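/- There exist a universal constant C > 0 and a function L that is polylogarithmic in K, S, A, H and 1/δ with the following property. In the partially adversarial setting where the λ adversarial steps form a known consecutive block {h̃₁, …, h̃₂ − 1} ⊆ [H−1] (with h̃₂ = h̃₁ + λ), and with bandit feedback, there is a learning algorithm (the sub-policy-based COMSP-OMD with η = γ = 1/√(S·K·A^{λ+1})) such that for every δ ∈ (0,1), with probability at least 1 − 9δ, its regret satisfies R_K ≤ C·L·( H·√(K·S³·A^{λ+1}) + H³·S²·A + √(H⁴·S²·A·K) ). -/

import Mathlib

open Finset

namespace AdvMDP

variable {S A : ℕ}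

/-- A per-step transition kernel: a probability distribution over next states
for every (state, action) pair. -/
def IsKernel (p : Fin S → Fin A → Fin S → ℝ) : Prop :=
  (∀ s a s', 0 ≤ p s a s') ∧ ∀ s a, ∑ s', p s a s' = 1

/-- A transition function for an `H`-step episode: a kernel for every step
`h` with `h + 1 < H` (the transition from step `h` to step `h+1`). -/
def IsTrans (H : ℕ) (p : ℕ → Fin S → Fin A → Fin S → ℝ) : Prop :=
  ∀ h, h + 1 < H → IsKernel (p h)

/-- A loss function for an `H`-step episode, with values in `[0,1]`. -/
def IsLoss (H : ℕ) (ℓ : ℕ → Fin S → Fin A → ℝ) : Prop :=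
  ∀ h s a, h < H → 0 ≤ ℓ h s a ∧ ℓ h s a ≤ 1

/-- A (stochastic) Markov policy. -/
def IsPolicy (π : ℕ → Fin S → Fin A → ℝ) : Prop :=
  (∀ h s a, 0 ≤ π h s a) ∧ ∀ h s, ∑ a, π h s a = 1

/-- The distribution over states at step `h` induced by a Markov policy `π`
under transitions `p`, starting from `sinit`. -/
noncomputable def stateDist (p : ℕ → Fin S → Fin A → Fin S → ℝ)
    (π : ℕ → Fin S → Fin A → ℝ) (sinit : Fin S) : ℕ → Fin S → ℝ
  | 0 => fun s => if s = sinit then 1 else 0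
  | h + 1 => fun s' => ∑ s, ∑ a, stateDist p π sinit h s * π h s a * p h s a s'

/-- The value `V₁^{π,p,ℓ}` of a Markov policy: the expected cumulative loss
over an `H`-step episode. -/
noncomputable def value (H : ℕ) (p : ℕ → Fin S → Fin A → Fin S → ℝ)
    (π : ℕ → Fin S → Fin A → ℝ) (ℓ : ℕ → Fin S → Fin A → ℝ) (sinit : Fin S) : ℝ :=
  ∑ h ∈ range H, ∑ s, ∑ a, stateDist p π sinit h s * π h s a * ℓ h s a

/-- The benchmark: the best cumulative value over `K` episodes achievable by a
fixed Markov policy. -/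
noncomputable def bestValue (H K : ℕ) (p : ℕ → ℕ → Fin S → Fin A → Fin S → ℝ)
    (ℓ : ℕ → ℕ → Fin S → Fin A → ℝ) (sinit : Fin S) : ℝ :=
  sInf {x : ℝ | ∃ π : ℕ → Fin S → Fin A → ℝ,
    IsPolicy π ∧ x = ∑ k ∈ range K, value H (p k) π (ℓ k) sinit}

/-- A strategy: a rule assigning to every within-episode trajectory prefix
(the list of past state-action pairs) and current state a distribution over
actions. -/
def IsStrategy (σ : List (Fin S × Fin A) → Fin S → Fin A → ℝ) : Prop :=
  (∀ t s a, 0 ≤ σ t s a) ∧ ∀ t s, ∑ a, σ t s a = 1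

/-- Probability that, starting at step `h` in state `s` with within-episode
history `hist`, the strategy `σ` under transitions `p` produces exactly the
remaining trajectory `rest`. -/
noncomputable def trajProb (p : ℕ → Fin S → Fin A → Fin S → ℝ)
    (σ : List (Fin S × Fin A) → Fin S → Fin A → ℝ) :
    ℕ → Fin S → List (Fin S × Fin A) → List (Fin S × Fin A) → ℝ
  | _, _, _, [] => 1
  | _, s, hist, [(s', a)] => if s' = s then σ hist s a else 0
  | h, s, hist, (s', a) :: (s'', a'') :: rest =>
      (if s' = s then σ hist s a else 0) * p h s' a s'' *
        trajProb p σ (h + 1) s'' (hist ++ [(s', a)]) ((s'', a'') :: rest)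

/-- Probability that strategy `σ` produces the full `H`-step trajectory `t`. -/
noncomputable def trajDist (H : ℕ) (p : ℕ → Fin S → Fin A → Fin S → ℝ)
    (σ : List (Fin S × Fin A) → Fin S → Fin A → ℝ) (sinit : Fin S)
    (t : Fin H → Fin S × Fin A) : ℝ :=
  trajProb p σ 0 sinit [] (List.ofFn t)

/-- Cumulative loss along a trajectory. -/
noncomputable def trajLoss (H : ℕ) (ℓ : ℕ → Fin S → Fin A → ℝ)
    (t : Fin H → Fin S × Fin A) : ℝ :=
  ∑ h : Fin H, ℓ h (t h).1 (t h).2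

/-- The value `V₁^{σ,p,ℓ}` of a history-dependent strategy. -/
noncomputable def stratValue (H : ℕ) (p : ℕ → Fin S → Fin A → Fin S → ℝ)
    (σ : List (Fin S × Fin A) → Fin S → Fin A → ℝ) (ℓ : ℕ → Fin S → Fin A → ℝ)
    (sinit : Fin S) : ℝ :=
  ∑ t : Fin H → Fin S × Fin A, trajDist H p σ sinit t * trajLoss H ℓ t

/-- A (randomized) learning algorithm with per-episode observations of type
`Obs`: a random seed (drawn once, with distribution `w`) together with a map
from the seed and the list of past observations to the strategy played in the
next episode. -/
structure Alg (S A : ℕ) (Obs : Type) where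
  w : ℕ → ℝ
  w_nonneg : ∀ i, 0 ≤ w i
  w_sum : ∑' i, w i = 1
  act : ℕ → List Obs → List (Fin S × Fin A) → Fin S → Fin A → ℝ
  act_strat : ∀ i past, IsStrategy (act i past)

/-- The strategy played by algorithm `alg` (with seed `i`) in episode `k`,
when the realized trajectories so far are `ts` and the per-episode
observations are produced by `obs`. -/
noncomputable def played {Obs : Type} {H K : ℕ} (alg : Alg S A Obs) (i : ℕ)
    (obs : ℕ → (Fin H → Fin S × Fin A) → Obs)
    (ts : Fin K → Fin H → Fin S × Fin A) (k : Fin K) :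
    List (Fin S × Fin A) → Fin S → Fin A → ℝ :=
  alg.act i (List.ofFn fun j : Fin (k : ℕ) =>
    obs (j : ℕ) (ts ⟨(j : ℕ), j.2.trans k.2⟩))

/-- The probability that the interaction of algorithm `alg` (with seed `i`)
with the episodic MDP `(p, obs)` produces the sequence of trajectories `ts`. -/
noncomputable def seqProb {Obs : Type} {H K : ℕ} (alg : Alg S A Obs) (i : ℕ)
    (p : ℕ → ℕ → Fin S → Fin A → Fin S → ℝ)
    (obs : ℕ → (Fin H → Fin S × Fin A) → Obs) (sinit : Fin S)
    (ts : Fin K → Fin H → Fin S × Fin A) : ℝ :=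
  ∏ k : Fin K, trajDist H (p k) (played alg i obs ts k) sinit (ts k)

/-- The realized total value `∑_k V₁^{π^k,p^k,ℓ^k}` of the strategies selected
by the algorithm along the history `(i, ts)`. -/
noncomputable def playedValue {Obs : Type} (H K : ℕ) (alg : Alg S A Obs) (i : ℕ)
    (p : ℕ → ℕ → Fin S → Fin A → Fin S → ℝ) (ℓ : ℕ → ℕ → Fin S → Fin A → ℝ)
    (obs : ℕ → (Fin H → Fin S × Fin A) → Obs) (sinit : Fin S)
    (ts : Fin K → Fin H → Fin S × Fin A) : ℝ :=
  ∑ k : Fin K, stratValue H (p k) (played alg i obs ts k) (ℓ k) sinit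

/-- `E[∑_k V₁^{π^k,p^k,ℓ^k}]`: the expectation, over the algorithm's seed and
the realized trajectories, of the total value of the selected strategies. -/
noncomputable def algValue {Obs : Type} (H K : ℕ) (alg : Alg S A Obs)
    (p : ℕ → ℕ → Fin S → Fin A → Fin S → ℝ) (ℓ : ℕ → ℕ → Fin S → Fin A → ℝ)
    (obs : ℕ → (Fin H → Fin S × Fin A) → Obs) (sinit : Fin S) : ℝ :=
  ∑' i : ℕ, alg.w i * ∑ ts : Fin K → Fin H → Fin S × Fin A,
    seqProb alg i p obs sinit ts * playedValue H K alg i p ℓ obs sinit ts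

/-- The expected regret `E[R_K]` of the algorithm. -/
noncomputable def expRegret {Obs : Type} (H K : ℕ) (alg : Alg S A Obs)
    (p : ℕ → ℕ → Fin S → Fin A → Fin S → ℝ) (ℓ : ℕ → ℕ → Fin S → Fin A → ℝ)
    (obs : ℕ → (Fin H → Fin S × Fin A) → Obs) (sinit : Fin S) : ℝ :=
  algValue H K alg p ℓ obs sinit - bestValue H K p ℓ sinit

open scoped Classical in
/-- The probability of an event `E` (a predicate of the seed and the realized
trajectories) under the interaction of `alg` with the episodic MDP. -/
noncomputable def eventProb {Obs : Type} (H K : ℕ) (alg : Alg S A Obs)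
    (p : ℕ → ℕ → Fin S → Fin A → Fin S → ℝ)
    (obs : ℕ → (Fin H → Fin S × Fin A) → Obs) (sinit : Fin S)
    (E : ℕ → (Fin K → Fin H → Fin S × Fin A) → Prop) : ℝ :=
  ∑' i : ℕ, alg.w i * ∑ ts : Fin K → Fin H → Fin S × Fin A,
    seqProb alg i p obs sinit ts * (if E i ts then 1 else 0)


/-- Observations with bandit feedback: the realized trajectory and the losses
along it. -/
abbrev BanditObs (S A H : ℕ) : Type :=
  (Fin H → Fin S × Fin A) × (Fin H → ℝ)

/-- The bandit observation map. -/
noncomputable def banditObs {S A : ℕ} (H : ℕ)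
    (ℓ : ℕ → ℕ → Fin S → Fin A → ℝ) :
    ℕ → (Fin H → Fin S × Fin A) → BanditObs S A H :=
  fun k t => (t, fun h => ℓ k h (t h).1 (t h).2)


/-! ### Weighted sums over paths -/

/-- The first state of a path `l` that ends in the state `x`. -/
def headState (l : List (Fin S × Fin A)) (x : Fin S) : Fin S :=
  match l with
  | [] => x
  | y :: _ => y.1

/-- The `W`-weighted sum of `F` over all paths of length `n` that start in state `s` at step `j`;
`F` receives the list of visited state-action pairs and the final state. -/
noncomputable def pathSum (W : ℕ → Fin S → Fin A → Fin S → ℝ) :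
    ℕ → ℕ → Fin S → (List (Fin S × Fin A) → Fin S → ℝ) → ℝ
  | 0, _, s, F => F [] s
  | n + 1, j, s, F =>
      ∑ a, ∑ s', W j s a s' * pathSum W n (j + 1) s' (fun l x => F ((s, a) :: l) x)

/-- The product of the weights `r` along a path that starts at step `j`. -/
noncomputable def pathProd (r : ℕ → Fin S → Fin A → ℝ) : ℕ → List (Fin S × Fin A) → ℝ
  | _, [] => 1
  | j, x :: l => r j x.1 x.2 * pathProd r (j + 1) l

/-- The sum of the weights `d` along a path that starts at step `j`. -/
noncomputable def pathAdd (d : ℕ → Fin S → Fin A → ℝ) : ℕ → List (Fin S × Fin A) → ℝ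
  | _, [] => 0
  | j, x :: l => d j x.1 x.2 + pathAdd d (j + 1) l

/-- The weighted number of paths of length `n` from `(j, s)` to the state `x`. -/
noncomputable def pathTo (W : ℕ → Fin S → Fin A → Fin S → ℝ) (n j : ℕ) (s x : Fin S) : ℝ :=
  pathSum W n j s (fun _ x' => if x' = x then 1 else 0)

theorem pathSum_congr (W : ℕ → Fin S → Fin A → Fin S → ℝ) {n j : ℕ} {s : Fin S}
    {F G : List (Fin S × Fin A) → Fin S → ℝ}
    (h : ∀ l x, l.length = n → headState l x = s → F l x = G l x) :
    pathSum W n j s F = pathSum W n j s G := by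
  induction n generalizing j s F G with
  | zero => exact h _ _ rfl rfl
  | succ n ih =>
    simp only [pathSum]
    refine sum_congr rfl fun a _ => sum_congr rfl fun s' _ => ?_
    rw [ih]
    intro l x hl _
    exact h _ _ (by simp [hl]) rfl

theorem pathSum_le_pathSum {W W' : ℕ → Fin S → Fin A → Fin S → ℝ} {n j : ℕ} {s : Fin S}
    {F G : List (Fin S × Fin A) → Fin S → ℝ}
    (hW : ∀ i, j ≤ i → i < j + n → ∀ s a x, 0 ≤ W i s a x)
    (hWW : ∀ i, j ≤ i → i < j + n → ∀ s a x, W i s a x ≤ W' i s a x)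
    (hG : ∀ l x, l.length = n → headState l x = s → 0 ≤ G l x)
    (h : ∀ l x, l.length = n → headState l x = s → F l x ≤ G l x) :
    pathSum W n j s F ≤ pathSum W' n j s G ∧ 0 ≤ pathSum W' n j s G := by
  induction n generalizing j s F G with
  | zero => exact ⟨h _ _ rfl rfl, hG _ _ rfl rfl⟩
  | succ n ih =>
    simp only [pathSum]
    have key : ∀ a s', pathSum W n (j + 1) s' (fun l x => F ((s, a) :: l) x) ≤
        pathSum W' n (j + 1) s' (fun l x => G ((s, a) :: l) x) ∧
        0 ≤ pathSum W' n (j + 1) s' (fun l x => G ((s, a) :: l) x) := by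
      intro a s'
      refine ih (fun i h1 h2 => hW i (by omega) (by omega))
        (fun i h1 h2 => hWW i (by omega) (by omega)) ?_ ?_
      · intro l x hl _; exact hG _ _ (by simp [hl]) rfl
      · intro l x hl _; exact h _ _ (by simp [hl]) rfl
    have h0 := fun s a x => hW j le_rfl (by omega) s a x
    have h1 := fun s a x => hWW j le_rfl (by omega) s a x
    constructor
    · refine sum_le_sum fun a _ => sum_le_sum fun s' _ => ?_
      calc _ ≤ W j s a s' * pathSum W' n (j + 1) s' (fun l x => G ((s, a) :: l) x) :=
            mul_le_mul_of_nonneg_left (key a s').1 (h0 _ _ _)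
        _ ≤ _ := mul_le_mul_of_nonneg_right (h1 _ _ _) (key a s').2
    · exact sum_nonneg fun a _ => sum_nonneg fun s' _ =>
        mul_nonneg ((h0 _ _ _).trans (h1 _ _ _)) (key a s').2

theorem pathSum_mono {W : ℕ → Fin S → Fin A → Fin S → ℝ} {n j : ℕ} {s : Fin S}
    {F G : List (Fin S × Fin A) → Fin S → ℝ}
    (hW : ∀ i s a x, 0 ≤ W i s a x)
    (h : ∀ l x, l.length = n → headState l x = s → F l x ≤ G l x) :
    pathSum W n j s F ≤ pathSum W n j s G := by
  induction n generalizing j s F G with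
  | zero => exact h _ _ rfl rfl
  | succ n ih =>
    simp only [pathSum]
    refine sum_le_sum fun a _ => sum_le_sum fun s' _ => mul_le_mul_of_nonneg_left (ih ?_) (hW _ _ _ _)
    intro l x hl _
    exact h _ _ (by simp [hl]) rfl

theorem pathSum_nonneg {W : ℕ → Fin S → Fin A → Fin S → ℝ} {n j : ℕ} {s : Fin S}
    {F : List (Fin S × Fin A) → Fin S → ℝ}
    (hW : ∀ i s a x, 0 ≤ W i s a x)
    (h : ∀ l x, l.length = n → headState l x = s → 0 ≤ F l x) :
    0 ≤ pathSum W n j s F := by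
  induction n generalizing j s F with
  | zero => exact h _ _ rfl rfl
  | succ n ih =>
    refine sum_nonneg fun a _ => sum_nonneg fun s' _ => mul_nonneg (hW _ _ _ _) (ih ?_)
    intro l x hl _
    exact h _ _ (by simp [hl]) rfl

theorem pathSum_congr_kernel {W W' : ℕ → Fin S → Fin A → Fin S → ℝ} {n j : ℕ} {s : Fin S}
    {F : List (Fin S × Fin A) → Fin S → ℝ}
    (hW : ∀ i, j ≤ i → i < j + n → W i = W' i) :
    pathSum W n j s F = pathSum W' n j s F := by
  induction n generalizing j s F with
  | zero => rfl
  | succ n ih =>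
    simp only [pathSum]
    refine sum_congr rfl fun a _ => sum_congr rfl fun s' _ => ?_
    rw [hW j le_rfl (by omega), ih (fun i h1 h2 => hW i (by omega) (by omega))]

theorem pathSum_add (W : ℕ → Fin S → Fin A → Fin S → ℝ) (n j : ℕ) (s : Fin S)
    (F G : List (Fin S × Fin A) → Fin S → ℝ) :
    pathSum W n j s (fun l x => F l x + G l x) = pathSum W n j s F + pathSum W n j s G := by
  induction n generalizing j s F G with
  | zero => rfl
  | succ n ih => simp only [pathSum, ih, mul_add, sum_add_distrib]

theorem pathSum_const_mul (W : ℕ → Fin S → Fin A → Fin S → ℝ) (n j : ℕ) (s : Fin S) (c : ℝ)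
    (F : List (Fin S × Fin A) → Fin S → ℝ) :
    pathSum W n j s (fun l x => c * F l x) = c * pathSum W n j s F := by
  induction n generalizing j s F with
  | zero => rfl
  | succ n ih =>
    simp only [pathSum, ih, mul_sum]
    exact sum_congr rfl fun a _ => sum_congr rfl fun s' _ => by ring

theorem pathSum_sum {ι : Type*} (I : Finset ι) (W : ℕ → Fin S → Fin A → Fin S → ℝ) (n j : ℕ)
    (s : Fin S) (F : ι → List (Fin S × Fin A) → Fin S → ℝ) :
    pathSum W n j s (fun l x => ∑ i ∈ I, F i l x) = ∑ i ∈ I, pathSum W n j s (F i) := by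
  induction n generalizing j s F with
  | zero => rfl
  | succ n ih =>
    simp only [pathSum, ih, mul_sum]
    rw [sum_comm]
    conv_rhs => rw [sum_comm]
    rw [sum_comm]
    exact sum_congr rfl fun a _ => sum_comm

theorem pathSum_append (W : ℕ → Fin S → Fin A → Fin S → ℝ) (m n j : ℕ) (s : Fin S)
    (F : List (Fin S × Fin A) → Fin S → ℝ) :
    pathSum W (m + n) j s F =
      pathSum W m j s (fun l x => pathSum W n (j + m) x (fun l' y => F (l ++ l') y)) := by
  induction m generalizing j s F with
  | zero => simp [pathSum]
  | succ m ih =>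
    have : m + 1 + n = (m + n) + 1 := by omega
    rw [this]
    simp only [pathSum, ih]
    have : j + 1 + m = j + (m + 1) := by omega
    simp [this]

theorem pathSum_mul_weight (W : ℕ → Fin S → Fin A → Fin S → ℝ) (r : ℕ → Fin S → Fin A → ℝ)
    (n j : ℕ) (s : Fin S) (F : List (Fin S × Fin A) → Fin S → ℝ) :
    pathSum (fun j s a x => r j s a * W j s a x) n j s F =
      pathSum W n j s (fun l x => pathProd r j l * F l x) := by
  induction n generalizing j s F with
  | zero => simp [pathSum, pathProd]
  | succ n ih =>
    simp only [pathSum, pathProd, ih]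
    refine sum_congr rfl fun a _ => sum_congr rfl fun s' _ => ?_
    rw [← pathSum_const_mul, ← pathSum_const_mul]
    congr 1; funext l x; ring

theorem pathSum_eq_sum_pathTo (W : ℕ → Fin S → Fin A → Fin S → ℝ) (n j : ℕ) (s : Fin S)
    (g : Fin S → ℝ) :
    pathSum W n j s (fun _ x => g x) = ∑ x, pathTo W n j s x * g x := by
  have : (fun (_ : List (Fin S × Fin A)) x => g x) =
      fun _ x => ∑ y, g y * (if x = y then 1 else 0) := by
    funext _ x; simp
  rw [this, pathSum_sum]
  refine sum_congr rfl fun y _ => ?_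
  rw [pathSum_const_mul, mul_comm]; rfl

theorem pathSum_const {W : ℕ → Fin S → Fin A → Fin S → ℝ} (n j : ℕ) (s : Fin S) (c : ℝ)
    (hW : ∀ i s, ∑ a, ∑ x, W i s a x = 1) :
    pathSum W n j s (fun _ _ => c) = c := by
  induction n generalizing j s with
  | zero => rfl
  | succ n ih => simp only [pathSum, ih, ← sum_mul, hW, one_mul]

theorem pathSum_one_le {W : ℕ → Fin S → Fin A → Fin S → ℝ} (n j : ℕ) (s : Fin S)
    (h0 : ∀ i s a x, 0 ≤ W i s a x) (hW : ∀ i s, ∑ a, ∑ x, W i s a x ≤ 1) :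
    pathSum W n j s (fun _ _ => 1) ≤ 1 := by
  induction n generalizing j s with
  | zero => exact le_rfl
  | succ n ih =>
    refine le_trans ?_ (hW j s)
    exact sum_le_sum fun a _ => sum_le_sum fun x _ => mul_le_of_le_one_right (h0 _ _ _ _) (ih _ _)

theorem pathAdd_nonneg {d : ℕ → Fin S → Fin A → ℝ} (hd : ∀ j s a, 0 ≤ d j s a) (j : ℕ)
    (l : List (Fin S × Fin A)) : 0 ≤ pathAdd d j l := by
  induction l generalizing j with
  | nil => exact le_rfl
  | cons x l ih => exact add_nonneg (hd _ _ _) (ih _)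

/-- The mass lost by a killed kernel is at most the expected cumulative killing rate. -/
theorem one_sub_pathSum_le {W W' : ℕ → Fin S → Fin A → Fin S → ℝ} {d : ℕ → Fin S → Fin A → ℝ}
    (hd : ∀ j s a, 0 ≤ d j s a) (h0 : ∀ i s a x, 0 ≤ W' i s a x)
    (hWW : ∀ i s a x, W' i s a x ≤ W i s a x) (hW : ∀ i s, ∑ a, ∑ x, W i s a x = 1)
    (hW' : ∀ i s a, (∑ x, W i s a x) * (1 - d i s a) ≤ ∑ x, W' i s a x)
    (n j : ℕ) (s : Fin S) :
    1 - pathSum W' n j s (fun _ _ => 1) ≤ pathSum W n j s (fun l _ => pathAdd d j l) := by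
  induction n generalizing j s with
  | zero => simp [pathSum, pathAdd]
  | succ n ih =>
    simp only [pathSum, pathAdd]
    have h1 : ∀ a x, W' j s a x - W j s a x * pathSum W n (j + 1) x (fun l _ => pathAdd d (j + 1) l)
        ≤ W' j s a x * pathSum W' n (j + 1) x (fun _ _ => 1) := by
      intro a x
      have hD : 0 ≤ pathSum W n (j + 1) x (fun l _ => pathAdd d (j + 1) l) :=
        pathSum_nonneg (fun i s a x => (h0 _ _ _ _).trans (hWW _ _ _ _))
          fun l _ _ _ => pathAdd_nonneg hd _ _
      have := mul_le_mul_of_nonneg_right (hWW j s a x) hD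
      have := mul_le_mul_of_nonneg_left (ih (j + 1) x) (h0 j s a x)
      nlinarith
    have h2 : ∑ a, ∑ x, W' j s a x - ∑ a, ∑ x, W j s a x *
          pathSum W n (j + 1) x (fun l _ => pathAdd d (j + 1) l)
        ≤ ∑ a, ∑ x, W' j s a x * pathSum W' n (j + 1) x (fun _ _ => 1) := by
      simp only [← sum_sub_distrib]
      exact sum_le_sum fun a _ => sum_le_sum fun x _ => h1 a x
    have h3 : 1 - ∑ a, ∑ x, W j s a x * d j s a ≤ ∑ a, ∑ x, W' j s a x := by
      rw [← hW j s, ← sum_sub_distrib]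
      refine sum_le_sum fun a _ => le_trans (le_of_eq ?_) (hW' j s a)
      rw [← sum_mul]; ring
    have h4 : ∀ a x, W j s a x * pathSum W n (j + 1) x
          (fun l _ => d j s a + pathAdd d (j + 1) l) =
        W j s a x * d j s a + W j s a x * pathSum W n (j + 1) x (fun l _ => pathAdd d (j + 1) l) := by
      intro a x
      rw [pathSum_add, pathSum_const _ _ _ _ hW]; ring
    simp only [h4, sum_add_distrib]
    linarith

/-! ### Deterministic policies and classes of trajectories -/

/-- The weight of an action under a deterministic policy. -/
noncomputable def detW (f : ℕ → Fin S → Fin A) (j : ℕ) (s : Fin S) (a : Fin A) : ℝ :=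
  if f j s = a then 1 else 0

/-- The kernel on state-action pairs induced by a transition `p` and a deterministic policy. -/
noncomputable def polK (p : ℕ → Fin S → Fin A → Fin S → ℝ) (f : ℕ → Fin S → Fin A)
    (j : ℕ) (s : Fin S) (a : Fin A) (x : Fin S) : ℝ :=
  detW f j s a * p j s a x

/-- The part of a trajectory that is relevant at a layer: the segment on the adversarial block,
the state after the block, and the final state-action pair. -/
abbrev Cls (S A : ℕ) : Type := List (Fin S × Fin A) × Fin S × Fin S × Fin A

/-- The class of a trajectory at layer `b + m + n`, where `[b, b + m)` is the block. -/
def clsOf (d : Fin S × Fin A) (b m n : ℕ) (L : List (Fin S × Fin A)) : Cls S A :=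
  ((L.drop b).take m, (L.getD (b + m) d).1, L.getD (b + m + n) d)

/-- The probability of a class under the kernel `R` outside the block, up to the transition
probabilities on the block. -/
noncomputable def clsProb (s0 : Fin S) (b m n : ℕ) (R : ℕ → Fin S → Fin A → Fin S → ℝ)
    (f : ℕ → Fin S → Fin A) (c : Cls S A) : ℝ :=
  pathTo (polK R f) b 0 s0 (headState c.1 c.2.1) * pathProd (detW f) b c.1 *
    (pathTo (polK R f) n (b + m) c.2.1 c.2.2.1 * detW f (b + m + n) c.2.2.1 c.2.2.2)

/-- Summation over classes, weighted by the transition probabilities on the block. -/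
noncomputable def clsSum (p : ℕ → Fin S → Fin A → Fin S → ℝ) (b m : ℕ) (F : Cls S A → ℝ) : ℝ :=
  ∑ y, pathSum p m b y (fun seg x => ∑ s, ∑ a, F (seg, x, s, a))

theorem detW_nonneg (f : ℕ → Fin S → Fin A) (j : ℕ) (s : Fin S) (a : Fin A) :
    0 ≤ detW f j s a := by
  unfold detW; split_ifs <;> norm_num

theorem sum_detW (f : ℕ → Fin S → Fin A) (j : ℕ) (s : Fin S) : ∑ a, detW f j s a = 1 := by
  simp [detW]

theorem sum_detW_mul (f : ℕ → Fin S → Fin A) (j : ℕ) (s : Fin S) (g : Fin A → ℝ) :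
    ∑ a, detW f j s a * g a = g (f j s) := by
  simp [detW]

theorem polK_nonneg {p : ℕ → Fin S → Fin A → Fin S → ℝ} (hp : ∀ j s a x, 0 ≤ p j s a x)
    (f : ℕ → Fin S → Fin A) (j : ℕ) (s : Fin S) (a : Fin A) (x : Fin S) :
    0 ≤ polK p f j s a x :=
  mul_nonneg (detW_nonneg _ _ _ _) (hp _ _ _ _)

theorem sum_polK (p : ℕ → Fin S → Fin A → Fin S → ℝ) (f : ℕ → Fin S → Fin A) (j : ℕ) (s : Fin S) :
    ∑ a, ∑ x, polK p f j s a x = ∑ x, p j s (f j s) x := by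
  simp only [polK, ← mul_sum, sum_detW_mul]

theorem sum_polK_eq_one {p : ℕ → Fin S → Fin A → Fin S → ℝ} (hp : ∀ j, IsKernel (p j))
    (f : ℕ → Fin S → Fin A) (j : ℕ) (s : Fin S) : ∑ a, ∑ x, polK p f j s a x = 1 := by
  rw [sum_polK]; exact (hp j).2 _ _

theorem pathProd_detW_nonneg (f : ℕ → Fin S → Fin A) (j : ℕ) (l : List (Fin S × Fin A)) :
    0 ≤ pathProd (detW f) j l := by
  induction l generalizing j with
  | nil => exact zero_le_one
  | cons x l ih => exact mul_nonneg (detW_nonneg _ _ _ _) (ih _)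

theorem pathTo_nonneg {W : ℕ → Fin S → Fin A → Fin S → ℝ} (hW : ∀ i s a x, 0 ≤ W i s a x)
    (n j : ℕ) (s x : Fin S) : 0 ≤ pathTo W n j s x :=
  pathSum_nonneg hW fun l x' _ _ => by split_ifs <;> norm_num

theorem clsProb_nonneg (s0 : Fin S) (b m n : ℕ) {R : ℕ → Fin S → Fin A → Fin S → ℝ}
    (hR : ∀ j s a x, 0 ≤ R j s a x) (f : ℕ → Fin S → Fin A) (c : Cls S A) :
    0 ≤ clsProb s0 b m n R f c :=
  mul_nonneg (mul_nonneg (pathTo_nonneg (polK_nonneg hR f) _ _ _ _) (pathProd_detW_nonneg _ _ _))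
    (mul_nonneg (pathTo_nonneg (polK_nonneg hR f) _ _ _ _) (detW_nonneg _ _ _ _))

theorem pathTo_le_pathTo {W W' : ℕ → Fin S → Fin A → Fin S → ℝ} {n j : ℕ}
    (hW : ∀ i, j ≤ i → i < j + n → ∀ s a x, 0 ≤ W i s a x)
    (hWW : ∀ i, j ≤ i → i < j + n → ∀ s a x, W i s a x ≤ W' i s a x) (s x : Fin S) :
    pathTo W n j s x ≤ pathTo W' n j s x :=
  (pathSum_le_pathSum hW hWW (fun l x' _ _ => by split_ifs <;> norm_num) fun _ _ _ _ => le_rfl).1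

/-- The class probability is monotone in the kernel outside the block. -/
theorem clsProb_mono (s0 : Fin S) (b m n : ℕ) {R R' : ℕ → Fin S → Fin A → Fin S → ℝ}
    (hR : ∀ j s a x, 0 ≤ R j s a x) (hR' : ∀ j s a x, 0 ≤ R' j s a x)
    (h : ∀ j, (j < b ∨ b + m ≤ j ∧ j < b + m + n) → ∀ s a x, R j s a x ≤ R' j s a x)
    (f : ℕ → Fin S → Fin A) (c : Cls S A) :
    clsProb s0 b m n R f c ≤ clsProb s0 b m n R' f c := by
  unfold clsProb
  have h1 : ∀ s x, pathTo (polK R f) b 0 s x ≤ pathTo (polK R' f) b 0 s x :=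
    pathTo_le_pathTo (fun i _ _ => polK_nonneg hR f i) fun i _ hi s a x =>
      mul_le_mul_of_nonneg_left (h i (by omega) s a x) (detW_nonneg _ _ _ _)
  have h2 : ∀ s x, pathTo (polK R f) n (b + m) s x ≤ pathTo (polK R' f) n (b + m) s x :=
    pathTo_le_pathTo (fun i _ _ => polK_nonneg hR f i) fun i _ hi s a x =>
      mul_le_mul_of_nonneg_left (h i (by omega) s a x) (detW_nonneg _ _ _ _)
  have n1 := fun s x => pathTo_nonneg (polK_nonneg hR f) b 0 s x
  have n2 := fun s x => pathTo_nonneg (polK_nonneg hR f) n (b + m) s x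
  have n1' := fun s x => pathTo_nonneg (polK_nonneg hR' f) b 0 s x
  have d := pathProd_detW_nonneg f b c.1
  have d' := detW_nonneg f (b + m + n) c.2.2.1 c.2.2.2
  exact mul_le_mul (mul_le_mul_of_nonneg_right (h1 _ _) d) (mul_le_mul_of_nonneg_right (h2 _ _) d')
    (mul_nonneg (n2 _ _) d') (mul_nonneg (n1' _ _) d)

section clsSum
variable {p : ℕ → Fin S → Fin A → Fin S → ℝ} {b m : ℕ}

theorem clsSum_mono (hp : ∀ j s a x, 0 ≤ p j s a x) {F G : Cls S A → ℝ}
    (h : ∀ c : Cls S A, c.1.length = m → F c ≤ G c) : clsSum p b m F ≤ clsSum p b m G :=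
  sum_le_sum fun _ _ => pathSum_mono hp fun _ _ hl _ =>
    sum_le_sum fun _ _ => sum_le_sum fun _ _ => h _ hl

theorem clsSum_congr {F G : Cls S A → ℝ}
    (h : ∀ c : Cls S A, c.1.length = m → F c = G c) : clsSum p b m F = clsSum p b m G :=
  sum_congr rfl fun _ _ => pathSum_congr p fun _ _ hl _ =>
    sum_congr rfl fun _ _ => sum_congr rfl fun _ _ => h _ hl

theorem clsSum_const_mul (c : ℝ) (F : Cls S A → ℝ) :
    clsSum p b m (fun x => c * F x) = c * clsSum p b m F := by
  simp only [clsSum, ← mul_sum, pathSum_const_mul]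

theorem clsSum_add (F G : Cls S A → ℝ) :
    clsSum p b m (fun x => F x + G x) = clsSum p b m F + clsSum p b m G := by
  simp only [clsSum, sum_add_distrib, pathSum_add]

theorem clsSum_sub (F G : Cls S A → ℝ) :
    clsSum p b m (fun x => F x - G x) = clsSum p b m F - clsSum p b m G := by
  have := clsSum_add (p := p) (b := b) (m := m) (fun x => F x - G x) G
  simp only [sub_add_cancel] at this
  linarith [this]

theorem clsSum_sum {ι : Type*} (I : Finset ι) (F : ι → Cls S A → ℝ) :
    clsSum p b m (fun x => ∑ i ∈ I, F i x) = ∑ i ∈ I, clsSum p b m (F i) := by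
  simp only [clsSum]
  rw [sum_comm]
  refine sum_congr rfl fun y _ => ?_
  rw [← pathSum_sum]
  congr 1; funext seg x
  conv_rhs => rw [sum_comm]
  exact sum_congr rfl fun s _ => sum_comm

theorem clsSum_nonneg (hp : ∀ j s a x, 0 ≤ p j s a x) {F : Cls S A → ℝ} (h : ∀ c, 0 ≤ F c) :
    0 ≤ clsSum p b m F :=
  sum_nonneg fun _ _ => pathSum_nonneg hp fun _ _ _ _ =>
    sum_nonneg fun _ _ => sum_nonneg fun _ _ => h _

theorem clsSum_one (hp : ∀ j, IsKernel (p j)) :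
    clsSum p b m (fun _ => 1) = (S : ℝ) * A ^ m * (S * A) := by
  have key : ∀ m b y (c : ℝ), pathSum p m b y (fun _ _ => c) = (A : ℝ) ^ m * c := by
    intro m
    induction m with
    | zero => intro b y c; simp [pathSum]
    | succ m ih =>
      intro b y c
      simp only [pathSum, ih, ← sum_mul, (hp _).2]
      simp [pow_succ]; ring
  simp only [clsSum, key]
  simp; ring

end clsSum

/-- The law of the class of a trajectory. -/
theorem pathSum_clsOf (d : Fin S × Fin A) (s0 : Fin S) (b m n : ℕ)
    {W R p : ℕ → Fin S → Fin A → Fin S → ℝ} (f : ℕ → Fin S → Fin A) (F : Cls S A → ℝ)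
    (h1 : ∀ i < b, W i = R i) (h2 : ∀ i, b ≤ i → i < b + m → W i = p i)
    (h3 : ∀ i, b + m ≤ i → i < b + m + n → W i = R i) :
    pathSum (polK W f) (b + m + n) 0 s0 (fun l x => ∑ a, detW f (b + m + n) x a *
      F (clsOf d b m n (l ++ [(x, a)]))) =
    clsSum p b m (fun c => clsProb s0 b m n R f c * F c) := by
  rw [pathSum_append, pathSum_append]
  have hk : ∀ {n j : ℕ} {s : Fin S} {G : List (Fin S × Fin A) → Fin S → ℝ}
      {R : ℕ → Fin S → Fin A → Fin S → ℝ},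
      (∀ i, j ≤ i → i < j + n → W i = R i) →
      pathSum (polK W f) n j s G = pathSum (polK R f) n j s G := by
    intro n j s G R h
    refine pathSum_congr_kernel fun i hi hi' => ?_
    unfold polK; rw [h i hi hi']
  rw [hk (R := R) (fun i _ hi => h1 i (by omega))]
  have step : pathSum (polK R f) b 0 s0 (fun l1 y => pathSum (polK W f) m (0 + b) y fun seg x =>
      pathSum (polK W f) n (0 + (b + m)) x fun l3 s => ∑ a, detW f (b + m + n) s a *
        F (clsOf d b m n (l1 ++ seg ++ l3 ++ [(s, a)]))) =
      pathSum (polK R f) b 0 s0 (fun _ y => pathSum p m b y fun seg x =>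
        pathProd (detW f) b seg * ∑ s, pathTo (polK R f) n (b + m) x s *
          ∑ a, detW f (b + m + n) s a * F (seg, x, s, a)) := by
    refine pathSum_congr _ fun l1 y hl1 _ => ?_
    rw [zero_add, zero_add, hk (R := p) h2, ← pathSum_mul_weight]
    refine pathSum_congr _ fun seg x hseg _ => ?_
    rw [hk (R := R) h3, ← pathSum_eq_sum_pathTo]
    refine pathSum_congr _ fun l3 s hl3 hx => ?_
    refine sum_congr rfl fun a _ => ?_
    congr 2
    unfold clsOf
    have e1 : (List.drop b (l1 ++ seg ++ l3 ++ [(s, a)])).take m = seg := by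
      subst hl1 hseg
      simp [List.append_assoc]
    have e2 : ((l1 ++ seg ++ l3 ++ [(s, a)]).getD (b + m) d).1 = x := by
      subst hl1 hseg
      cases l3 with
      | nil => simp at hx ⊢; simpa [headState] using hx
      | cons z l3 => simp at hx ⊢; simpa [headState] using hx
    have e3 : (l1 ++ seg ++ l3 ++ [(s, a)]).getD (b + m + n) d = (s, a) := by
      subst hl1 hseg hl3
      rw [List.getD_append_right _ _ _ _ (by simp; omega)]
      simp [add_assoc]
    rw [e1, e2, e3]
  refine Eq.trans ?_ (step.trans ?_)
  · simp [List.append_assoc]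
  rw [pathSum_eq_sum_pathTo]
  unfold clsSum
  refine sum_congr rfl fun y _ => ?_
  rw [← pathSum_const_mul]
  refine pathSum_congr _ fun seg x _ hx => ?_
  simp only [clsProb, hx, mul_sum]
  exact sum_congr rfl fun s _ => sum_congr rfl fun a _ => by ring

/-- A function of the first `h + 1` state-action pairs does not depend on later steps. -/
theorem pathSum_take {p : ℕ → Fin S → Fin A → Fin S → ℝ} (hp : ∀ j, IsKernel (p j))
    (s0 : Fin S) {q : ℕ → Fin S → Fin A → ℝ} (hq : ∀ j s, ∑ a, q j s a = 1) (h n : ℕ)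
    (G : List (Fin S × Fin A) → ℝ) :
    pathSum (fun j s a x => q j s a * p j s a x) (h + 1 + n) 0 s0
        (fun l _ => G (l.take (h + 1))) =
      pathSum (fun j s a x => q j s a * p j s a x) h 0 s0
        (fun l x => ∑ a, q h x a * G (l ++ [(x, a)])) := by
  rw [pathSum_append, pathSum_append]
  refine pathSum_congr _ fun l x hl _ => ?_
  simp only [pathSum]
  refine sum_congr rfl fun a _ => ?_
  have : ∀ s', pathSum (fun j s a x => q j s a * p j s a x) n (0 + (h + 1)) s'
      (fun l' _ => G (List.take (h + 1) (l ++ [(x, a)] ++ l'))) = G (l ++ [(x, a)]) := by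
    intro s'
    rw [← pathSum_const (W := fun j s a x => q j s a * p j s a x) n (0 + (h + 1)) s'
      (G (l ++ [(x, a)])) fun i s => by simp only [← mul_sum, (hp i).2, mul_one, hq]]
    refine pathSum_congr _ fun l' _ _ _ => ?_
    congr 1
    subst hl
    rw [List.take_append_of_le_length (by simp), List.take_of_length_le (by simp)]
  simp only [this, ← sum_mul]
  simp only [zero_add, ← mul_sum, (hp h).2, mul_one]

/-! ### Trajectories -/

/-- The contribution of the transitions to the probability of a path. -/
noncomputable def transW (p : ℕ → Fin S → Fin A → Fin S → ℝ) :
    ℕ → Fin S → List (Fin S × Fin A) → ℝ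
  | _, _, [] => 1
  | j, s, x :: l => (if x.1 = s then 1 else 0) * ∑ s', p j x.1 x.2 s' * transW p (j + 1) s' l

/-- The contribution of the strategy to the probability of a path. -/
noncomputable def actW (σ : List (Fin S × Fin A) → Fin S → Fin A → ℝ) :
    List (Fin S × Fin A) → List (Fin S × Fin A) → ℝ
  | _, [] => 1
  | hist, x :: l => σ hist x.1 x.2 * actW σ (hist ++ [x]) l

theorem sum_ofFn_succ {X : Type*} [Fintype X] (n : ℕ) (G : List X → ℝ) :
    ∑ t : Fin (n + 1) → X, G (List.ofFn t) = ∑ x, ∑ t : Fin n → X, G (x :: List.ofFn t) := by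
  rw [← (Fin.consEquiv fun _ : Fin (n + 1) => X).sum_comp, Fintype.sum_prod_type]
  simp [Fin.consEquiv, List.ofFn_succ]

theorem sum_traj_eq_pathSum (p : ℕ → Fin S → Fin A → Fin S → ℝ) (q : ℕ → Fin S → Fin A → ℝ)
    (n j : ℕ) (s : Fin S) (F : List (Fin S × Fin A) → ℝ) :
    ∑ t : Fin n → Fin S × Fin A,
        pathProd q j (List.ofFn t) * transW p j s (List.ofFn t) * F (List.ofFn t) =
      pathSum (fun j s a x => q j s a * p j s a x) n j s (fun l _ => F l) := by
  induction n generalizing j s F with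
  | zero => simp [pathSum, pathProd, transW]
  | succ n ih =>
    rw [sum_ofFn_succ n (fun l => pathProd q j l * transW p j s l * F l), Fintype.sum_prod_type]
    simp only [pathSum, ← ih]
    rw [sum_eq_single s]
    · refine sum_congr rfl fun a _ => ?_
      simp only [pathProd, transW, if_true, one_mul, mul_sum, sum_mul]
      rw [sum_comm]
      exact sum_congr rfl fun s' _ => sum_congr rfl fun t _ => by ring
    · intro s' _ hs'
      simp [transW, hs']
    · simp

theorem trajProb_eq {p : ℕ → Fin S → Fin A → Fin S → ℝ} (hp : ∀ j, IsKernel (p j))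
    (σ : List (Fin S × Fin A) → Fin S → Fin A → ℝ) (j : ℕ) (s : Fin S)
    (hist l : List (Fin S × Fin A)) :
    trajProb p σ j s hist l = actW σ hist l * transW p j s l := by
  induction l generalizing j s hist with
  | nil => simp [trajProb, actW, transW]
  | cons x r ih =>
    obtain ⟨s', a⟩ := x
    cases r with
    | nil =>
      simp only [trajProb, actW, transW, mul_one, (hp j).2]
      split_ifs with h
      · simp [h]
      · simp
    | cons y r =>
      obtain ⟨s'', a''⟩ := y
      rw [trajProb, ih]
      simp only [actW, transW]
      have : ∀ x, p j s' a x * ((if s'' = x then 1 else 0) *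
          ∑ z, p (j + 1) s'' a'' z * transW p (j + 1 + 1) z r) =
          if s'' = x then p j s' a s'' * ∑ z, p (j + 1) s'' a'' z * transW p (j + 1 + 1) z r
            else 0 := by
        intro x; split_ifs with h
        · rw [h]; ring
        · ring
      simp only [this, sum_ite_eq, mem_univ, if_true]
      split_ifs with h
      · rw [h]; ring
      · ring

/-! ### Mixtures of deterministic policies -/

section mix
variable {ι : Type*} [Fintype ι] (pol : ι → ℕ → Fin S → Fin A)

/-- The weight of the policies compatible with a path. -/
noncomputable def mixW (P : ι → ℝ) (l : List (Fin S × Fin A)) : ℝ :=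
  ∑ i, P i * pathProd (detW (pol i)) 0 l

open scoped Classical in
/-- The strategy that draws a deterministic policy from `P` and follows it. -/
noncomputable def mixStrat (a0 : Fin A) (P : ι → ℝ) (hist : List (Fin S × Fin A)) (s : Fin S)
    (a : Fin A) : ℝ :=
  if mixW pol P hist = 0 then (if a = a0 then 1 else 0)
  else mixW pol P (hist ++ [(s, a)]) / mixW pol P hist

theorem pathProd_append (r : ℕ → Fin S → Fin A → ℝ) (j : ℕ) (l l' : List (Fin S × Fin A)) :
    pathProd r j (l ++ l') = pathProd r j l * pathProd r (j + l.length) l' := by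
  induction l generalizing j with
  | nil => simp [pathProd]
  | cons x l ih =>
    simp only [List.cons_append, pathProd, ih, List.length_cons]
    rw [show j + 1 + l.length = j + (l.length + 1) by omega]; ring

theorem mixW_nonneg {P : ι → ℝ} (hP : ∀ i, 0 ≤ P i) (l : List (Fin S × Fin A)) :
    0 ≤ mixW pol P l :=
  sum_nonneg fun i _ => mul_nonneg (hP i) (pathProd_detW_nonneg _ _ _)

theorem sum_mixW (P : ι → ℝ) (l : List (Fin S × Fin A)) (s : Fin S) :
    ∑ a, mixW pol P (l ++ [(s, a)]) = mixW pol P l := by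
  simp only [mixW]
  rw [sum_comm]
  simp only [pathProd_append, pathProd, mul_one, ← mul_sum, sum_detW]

theorem mixStrat_isStrategy (a0 : Fin A) {P : ι → ℝ} (hP : ∀ i, 0 ≤ P i) :
    IsStrategy (mixStrat pol a0 P) := by
  constructor
  · intro t s a
    unfold mixStrat
    split_ifs
    · norm_num
    · norm_num
    · exact div_nonneg (mixW_nonneg pol hP _) (mixW_nonneg pol hP _)
  · intro t s
    unfold mixStrat
    split_ifs with h
    · simp
    · rw [← sum_div, sum_mixW, div_self h]

theorem actW_mixStrat (a0 : Fin A) {P : ι → ℝ} (hP : ∀ i, 0 ≤ P i)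
    (hist l : List (Fin S × Fin A)) :
    actW (mixStrat pol a0 P) hist l * mixW pol P hist = mixW pol P (hist ++ l) := by
  induction l generalizing hist with
  | nil => simp [actW]
  | cons x l ih =>
    have hx : mixStrat pol a0 P hist x.1 x.2 * mixW pol P hist = mixW pol P (hist ++ [x]) := by
      unfold mixStrat
      split_ifs with h h'
      · rw [h, mul_zero]
        have := sum_mixW pol P hist x.1
        rw [h] at this
        exact ((sum_eq_zero_iff_of_nonneg fun a _ => mixW_nonneg pol hP _).1 this x.2
          (mem_univ _)).symm
      · rw [h, mul_zero]
        have := sum_mixW pol P hist x.1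
        rw [h] at this
        exact ((sum_eq_zero_iff_of_nonneg fun a _ => mixW_nonneg pol hP _).1 this x.2
          (mem_univ _)).symm
      · exact div_mul_cancel₀ _ h
    have : hist ++ x :: l = hist ++ [x] ++ l := by simp
    rw [this, ← ih, ← hx, actW]; ring

theorem trajDist_mixStrat {p : ℕ → Fin S → Fin A → Fin S → ℝ} (hp : ∀ j, IsKernel (p j))
    (a0 : Fin A) {P : ι → ℝ} (hP : ∀ i, 0 ≤ P i) (hP1 : ∑ i, P i = 1) (H : ℕ) (s0 : Fin S)
    (t : Fin H → Fin S × Fin A) :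
    trajDist H p (mixStrat pol a0 P) s0 t =
      ∑ i, P i * (pathProd (detW (pol i)) 0 (List.ofFn t) * transW p 0 s0 (List.ofFn t)) := by
  have h := actW_mixStrat pol a0 hP [] (List.ofFn t)
  have h1 : mixW pol P ([] : List (Fin S × Fin A)) = 1 := by simp [mixW, pathProd, hP1]
  rw [h1, mul_one, List.nil_append] at h
  rw [trajDist, trajProb_eq hp, h, mixW, sum_mul]
  exact sum_congr rfl fun i _ => by ring

theorem sum_trajDist_mixStrat {p : ℕ → Fin S → Fin A → Fin S → ℝ} (hp : ∀ j, IsKernel (p j))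
    (a0 : Fin A) {P : ι → ℝ} (hP : ∀ i, 0 ≤ P i) (hP1 : ∑ i, P i = 1) (H : ℕ) (s0 : Fin S)
    (F : List (Fin S × Fin A) → ℝ) :
    ∑ t : Fin H → Fin S × Fin A, trajDist H p (mixStrat pol a0 P) s0 t * F (List.ofFn t) =
      ∑ i, P i * pathSum (polK p (pol i)) H 0 s0 (fun l _ => F l) := by
  simp only [trajDist_mixStrat pol hp a0 hP hP1, sum_mul]
  rw [sum_comm]
  refine sum_congr rfl fun i _ => ?_
  have := sum_traj_eq_pathSum p (detW (pol i)) H 0 s0 F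
  rw [show (polK p (pol i)) = fun j s a x => detW (pol i) j s a * p j s a x from rfl, ← this,
    mul_sum]
  exact sum_congr rfl fun t _ => by ring

end mix

/-! ### Values of policies -/

/-- The expected loss at layer `h` of the policy `q`. -/
noncomputable def layerVal (p : ℕ → Fin S → Fin A → Fin S → ℝ) (q : ℕ → Fin S → Fin A → ℝ)
    (ℓ : ℕ → Fin S → Fin A → ℝ) (s0 : Fin S) (h : ℕ) : ℝ :=
  pathSum (fun j s a x => q j s a * p j s a x) h 0 s0 (fun _ x => ∑ a, q h x a * ℓ h x a)

theorem trajLoss_eq (d : Fin S × Fin A) (H : ℕ) (ℓ : ℕ → Fin S → Fin A → ℝ)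
    (t : Fin H → Fin S × Fin A) :
    trajLoss H ℓ t = ∑ h ∈ range H,
      ℓ h (((List.ofFn t).take (h + 1)).getD h d).1 (((List.ofFn t).take (h + 1)).getD h d).2 := by
  rw [trajLoss, ← Fin.sum_univ_eq_sum_range (fun h => ℓ h (((List.ofFn t).take (h + 1)).getD h d).1
    (((List.ofFn t).take (h + 1)).getD h d).2)]
  refine sum_congr rfl fun h _ => ?_
  have : ((List.ofFn t).take (h + 1)).getD h d = t h := by
    rw [List.getD_eq_getElem _ _ (by simp)]
    simp
  rw [this]

theorem sum_traj_trajLoss {p : ℕ → Fin S → Fin A → Fin S → ℝ} (hp : ∀ j, IsKernel (p j))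
    {q : ℕ → Fin S → Fin A → ℝ} (hq : ∀ j s, ∑ a, q j s a = 1) (d : Fin S × Fin A) (H : ℕ)
    (ℓ : ℕ → Fin S → Fin A → ℝ) (s0 : Fin S) :
    ∑ t : Fin H → Fin S × Fin A, pathProd q 0 (List.ofFn t) * transW p 0 s0 (List.ofFn t) *
        trajLoss H ℓ t = ∑ h ∈ range H, layerVal p q ℓ s0 h := by
  simp only [trajLoss_eq d, mul_sum]
  rw [sum_comm]
  refine sum_congr rfl fun h hh => ?_
  have hh : h < H := mem_range.1 hh
  obtain ⟨n, rfl⟩ : ∃ n, H = h + 1 + n := ⟨H - (h + 1), by omega⟩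
  rw [sum_traj_eq_pathSum p q (h + 1 + n) 0 s0 (fun l => ℓ h ((l.take (h + 1)).getD h d).1
    ((l.take (h + 1)).getD h d).2), pathSum_take hp s0 hq h n
    (fun l => ℓ h (l.getD h d).1 (l.getD h d).2)]
  unfold layerVal
  refine pathSum_congr _ fun l x hl _ => sum_congr rfl fun a _ => ?_
  subst hl
  rw [List.getD_append_right _ _ _ _ (by simp)]
  simp

theorem stateDist_eq_pathTo (p : ℕ → Fin S → Fin A → Fin S → ℝ) (q : ℕ → Fin S → Fin A → ℝ)
    (s0 : Fin S) (h : ℕ) (x : Fin S) :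
    stateDist p q s0 h x = pathTo (fun j s a x => q j s a * p j s a x) h 0 s0 x := by
  induction h generalizing x with
  | zero => simp [stateDist, pathTo, pathSum, eq_comm]
  | succ h ih =>
    rw [stateDist, pathTo, pathSum_append]
    simp only [pathSum]
    rw [pathSum_eq_sum_pathTo]
    refine sum_congr rfl fun s _ => ?_
    rw [ih, mul_sum]
    refine sum_congr rfl fun a _ => ?_
    simp [mul_assoc]

theorem value_eq (H : ℕ) (p : ℕ → Fin S → Fin A → Fin S → ℝ) (q : ℕ → Fin S → Fin A → ℝ)
    (ℓ : ℕ → Fin S → Fin A → ℝ) (s0 : Fin S) :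
    value H p q ℓ s0 = ∑ h ∈ range H, layerVal p q ℓ s0 h := by
  refine sum_congr rfl fun h _ => ?_
  rw [layerVal, pathSum_eq_sum_pathTo]
  refine sum_congr rfl fun s _ => ?_
  rw [mul_sum, stateDist_eq_pathTo]
  exact sum_congr rfl fun a _ => by ring

theorem pathProd_ofFn (q : ℕ → Fin S → Fin A → ℝ) (n j : ℕ) (t : Fin n → Fin S × Fin A) :
    pathProd q j (List.ofFn t) = ∏ i : Fin n, q (j + i) (t i).1 (t i).2 := by
  induction n generalizing j with
  | zero => simp [pathProd]
  | succ n ih =>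
    rw [List.ofFn_succ, pathProd, ih, Fin.prod_univ_succ]
    simp [add_left_comm, add_comm]

/-- Extension of a finite-horizon deterministic policy to all steps. -/
def extPol {H : ℕ} (a0 : Fin A) (g : Fin H → Fin S → Fin A) (j : ℕ) (s : Fin S) : Fin A :=
  if h : j < H then g ⟨j, h⟩ s else a0

theorem sum_prod_pi {α β : Type*} [Fintype α] [DecidableEq α] [Fintype β] [DecidableEq β]
    (q : α → β → ℝ) (hq : ∀ x, ∑ y, q x y = 1) (x0 : α) (v : β) :
    ∑ g : α → β, (∏ x, q x (g x)) * (if g x0 = v then 1 else 0) = q x0 v := by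
  have h1 : ∀ g : α → β, (∏ x, q x (g x)) * (if g x0 = v then 1 else 0) =
      ∏ x, q x (g x) * (if x = x0 → g x = v then 1 else 0) := by
    intro g
    rw [prod_mul_distrib]
    congr 1
    rw [← Finset.mul_prod_erase _ _ (mem_univ x0), prod_eq_one]
    · simp
    · intro x hx; simp [(mem_erase.1 hx).1]
  simp only [h1]
  have h2 := Finset.prod_univ_sum (fun _ : α => (univ : Finset β))
    (fun x y => q x y * (if x = x0 → y = v then (1 : ℝ) else 0))
  rw [Fintype.piFinset_univ] at h2
  rw [← h2, ← Finset.mul_prod_erase _ _ (mem_univ x0), prod_eq_one]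
  · simp
  · intro x hx
    simp [(mem_erase.1 hx).1, hq]

/-- A stochastic Markov policy is a mixture of deterministic ones. -/
theorem layerVal_mixture {p : ℕ → Fin S → Fin A → Fin S → ℝ} (hp : ∀ j, IsKernel (p j))
    {q : ℕ → Fin S → Fin A → ℝ} (hq : ∀ j s, ∑ a, q j s a = 1) (d : Fin S × Fin A) (H : ℕ)
    (ℓ : ℕ → Fin S → Fin A → ℝ) (s0 : Fin S) :
    ∑ h ∈ range H, layerVal p q ℓ s0 h = ∑ g : Fin H → Fin S → Fin A,
      (∏ h : Fin H, ∏ s, q h s (g h s)) *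
        ∑ h ∈ range H, layerVal p (detW (extPol d.2 g)) ℓ s0 h := by
  rw [← sum_traj_trajLoss hp hq d]
  simp only [← sum_traj_trajLoss hp (sum_detW _) d]
  have key : ∀ t : Fin H → Fin S × Fin A, pathProd q 0 (List.ofFn t) =
      ∑ g : Fin H → Fin S → Fin A, (∏ h : Fin H, ∏ s, q h s (g h s)) *
        pathProd (detW (extPol d.2 g)) 0 (List.ofFn t) := by
    intro t
    simp only [pathProd_ofFn, zero_add, ← prod_mul_distrib]
    have h2 := Finset.prod_univ_sum (fun _ : Fin H => (univ : Finset (Fin S → Fin A)))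
      (fun h g => (∏ s, q h s (g s)) * (if g (t h).1 = (t h).2 then (1 : ℝ) else 0))
    rw [Fintype.piFinset_univ] at h2
    simp only [sum_prod_pi _ (hq _)] at h2
    rw [h2]
    refine sum_congr rfl fun g _ => prod_congr rfl fun h _ => ?_
    simp [detW, extPol]
  simp only [key, sum_mul, mul_sum]
  rw [sum_comm]
  exact sum_congr rfl fun g _ => sum_congr rfl fun t _ => by ring

theorem sum_mixture_weights {q : ℕ → Fin S → Fin A → ℝ} (hq : ∀ j s, ∑ a, q j s a = 1) (H : ℕ) :
    ∑ g : Fin H → Fin S → Fin A, ∏ h : Fin H, ∏ s, q h s (g h s) = 1 := by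
  have h1 : ∀ h : Fin H, ∑ g : Fin S → Fin A, ∏ s, q h s (g s) = 1 := by
    intro h
    have h2 := Finset.prod_univ_sum (fun _ : Fin S => (univ : Finset (Fin A))) (fun s a => q h s a)
    rw [Fintype.piFinset_univ] at h2
    rw [← h2, prod_eq_one fun s _ => hq _ _]
  have h2 := Finset.prod_univ_sum (fun _ : Fin H => (univ : Finset (Fin S → Fin A)))
    (fun h g => (∏ s, q h s (g s)))
  rw [Fintype.piFinset_univ] at h2
  rw [← h2, prod_eq_one fun h _ => h1 h]

theorem stratValue_mixStrat {ι : Type*} [Fintype ι] (pol : ι → ℕ → Fin S → Fin A)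
    {p : ℕ → Fin S → Fin A → Fin S → ℝ} (hp : ∀ j, IsKernel (p j))
    (a0 : Fin A) {P : ι → ℝ} (hP : ∀ i, 0 ≤ P i) (hP1 : ∑ i, P i = 1) (H : ℕ) (s0 : Fin S)
    (ℓ : ℕ → Fin S → Fin A → ℝ) :
    stratValue H p (mixStrat pol a0 P) ℓ s0 =
      ∑ i, P i * ∑ h ∈ range H, layerVal p (detW (pol i)) ℓ s0 h := by
  unfold stratValue
  simp only [trajDist_mixStrat pol hp a0 hP hP1, sum_mul]
  rw [sum_comm]
  refine sum_congr rfl fun i _ => ?_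
  rw [← sum_traj_trajLoss hp (sum_detW _) (s0, a0), mul_sum]
  exact sum_congr rfl fun t _ => by ring

/-! ### Exponential supermartingales -/

section supermartingale
variable {T : Type*}

/-- The probability of a history (newest observation first) under the transition weights `Q`. -/
noncomputable def histProd (Q : List T → T → ℝ) : List T → ℝ
  | [] => 1
  | t :: past => histProd Q past * Q past t

/-- The sum of the increments `D` along a history (newest observation first). -/
noncomputable def histSum (D : List T → T → ℝ) : List T → ℝ
  | [] => 0
  | t :: past => histSum D past + D past t

theorem histProd_nonneg {Q : List T → T → ℝ} (hQ : ∀ past t, 0 ≤ Q past t) (l : List T) :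
    0 ≤ histProd Q l := by
  induction l with
  | nil => exact zero_le_one
  | cons t l ih => exact mul_nonneg ih (hQ _ _)

variable [Fintype T]

theorem sum_histProd_exp_le {Q D : List T → T → ℝ} (hQ : ∀ past t, 0 ≤ Q past t)
    (hD : ∀ past, ∑ t, Q past t * Real.exp (D past t) ≤ 1) (n : ℕ) :
    ∑ t : Fin n → T, histProd Q (List.ofFn t) * Real.exp (histSum D (List.ofFn t)) ≤ 1 := by
  induction n with
  | zero => simp [histProd, histSum]
  | succ n ih =>
    rw [sum_ofFn_succ n (fun l => histProd Q l * Real.exp (histSum D l)), sum_comm]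
    refine le_trans (sum_le_sum fun t _ => ?_) ih
    simp only [histProd, histSum, Real.exp_add]
    calc _ = histProd Q (List.ofFn t) * Real.exp (histSum D (List.ofFn t)) *
          ∑ x, Q (List.ofFn t) x * Real.exp (D (List.ofFn t) x) := by
          rw [mul_sum]; exact sum_congr rfl fun x _ => by ring
      _ ≤ _ := mul_le_of_le_one_right
          (mul_nonneg (histProd_nonneg hQ _) (Real.exp_pos _).le) (hD _)

theorem sum_histProd {Q : List T → T → ℝ} (hQ : ∀ past, ∑ t, Q past t = 1) (n : ℕ) :
    ∑ t : Fin n → T, histProd Q (List.ofFn t) = 1 := by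
  induction n with
  | zero => simp [histProd]
  | succ n ih =>
    rw [sum_ofFn_succ n (histProd Q), sum_comm, ← ih]
    simp only [histProd, ← mul_sum, hQ, mul_one]

open scoped Classical in
theorem sum_histProd_tail_le {Q D : List T → T → ℝ} (hQ : ∀ past t, 0 ≤ Q past t)
    (hD : ∀ past, ∑ t, Q past t * Real.exp (D past t) ≤ 1) (n : ℕ) (L : ℝ) :
    ∑ t : Fin n → T, histProd Q (List.ofFn t) *
      (if L < histSum D (List.ofFn t) then 1 else 0) ≤ Real.exp (-L) := by
  have h := sum_histProd_exp_le hQ hD n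
  calc _ ≤ ∑ t : Fin n → T, Real.exp (-L) * (histProd Q (List.ofFn t) *
        Real.exp (histSum D (List.ofFn t))) := by
        refine sum_le_sum fun t _ => ?_
        have h0 := histProd_nonneg hQ (List.ofFn t)
        rw [mul_left_comm, ← Real.exp_add]
        refine mul_le_mul_of_nonneg_left ?_ h0
        split_ifs with hL
        · exact Real.one_le_exp (by linarith)
        · exact (Real.exp_pos _).le
    _ ≤ _ := by rw [← mul_sum]; exact mul_le_of_le_one_right (Real.exp_pos _).le h

end supermartingale

/-! ### Mirror descent with the entropy regularizer -/

section entropy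
variable {I : Type*} [Fintype I]

/-- The unnormalized relative entropy. -/
noncomputable def relEnt (y w : I → ℝ) : ℝ := ∑ i, y i * Real.log (y i / w i)

theorem sub_le_mul_log_div {a b : ℝ} (ha : 0 < a) (hb : 0 < b) : a - b ≤ a * Real.log (a / b) := by
  have h := Real.one_sub_inv_le_log_of_pos (div_pos ha hb)
  rw [inv_div] at h
  calc a - b = a * (1 - b / a) := by field_simp
    _ ≤ _ := mul_le_mul_of_nonneg_left h ha.le

theorem sum_sub_sum_le_relEnt {y w : I → ℝ} (hy : ∀ i, 0 < y i) (hw : ∀ i, 0 < w i) :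
    ∑ i, y i - ∑ i, w i ≤ relEnt y w := by
  rw [← sum_sub_distrib]
  exact sum_le_sum fun i _ => sub_le_mul_log_div (hy i) (hw i)

theorem relEnt_sub_le {y z w : I → ℝ} (hy : ∀ i, 0 < y i) (hz : ∀ i, 0 < z i)
    (hw : ∀ i, 0 < w i) (hyz : ∑ i, y i = ∑ i, z i) :
    relEnt y w - relEnt z w ≤ ∑ i, (y i - z i) * Real.log (y i / w i) := by
  have h := sum_sub_sum_le_relEnt hz hy
  have e : relEnt z y = relEnt z w - ∑ i, z i * Real.log (y i / w i) := by
    unfold relEnt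
    rw [← sum_sub_distrib]
    refine sum_congr rfl fun i _ => ?_
    rw [Real.log_div (hz i).ne' (hy i).ne', Real.log_div (hz i).ne' (hw i).ne',
      Real.log_div (hy i).ne' (hw i).ne']
    ring
  have e2 : ∑ i, (y i - z i) * Real.log (y i / w i) =
      relEnt y w - ∑ i, z i * Real.log (y i / w i) := by
    unfold relEnt
    rw [← sum_sub_distrib]
    exact sum_congr rfl fun i _ => by ring
  linarith

/-- First-order optimality of the relative entropy projection along a segment. -/
theorem relEnt_optimality {y z w : I → ℝ} (hy : ∀ i, 0 < y i) (hz : ∀ i, 0 < z i)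
    (hw : ∀ i, 0 < w i) (hyz : ∑ i, y i = ∑ i, z i)
    (hmin : ∀ t : ℝ, 0 < t → t ≤ 1 → relEnt z w ≤ relEnt (fun i => z i + t * (y i - z i)) w) :
    0 ≤ ∑ i, (y i - z i) * Real.log (z i / w i) := by
  have hpos : ∀ t : ℝ, 0 < t → t ≤ 1 → ∀ i, 0 < z i + t * (y i - z i) := by
    intro t h0 h1 i
    have := mul_pos h0 (hy i)
    have := mul_nonneg (sub_nonneg.2 h1) (hz i).le
    nlinarith
  have key : ∀ t : ℝ, 0 < t → t ≤ 1 →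
      0 ≤ ∑ i, (y i - z i) * Real.log ((z i + t * (y i - z i)) / w i) := by
    intro t h0 h1
    have h := relEnt_sub_le (y := fun i => z i + t * (y i - z i)) (hpos t h0 h1) hz hw (by
      rw [sum_add_distrib, ← mul_sum, sum_sub_distrib, hyz]; ring)
    have h2 := hmin t h0 h1
    have e : ∑ i, (z i + t * (y i - z i) - z i) * Real.log ((z i + t * (y i - z i)) / w i) =
        t * ∑ i, (y i - z i) * Real.log ((z i + t * (y i - z i)) / w i) := by
      rw [mul_sum]; exact sum_congr rfl fun i _ => by ring
    rw [e] at h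
    exact nonneg_of_mul_nonneg_right (by linarith) h0
  have hlim : Filter.Tendsto
      (fun t : ℝ => ∑ i, (y i - z i) * Real.log ((z i + t * (y i - z i)) / w i))
      (nhdsWithin 0 (Set.Ioi 0)) (nhds (∑ i, (y i - z i) * Real.log (z i / w i))) := by
    apply tendsto_nhdsWithin_of_tendsto_nhds
    refine tendsto_finsetSum _ fun i _ => ?_
    have hc : ContinuousAt
        (fun t : ℝ => (y i - z i) * Real.log ((z i + t * (y i - z i)) / w i)) 0 := by
      refine ContinuousAt.mul continuousAt_const (ContinuousAt.log (by fun_prop) ?_)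
      simp [(hz i).ne', (hw i).ne']
    simpa [ContinuousAt] using hc
  refine ge_of_tendsto hlim ?_
  filter_upwards [Ioc_mem_nhdsGT (zero_lt_one (α := ℝ))] with t ht
  exact key t ht.1 ht.2

theorem exp_neg_le_quadratic {x : ℝ} (hx : 0 ≤ x) : Real.exp (-x) ≤ 1 - x + x ^ 2 := by
  have h := Real.add_one_le_exp x
  rw [Real.exp_neg, inv_le_comm₀ (Real.exp_pos _) (by nlinarith [sq_nonneg (x - 1)])]
  refine le_trans ?_ h
  rw [inv_le_iff_one_le_mul₀ (by nlinarith [sq_nonneg (x - 1)])]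
  nlinarith [pow_nonneg hx 3]

/-- One step of entropic mirror descent: the change of the potential. -/
theorem relEnt_step {y z w ℓ : I → ℝ} (hy : ∀ i, 0 < y i) (hz : ∀ i, 0 < z i)
    (hw : ∀ i, 0 < w i) (hℓ : ∀ i, 0 ≤ ℓ i)
    (hopt : 0 ≤ ∑ i, (y i - z i) * Real.log (z i / w i)) :
    relEnt y (fun i => z i * Real.exp (-ℓ i)) + ∑ i, z i * Real.exp (-ℓ i) ≤
      relEnt y w + ∑ i, w i + ∑ i, y i * ℓ i - ∑ i, z i * ℓ i + ∑ i, z i * ℓ i ^ 2 := by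
  have e1 : relEnt y (fun i => z i * Real.exp (-ℓ i)) =
      relEnt y z + ∑ i, y i * ℓ i := by
    unfold relEnt
    rw [← sum_add_distrib]
    refine sum_congr rfl fun i _ => ?_
    rw [Real.log_div (hy i).ne' (mul_pos (hz i) (Real.exp_pos _)).ne',
      Real.log_mul (hz i).ne' (Real.exp_pos _).ne', Real.log_exp,
      Real.log_div (hy i).ne' (hz i).ne']
    ring
  have e2 : relEnt y w = relEnt y z + relEnt z w + ∑ i, (y i - z i) * Real.log (z i / w i) := by
    unfold relEnt
    rw [← sum_add_distrib, ← sum_add_distrib]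
    refine sum_congr rfl fun i _ => ?_
    rw [Real.log_div (hy i).ne' (hw i).ne', Real.log_div (hy i).ne' (hz i).ne',
      Real.log_div (hz i).ne' (hw i).ne']
    ring
  have h3 := sum_sub_sum_le_relEnt hz hw
  have h4 : ∑ i, z i * Real.exp (-ℓ i) ≤ ∑ i, z i - ∑ i, z i * ℓ i + ∑ i, z i * ℓ i ^ 2 := by
    rw [← sum_sub_distrib, ← sum_add_distrib]
    refine sum_le_sum fun i _ => ?_
    have := mul_le_mul_of_nonneg_left (exp_neg_le_quadratic (hℓ i)) (hz i).le
    linarith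
  linarith

end entropy

/-! ### The algorithm -/

/-- The parameters of the algorithm. -/
structure Cfg (S A H : ℕ) where
  s0 : Fin S
  a0 : Fin A
  h1 : ℕ
  lam : ℕ
  hH : h1 + lam < H
  γ : ℝ
  β : ℝ
  L0 : ℝ
  γ_pos : 0 < γ
  β_pos : 0 < β
  β_le : β ≤ 1
  L0_ge : 1 ≤ L0

/-- Sub-policies: a state at the start of the block, a policy on the block, and a choice of the
state-action pair at the layer given the state after the block. -/
abbrev SubPol (S A lam : ℕ) : Type :=
  Fin S × (Fin (lam + 1) → Fin S → Fin A) × (Fin S → Fin S × Fin A)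

namespace Cfg
variable {H : ℕ} (c : Cfg S A H)

/-- The index set of the mirror descent iterates. -/
abbrev Idx : Type := Fin H × SubPol S A c.lam

/-- The step lies outside the adversarial block and is not the last one. -/
def off (j : ℕ) : Prop := j + 1 < H ∧ ¬ (c.h1 ≤ j ∧ j < c.h1 + c.lam)

noncomputable instance (j : ℕ) : Decidable (c.off j) := Classical.propDecidable _

/-- The number of steps before the block, up to layer `h`. -/
def bb (h : ℕ) : ℕ := min h c.h1

/-- The number of steps on the block, up to layer `h`. -/
def mm (h : ℕ) : ℕ := min h (c.h1 + c.lam) - min h c.h1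

/-- The number of steps after the block, up to layer `h`. -/
def nn (h : ℕ) : ℕ := h - min h (c.h1 + c.lam)

theorem bb_add_mm_add_nn (h : ℕ) : c.bb h + c.mm h + c.nn h = h := by
  unfold bb mm nn; omega

theorem off_of_lt {h j : ℕ} (hh : h < H)
    (hj : j < c.bb h ∨ c.bb h + c.mm h ≤ j ∧ j < c.bb h + c.mm h + c.nn h) : c.off j := by
  unfold bb mm nn at hj
  unfold off
  omega

theorem not_off_of_le {h j : ℕ} (h1 : c.bb h ≤ j) (h2 : j < c.bb h + c.mm h) : ¬ c.off j := by
  unfold bb mm at *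
  unfold off
  omega

/-- The class of a trajectory at layer `h`. -/
def cls (h : ℕ) (L : List (Fin S × Fin A)) : Cls S A :=
  clsOf (c.s0, c.a0) (c.bb h) (c.mm h) (c.nn h) L

/-- The number of visits to `(j, s, a)`. -/
noncomputable def cntN : List (BanditObs S A H) → ℕ → Fin S → Fin A → ℝ
  | [], _, _, _ => 0
  | o :: past, j, s, a => cntN past j s a +
      (if (List.ofFn o.1).getD j (c.s0, c.a0) = (s, a) then 1 else 0)

/-- The number of transitions from `(j, s, a)` to `x`. -/
noncomputable def cntC : List (BanditObs S A H) → ℕ → Fin S → Fin A → Fin S → ℝ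
  | [], _, _, _, _ => 0
  | o :: past, j, s, a, x => cntC past j s a x +
      (if (List.ofFn o.1).getD j (c.s0, c.a0) = (s, a) ∧
        ((List.ofFn o.1).getD (j + 1) (c.s0, c.a0)).1 = x then 1 else 0)

/-- The confidence radius after `n` visits. -/
noncomputable def rad (n : ℝ) : ℝ := if S * c.L0 < n then √(S * c.L0 / n) else 1

/-- The confidence radius at `(j, s, a)`. -/
noncomputable def thet (past : List (BanditObs S A H)) (j : ℕ) (s : Fin S) (a : Fin A) : ℝ :=
  c.rad (c.cntN past j s a)

/-- The empirical transition function. -/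
noncomputable def phat (past : List (BanditObs S A H)) (j : ℕ) (s : Fin S) (a : Fin A)
    (x : Fin S) : ℝ := c.cntC past j s a x / c.cntN past j s a

/-- The upper confidence kernel. -/
noncomputable def kerU (past : List (BanditObs S A H)) (j : ℕ) (s : Fin S) (a : Fin A)
    (x : Fin S) : ℝ := (c.phat past j s a x + c.thet past j s a / S) / (1 + c.thet past j s a)

/-- The lower confidence kernel. -/
noncomputable def kerL (past : List (BanditObs S A H)) (j : ℕ) (s : Fin S) (a : Fin A)
    (x : Fin S) : ℝ :=
  if c.thet past j s a < 1 then
    max 0 ((c.phat past j s a x - c.thet past j s a / S) / (1 + c.thet past j s a))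
  else 0

/-- The survival weights. -/
noncomputable def surv (past : List (BanditObs S A H)) (j : ℕ) (s : Fin S) (a : Fin A) : ℝ :=
  if c.off j then (1 - c.thet past j s a) / (1 + c.thet past j s a) else 1

/-- The killing rates. -/
noncomputable def kil (past : List (BanditObs S A H)) (j : ℕ) (s : Fin S) (a : Fin A) : ℝ :=
  if c.off j then c.thet past j s a else 0

/-- The deterministic policies. -/
abbrev Det (_ : Cfg S A H) : Type := Fin H → Fin S → Fin A

/-- The policy on all steps given by a deterministic policy. -/
def pol (π : c.Det) : ℕ → Fin S → Fin A := extPol c.a0 π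

/-- The policy on the block given by a sub-policy. -/
def blkPol (φ : Fin (c.lam + 1) → Fin S → Fin A) (j : ℕ) (s : Fin S) : Fin A :=
  φ (Fin.ofNat (c.lam + 1) (j - c.h1)) s

/-- Whether a class is consistent with a sub-policy. -/
noncomputable def sim (h : ℕ) (ω : SubPol S A c.lam) (x : Cls S A) : ℝ :=
  (if headState x.1 x.2.1 = ω.1 then 1 else 0) *
    pathProd (detW (c.blkPol ω.2.1)) (c.bb h) x.1 * (if ω.2.2 x.2.1 = x.2.2 then 1 else 0)

/-- The weight of a class under a law on sub-policies. -/
noncomputable def simZ (z : c.Idx → ℝ) (h : Fin H) (x : Cls S A) : ℝ :=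
  ∑ ω, z (h, ω) * c.sim h ω x

/-- The probability of a class under a mixture of policies, for the kernel `R` off the block. -/
noncomputable def mixCls (R : ℕ → Fin S → Fin A → Fin S → ℝ) (P : c.Det → ℝ) (h : ℕ)
    (x : Cls S A) : ℝ :=
  ∑ π, P π * clsProb c.s0 (c.bb h) (c.mm h) (c.nn h) R (c.pol π) x

/-- The number of sub-policies. -/
noncomputable def card : ℝ := Fintype.card (SubPol S A c.lam)

/-- The feasible pairs of sub-policy laws and mixtures of policies. -/
def feas (past : List (BanditObs S A H)) : Set ((c.Idx → ℝ) × (c.Det → ℝ)) :=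
  {x | (∀ i, c.β / c.card ≤ x.1 i) ∧ (∀ h, ∑ ω, x.1 (h, ω) = 1) ∧ (∀ π, 0 ≤ x.2 π) ∧
    ∑ π, x.2 π = 1 ∧ ∀ (h : Fin H) (y : Cls S A), y.1.length = c.mm h →
      (1 - c.β) * c.mixCls (c.kerL past) x.2 h y ≤ c.simZ x.1 h y}

open scoped Classical in
/-- The projection of `w` on the feasible set. -/
noncomputable def sel (past : List (BanditObs S A H)) (w : c.Idx → ℝ) :
    (c.Idx → ℝ) × (c.Det → ℝ) :=
  if h : ∃ x ∈ c.feas past, ∀ y ∈ c.feas past, relEnt x.1 w ≤ relEnt y.1 w then h.choose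
  else (fun _ => 1, fun π => if π = fun _ _ => c.a0 then 1 else 0)

/-- The loss estimator. -/
noncomputable def est (past : List (BanditObs S A H)) (P : c.Det → ℝ) (o : BanditObs S A H)
    (i : c.Idx) : ℝ :=
  pathProd (c.surv past) 0 ((List.ofFn o.1).take i.1) * c.sim i.1 i.2 (c.cls i.1 (List.ofFn o.1)) *
    o.2 i.1 / (c.mixCls (c.kerU past) P i.1 (c.cls i.1 (List.ofFn o.1)) + c.γ)

/-- The weights before projection. -/
noncomputable def wst : List (BanditObs S A H) → c.Idx → ℝ
  | [] => fun _ => 1 / c.card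
  | o :: past => fun i => (c.sel past (wst past)).1 i *
      Real.exp (-(c.γ * c.est past (c.sel past (wst past)).2 o i))

/-- The law on sub-policies. -/
noncomputable def zst (past : List (BanditObs S A H)) : c.Idx → ℝ := (c.sel past (c.wst past)).1

/-- The mixture of policies that is played. -/
noncomputable def Pst (past : List (BanditObs S A H)) : c.Det → ℝ := (c.sel past (c.wst past)).2

theorem Pst_simplex (past : List (BanditObs S A H)) :
    (∀ π, 0 ≤ c.Pst past π) ∧ ∑ π, c.Pst past π = 1 := by
  unfold Pst sel
  split_ifs with h
  · have := h.choose_spec.1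
    exact ⟨this.2.2.1, this.2.2.2.1⟩
  · constructor
    · intro π; dsimp only; split_ifs <;> norm_num
    · simp

/-- The learning algorithm. -/
noncomputable def alg : Alg S A (BanditObs S A H) where
  w := fun i => if i = 0 then 1 else 0
  w_nonneg := fun i => by split_ifs <;> norm_num
  w_sum := by simp
  act := fun _ past => mixStrat c.pol c.a0 (c.Pst past.reverse)
  act_strat := fun _ past => mixStrat_isStrategy _ _ (c.Pst_simplex _).1

theorem card_pos : 0 < c.card := by
  have : Nonempty (SubPol S A c.lam) := ⟨(c.s0, fun _ _ => c.a0, fun _ => (c.s0, c.a0))⟩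
  unfold card
  exact_mod_cast Fintype.card_pos

theorem mixCls_add_mul (R : ℕ → Fin S → Fin A → Fin S → ℝ) (P P' : c.Det → ℝ) (t : ℝ) (h : ℕ)
    (x : Cls S A) : c.mixCls R (fun π => P π + t * (P' π - P π)) h x =
      (1 - t) * c.mixCls R P h x + t * c.mixCls R P' h x := by
  unfold mixCls
  rw [mul_sum, mul_sum, ← sum_add_distrib]
  exact sum_congr rfl fun π _ => by ring

theorem simZ_add_mul (z z' : c.Idx → ℝ) (t : ℝ) (h : Fin H)
    (x : Cls S A) : c.simZ (fun i => z i + t * (z' i - z i)) h x =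
      (1 - t) * c.simZ z h x + t * c.simZ z' h x := by
  unfold simZ
  rw [mul_sum, mul_sum, ← sum_add_distrib]
  exact sum_congr rfl fun π _ => by ring

theorem feas_convex (past : List (BanditObs S A H)) {x y : (c.Idx → ℝ) × (c.Det → ℝ)}
    (hx : x ∈ c.feas past) (hy : y ∈ c.feas past) {t : ℝ} (h0 : 0 ≤ t) (h1 : t ≤ 1) :
    ((fun i => x.1 i + t * (y.1 i - x.1 i), fun π => x.2 π + t * (y.2 π - x.2 π)) :
      (c.Idx → ℝ) × (c.Det → ℝ)) ∈ c.feas past := by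
  obtain ⟨x1, x2, x3, x4, x5⟩ := hx
  obtain ⟨y1, y2, y3, y4, y5⟩ := hy
  have h1' := sub_nonneg.2 h1
  refine ⟨fun i => ?_, fun h => ?_, fun π => ?_, ?_, fun h u hu => ?_⟩
  · have := mul_le_mul_of_nonneg_left (x1 i) h1'
    have := mul_le_mul_of_nonneg_left (y1 i) h0
    dsimp only; linarith
  · rw [sum_add_distrib, ← mul_sum, sum_sub_distrib, x2, y2]; ring
  · have := mul_nonneg h1' (x3 π)
    have := mul_nonneg h0 (y3 π)
    dsimp only; linarith
  · rw [sum_add_distrib, ← mul_sum, sum_sub_distrib, x4, y4]; ring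
  · dsimp only
    rw [mixCls_add_mul, simZ_add_mul]
    have := mul_le_mul_of_nonneg_left (x5 h u hu) h1'
    have := mul_le_mul_of_nonneg_left (y5 h u hu) h0
    linarith

theorem feas_isCompact (past : List (BanditObs S A H)) : IsCompact (c.feas past) := by
  have hsub : c.feas past ⊆ (Set.univ.pi fun _ : c.Idx => Set.Icc (0 : ℝ) 1) ×ˢ
      (Set.univ.pi fun _ : c.Det => Set.Icc (0 : ℝ) 1) := by
    intro x hx
    obtain ⟨x1, x2, x3, x4, -⟩ := hx
    have x0 : ∀ i, 0 ≤ x.1 i := fun i => (div_nonneg c.β_pos.le c.card_pos.le).trans (x1 i)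
    refine ⟨fun i _ => ⟨x0 i, ?_⟩, fun π _ => ⟨x3 π, ?_⟩⟩
    · rw [← x2 i.1]
      exact single_le_sum (f := fun ω => x.1 (i.1, ω)) (fun ω _ => x0 _) (mem_univ i.2)
    · rw [← x4]
      exact single_le_sum (fun π _ => x3 π) (mem_univ π)
  refine ((isCompact_univ_pi fun _ => isCompact_Icc).prod
    (isCompact_univ_pi fun _ => isCompact_Icc)).of_isClosed_subset ?_ hsub
  unfold feas mixCls simZ
  simp only [Set.ofPred_and, Set.ofPred_forall]
  refine IsClosed.inter (isClosed_iInter fun i => isClosed_le (by fun_prop) (by fun_prop)) ?_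
  refine IsClosed.inter (isClosed_iInter fun i => isClosed_eq (by fun_prop) (by fun_prop)) ?_
  refine IsClosed.inter (isClosed_iInter fun i => isClosed_le (by fun_prop) (by fun_prop)) ?_
  refine IsClosed.inter (isClosed_eq (by fun_prop) (by fun_prop)) ?_
  exact isClosed_iInter fun h => isClosed_iInter fun y => isClosed_iInter fun _ =>
    isClosed_le (by fun_prop) (by fun_prop)

theorem sel_spec (past : List (BanditObs S A H)) {w : c.Idx → ℝ} (hw : ∀ i, 0 < w i)
    (hne : (c.feas past).Nonempty) :
    c.sel past w ∈ c.feas past ∧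
      ∀ y ∈ c.feas past, relEnt (c.sel past w).1 w ≤ relEnt y.1 w := by
  have hcont : Continuous fun x : (c.Idx → ℝ) × (c.Det → ℝ) => relEnt x.1 w := by
    unfold relEnt
    refine continuous_finsetSum _ fun i _ => ?_
    have : (fun x : (c.Idx → ℝ) × (c.Det → ℝ) => x.1 i * Real.log (x.1 i / w i)) =
        fun x => w i * ((x.1 i / w i) * Real.log (x.1 i / w i)) := by
      funext x
      rw [← mul_assoc, mul_div_cancel₀ _ (hw i).ne']
    rw [this]
    exact continuous_const.mul (Real.continuous_mul_log.comp (by fun_prop))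
  obtain ⟨x, hx, hmin⟩ := (c.feas_isCompact past).exists_isMinOn hne hcont.continuousOn
  have h : ∃ x ∈ c.feas past, ∀ y ∈ c.feas past, relEnt x.1 w ≤ relEnt y.1 w :=
    ⟨x, hx, fun y hy => hmin hy⟩
  have := h.choose_spec
  unfold sel
  rw [dif_pos h]
  exact this

theorem sel_pos (past : List (BanditObs S A H)) (w : c.Idx → ℝ) (i : c.Idx) :
    0 < (c.sel past w).1 i := by
  unfold sel
  split_ifs with h
  · exact (div_pos c.β_pos c.card_pos).trans_le (h.choose_spec.1.1 i)
  · exact one_pos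

theorem wst_pos (past : List (BanditObs S A H)) (i : c.Idx) : 0 < c.wst past i := by
  cases past with
  | nil => exact div_pos one_pos c.card_pos
  | cons o past => exact mul_pos (c.sel_pos _ _ _) (Real.exp_pos _)

theorem zst_pos (past : List (BanditObs S A H)) (i : c.Idx) : 0 < c.zst past i :=
  c.sel_pos _ _ _

end Cfg

namespace Cfg
variable {H : ℕ} (c : Cfg S A H)

/-! ### Confidence kernels -/

section confidence
variable (past : List (BanditObs S A H)) (j : ℕ) (s : Fin S) (a : Fin A)

theorem S_pos (c : Cfg S A H) : (0 : ℝ) < S := by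
  have := c.s0.pos
  exact_mod_cast this

theorem SL0_ge : 1 ≤ S * c.L0 := by
  have h : (1 : ℝ) ≤ S := by exact_mod_cast c.s0.pos
  have := c.L0_ge
  nlinarith

theorem rad_nonneg (n : ℝ) : 0 ≤ c.rad n := by
  unfold rad; split_ifs
  · exact Real.sqrt_nonneg _
  · exact zero_le_one

theorem rad_le_one (n : ℝ) : c.rad n ≤ 1 := by
  unfold rad; split_ifs with h
  · have h0 := c.SL0_ge
    rw [Real.sqrt_le_iff, one_pow, div_le_one (by linarith)]
    exact ⟨zero_le_one, h.le⟩
  · exact le_rfl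

theorem thet_nonneg : 0 ≤ c.thet past j s a := c.rad_nonneg _

theorem thet_le_one : c.thet past j s a ≤ 1 := c.rad_le_one _

theorem cntN_nonneg : 0 ≤ c.cntN past j s a := by
  induction past with
  | nil => exact le_rfl
  | cons o past ih => unfold cntN; split_ifs <;> linarith

theorem cntC_nonneg (x : Fin S) : 0 ≤ c.cntC past j s a x := by
  induction past with
  | nil => exact le_rfl
  | cons o past ih => unfold cntC; split_ifs <;> linarith

theorem sum_cntC : ∑ x, c.cntC past j s a x = c.cntN past j s a := by
  induction past with
  | nil => simp [cntC, cntN]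
  | cons o past ih =>
    simp only [cntC, cntN, sum_add_distrib, ih]
    congr 1
    generalize (List.ofFn o.1).getD j (c.s0, c.a0) = u
    generalize (List.ofFn o.1).getD (j + 1) (c.s0, c.a0) = v
    by_cases h : u = (s, a) <;> simp [h]

theorem cntN_pos_of_thet_lt (h : c.thet past j s a < 1) : 0 < c.cntN past j s a := by
  unfold thet rad at h
  split_ifs at h with h'
  · linarith [c.SL0_ge]
  · exact absurd h (lt_irrefl _)

theorem phat_nonneg (x : Fin S) : 0 ≤ c.phat past j s a x :=
  div_nonneg (c.cntC_nonneg _ _ _ _ _) (c.cntN_nonneg _ _ _ _)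

theorem sum_phat_le : ∑ x, c.phat past j s a x ≤ 1 := by
  unfold phat
  rw [← sum_div, sum_cntC]
  exact div_self_le_one _

theorem sum_phat (h : c.thet past j s a < 1) : ∑ x, c.phat past j s a x = 1 := by
  unfold phat
  rw [← sum_div, sum_cntC]
  exact div_self (c.cntN_pos_of_thet_lt past j s a h).ne'

theorem kerU_nonneg (x : Fin S) : 0 ≤ c.kerU past j s a x := by
  have := c.phat_nonneg past j s a x
  have := c.thet_nonneg past j s a
  unfold kerU; positivity

theorem sum_kerU_le : ∑ x, c.kerU past j s a x ≤ 1 := by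
  unfold kerU
  have h := c.thet_nonneg past j s a
  have h2 := c.sum_phat_le past j s a
  have hS := c.S_pos
  rw [← sum_div, sum_add_distrib, div_le_one (by linarith)]
  simp only [sum_const, card_univ, Fintype.card_fin, nsmul_eq_mul]
  rw [mul_div_cancel₀ _ hS.ne']
  linarith

theorem kerL_nonneg (x : Fin S) : 0 ≤ c.kerL past j s a x := by
  unfold kerL; split_ifs
  · exact le_max_left _ _
  · exact le_rfl

theorem kerL_le_kerU (x : Fin S) : c.kerL past j s a x ≤ c.kerU past j s a x := by
  have h := c.thet_nonneg past j s a
  have hS := c.S_pos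
  unfold kerL; split_ifs
  · refine max_le (c.kerU_nonneg _ _ _ _ _) ?_
    unfold kerU
    have : 0 ≤ c.thet past j s a / S := by positivity
    gcongr
    linarith
  · exact c.kerU_nonneg _ _ _ _ _

theorem one_sub_two_mul_le {θ : ℝ} (h0 : 0 ≤ θ) : 1 - 2 * θ ≤ (1 - θ) / (1 + θ) := by
  rw [le_div_iff₀ (by linarith)]
  nlinarith [mul_nonneg h0 h0]

theorem le_sum_kerL : 1 - 2 * c.thet past j s a ≤ ∑ x, c.kerL past j s a x := by
  have h := c.thet_nonneg past j s a
  have hS := c.S_pos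
  by_cases h1 : c.thet past j s a < 1
  · refine (one_sub_two_mul_le h).trans ?_
    calc (1 - c.thet past j s a) / (1 + c.thet past j s a) =
        ∑ x, (c.phat past j s a x - c.thet past j s a / S) / (1 + c.thet past j s a) := by
          rw [← sum_div, sum_sub_distrib, c.sum_phat _ _ _ _ h1]
          simp only [sum_const, card_univ, Fintype.card_fin, nsmul_eq_mul]
          rw [mul_div_cancel₀ _ hS.ne']
      _ ≤ _ := by
          refine sum_le_sum fun x _ => ?_
          unfold kerL; rw [if_pos h1]; exact le_max_right _ _
  · have : 0 ≤ ∑ x, c.kerL past j s a x := sum_nonneg fun x _ => c.kerL_nonneg _ _ _ _ _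
    linarith

theorem surv_nonneg : 0 ≤ c.surv past j s a := by
  have h := c.thet_nonneg past j s a
  have h' := c.thet_le_one past j s a
  unfold surv; split_ifs
  · exact div_nonneg (by linarith) (by linarith)
  · exact zero_le_one

theorem surv_le_one : c.surv past j s a ≤ 1 := by
  have h := c.thet_nonneg past j s a
  unfold surv; split_ifs
  · rw [div_le_one (by linarith)]; linarith
  · exact le_rfl

theorem kil_nonneg : 0 ≤ c.kil past j s a := by
  unfold kil; split_ifs
  · exact c.thet_nonneg _ _ _ _
  · exact le_rfl

theorem kil_le_one : c.kil past j s a ≤ 1 := by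
  unfold kil; split_ifs
  · exact c.thet_le_one _ _ _ _
  · exact zero_le_one

theorem one_sub_kil_le_surv : 1 - 2 * c.kil past j s a ≤ c.surv past j s a := by
  unfold kil surv; split_ifs
  · exact one_sub_two_mul_le (c.thet_nonneg _ _ _ _)
  · linarith

/-- The confidence event: the kernels sandwich the true transition function. -/
def conf (p : ℕ → Fin S → Fin A → Fin S → ℝ) : Prop :=
  ∀ j, c.off j → ∀ s a x, c.kerL past j s a x ≤ p j s a x ∧
    c.surv past j s a * p j s a x ≤ c.kerU past j s a x

theorem conf_of_bounds {p : ℕ → Fin S → Fin A → Fin S → ℝ} (hp : ∀ j s a x, 0 ≤ p j s a x)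
    (h : ∀ j, c.off j → ∀ s a x, c.thet past j s a < 1 →
      (1 - c.thet past j s a) * p j s a x ≤ c.phat past j s a x + c.thet past j s a / S ∧
      c.phat past j s a x - c.thet past j s a / S ≤ (1 + c.thet past j s a) * p j s a x) :
    c.conf past p := by
  intro j hj s a x
  have h0 := c.thet_nonneg past j s a
  unfold kerL surv kerU
  rw [if_pos hj]
  by_cases h1 : c.thet past j s a < 1
  · obtain ⟨h2, h3⟩ := h j hj s a x h1
    rw [if_pos h1]
    constructor
    · refine max_le (hp _ _ _ _) ?_
      rw [div_le_iff₀ (by linarith)]; linarith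
    · rw [div_mul_eq_mul_div]
      gcongr
  · have h1 : c.thet past j s a = 1 := le_antisymm (c.thet_le_one _ _ _ _) (not_lt.1 h1)
    rw [if_neg (by rw [h1]; exact lt_irrefl _), h1, sub_self, zero_div, zero_mul]
    have := c.phat_nonneg past j s a x
    have := c.S_pos
    exact ⟨hp _ _ _ _, by positivity⟩

end confidence

/-! ### The law of the classes in one episode -/

section episode
variable (past : List (BanditObs S A H)) {p : ℕ → Fin S → Fin A → Fin S → ℝ}

/-- Summation over the classes at layer `h`. -/
noncomputable def cs (p : ℕ → Fin S → Fin A → Fin S → ℝ) (h : ℕ) (F : Cls S A → ℝ) : ℝ :=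
  clsSum p (c.bb h) (c.mm h) F

/-- The kernel `R` off the block and `p` on the block. -/
noncomputable def mixK (R p : ℕ → Fin S → Fin A → Fin S → ℝ) (j : ℕ) : Fin S → Fin A → Fin S → ℝ :=
  if c.off j then R j else p j

/-- The expectation of a function of the trajectory under a mixture of policies. -/
noncomputable def expec (p : ℕ → Fin S → Fin A → Fin S → ℝ) (P : c.Det → ℝ)
    (F : List (Fin S × Fin A) → ℝ) : ℝ :=
  ∑ π, P π * pathSum (polK p (c.pol π)) H 0 c.s0 (fun l _ => F l)

theorem pathSum_mixK {h : ℕ} (hh : h < H) (R : ℕ → Fin S → Fin A → Fin S → ℝ)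
    (f : ℕ → Fin S → Fin A) (F : Cls S A → ℝ) :
    pathSum (polK (c.mixK R p) f) h 0 c.s0 (fun l x => ∑ a, detW f h x a *
      F (c.cls h (l ++ [(x, a)]))) =
    c.cs p h (fun y => clsProb c.s0 (c.bb h) (c.mm h) (c.nn h) R f y * F y) := by
  have := pathSum_clsOf (c.s0, c.a0) c.s0 (c.bb h) (c.mm h) (c.nn h) (W := c.mixK R p) (R := R)
    (p := p) f F (fun i hi => if_pos (c.off_of_lt hh (Or.inl hi)))
    (fun i h1 h2 => if_neg (c.not_off_of_le h1 h2))
    (fun i h1 h2 => if_pos (c.off_of_lt hh (Or.inr ⟨h1, h2⟩)))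
  rwa [c.bb_add_mm_add_nn] at this

theorem cs_mixCls_mul (R : ℕ → Fin S → Fin A → Fin S → ℝ) (P : c.Det → ℝ) (h : ℕ)
    (F : Cls S A → ℝ) : c.cs p h (fun y => c.mixCls R P h y * F y) =
      ∑ π, P π * c.cs p h
        (fun y => clsProb c.s0 (c.bb h) (c.mm h) (c.nn h) R (c.pol π) y * F y) := by
  unfold cs mixCls
  simp only [sum_mul, mul_assoc]
  rw [clsSum_sum]
  exact sum_congr rfl fun π _ => clsSum_const_mul _ _

theorem cs_mixCls {h : ℕ} (hh : h < H) (R : ℕ → Fin S → Fin A → Fin S → ℝ) (P : c.Det → ℝ) :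
    c.cs p h (c.mixCls R P h) =
      ∑ π, P π * pathSum (polK (c.mixK R p) (c.pol π)) h 0 c.s0 (fun _ _ => 1) := by
  have h1 := c.cs_mixCls_mul (p := p) R P h (fun _ => 1)
  have h2 := fun π => c.pathSum_mixK (p := p) hh R (c.pol π) (fun _ => 1)
  simp only [mul_one, sum_detW] at h1 h2
  rw [h1]
  exact sum_congr rfl fun π _ => by rw [h2]

/-- The law of the survival-weighted class. -/
theorem expec_surv_mul (hp : ∀ j, IsKernel (p j)) {h : ℕ} (hh : h < H) (P : c.Det → ℝ)
    (F : Cls S A → ℝ) :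
    c.expec p P (fun L => pathProd (c.surv past) 0 (L.take h) * F (c.cls h L)) =
      c.cs p h (fun y =>
        c.mixCls (fun j s a x => c.surv past j s a * p j s a x) P h y * F y) := by
  rw [cs_mixCls_mul]
  refine sum_congr rfl fun π _ => ?_
  congr 1
  rw [← c.pathSum_mixK hh]
  obtain ⟨n, hn⟩ : ∃ n, H = h + 1 + n := ⟨H - (h + 1), by omega⟩
  have e1 : ∀ L : List (Fin S × Fin A),
      pathProd (c.surv past) 0 (L.take h) * F (c.cls h L) =
      pathProd (c.surv past) 0 ((L.take (h + 1)).take h) * F (c.cls h (L.take (h + 1))) := by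
    intro L
    have b1 := c.bb_add_mm_add_nn h
    congr 2
    · rw [List.take_take]; congr 1; omega
    · have g : ∀ i < h + 1, ∀ d : Fin S × Fin A, (L.take (h + 1)).getD i d = L.getD i d := by
        intro i hi d
        simp [List.getD_eq_getElem?_getD, hi]
      unfold cls clsOf
      rw [g _ (by omega), g _ (by omega), List.drop_take, List.take_take,
        min_eq_left (by omega)]
  have e2 : (fun j s a x => polK (c.mixK (fun j s a x => c.surv past j s a * p j s a x) p)
      (c.pol π) j s a x) = fun j s a x => c.surv past j s a * polK p (c.pol π) j s a x := by
    funext j s a x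
    unfold polK mixK
    split_ifs with ho
    · ring
    · simp [surv, ho]
  rw [show (fun L : List (Fin S × Fin A) => pathProd (c.surv past) 0 (L.take h) *
    F (c.cls h L)) = _ from funext e1]
  have e3 := pathSum_take hp c.s0 (q := detW (c.pol π)) (sum_detW _) h n
    (fun L => pathProd (c.surv past) 0 (L.take h) * F (c.cls h L))
  rw [← hn] at e3
  refine e3.trans ?_
  change _ = pathSum (fun j s a x => polK (c.mixK (fun j s a x => c.surv past j s a * p j s a x) p)
      (c.pol π) j s a x) _ _ _ _
  rw [e2, pathSum_mul_weight (polK p (c.pol π)) (c.surv past)]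
  refine pathSum_congr _ fun l x hl _ => ?_
  rw [mul_sum]
  refine sum_congr rfl fun a _ => ?_
  rw [List.take_append_of_le_length (by omega), List.take_of_length_le (by omega)]
  ring

/-- The expected cumulative killing rate. -/
noncomputable def kilF (p : ℕ → Fin S → Fin A → Fin S → ℝ) (P : c.Det → ℝ) : ℝ :=
  c.expec p P (pathAdd (c.kil past) 0)

theorem expec_nonneg (hp : ∀ j, IsKernel (p j)) {P : c.Det → ℝ} (hP : ∀ π, 0 ≤ P π)
    {F : List (Fin S × Fin A) → ℝ} (hF : ∀ l, 0 ≤ F l) : 0 ≤ c.expec p P F :=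
  sum_nonneg fun π _ => mul_nonneg (hP π)
    (pathSum_nonneg (polK_nonneg (fun j => (hp j).1) _) fun l _ _ _ => hF l)

theorem expec_mono (hp : ∀ j, IsKernel (p j)) {P : c.Det → ℝ} (hP : ∀ π, 0 ≤ P π)
    {F G : List (Fin S × Fin A) → ℝ} (hF : ∀ l, l.length = H → F l ≤ G l) :
    c.expec p P F ≤ c.expec p P G :=
  sum_le_sum fun π _ => mul_le_mul_of_nonneg_left
    (pathSum_mono (polK_nonneg (fun j => (hp j).1) _) fun l _ hl _ => hF l hl) (hP π)

theorem expec_add (P : c.Det → ℝ) (F G : List (Fin S × Fin A) → ℝ) :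
    c.expec p P (fun l => F l + G l) = c.expec p P F + c.expec p P G := by
  unfold expec
  rw [← sum_add_distrib]
  refine sum_congr rfl fun π _ => ?_
  rw [pathSum_add]; ring

theorem expec_const_mul (P : c.Det → ℝ) (r : ℝ) (F : List (Fin S × Fin A) → ℝ) :
    c.expec p P (fun l => r * F l) = r * c.expec p P F := by
  unfold expec
  rw [mul_sum]
  refine sum_congr rfl fun π _ => ?_
  rw [pathSum_const_mul]; ring

theorem expec_const (hp : ∀ j, IsKernel (p j)) {P : c.Det → ℝ} (hP1 : ∑ π, P π = 1) (r : ℝ) :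
    c.expec p P (fun _ => r) = r := by
  unfold expec
  simp only [pathSum_const _ _ _ _ (sum_polK_eq_one hp _), ← sum_mul, hP1, one_mul]

theorem kilF_nonneg (hp : ∀ j, IsKernel (p j)) {P : c.Det → ℝ} (hP : ∀ π, 0 ≤ P π) :
    0 ≤ c.kilF past p P :=
  c.expec_nonneg hp hP fun l => pathAdd_nonneg (c.kil_nonneg past) 0 l

theorem pathAdd_append (d : ℕ → Fin S → Fin A → ℝ) (j : ℕ) (l l' : List (Fin S × Fin A)) :
    pathAdd d j (l ++ l') = pathAdd d j l + pathAdd d (j + l.length) l' := by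
  induction l generalizing j with
  | nil => simp [pathAdd]
  | cons x l ih =>
    simp only [List.cons_append, pathAdd, ih, List.length_cons]
    rw [show j + 1 + l.length = j + (l.length + 1) by omega]; ring

theorem pathAdd_const_mul (d : ℕ → Fin S → Fin A → ℝ) (r : ℝ) (j : ℕ)
    (l : List (Fin S × Fin A)) :
    pathAdd (fun j s a => r * d j s a) j l = r * pathAdd d j l := by
  induction l generalizing j with
  | nil => simp [pathAdd]
  | cons x l ih => simp only [pathAdd, ih]; ring

/-- The mass lost by a lower kernel is controlled by the killing rates. -/
theorem one_sub_cs_mixCls_le (hp : ∀ j, IsKernel (p j)) {h : ℕ} (hh : h < H)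
    {R : ℕ → Fin S → Fin A → Fin S → ℝ} (hR0 : ∀ j s a x, 0 ≤ R j s a x)
    (hR : ∀ j, c.off j → ∀ s a x, R j s a x ≤ p j s a x)
    (hR1 : ∀ j, c.off j → ∀ s a, 1 - 2 * c.kil past j s a ≤ ∑ x, R j s a x)
    {P : c.Det → ℝ} (hP : ∀ π, 0 ≤ P π) (hP1 : ∑ π, P π = 1) :
    1 - c.cs p h (c.mixCls R P h) ≤ 2 * c.kilF past p P := by
  have e0 : ∀ f : c.Det → ℝ, 1 - ∑ π, P π * f π = ∑ π, P π * (1 - f π) := fun f => by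
    simp only [mul_sub, mul_one, sum_sub_distrib, hP1]
  rw [c.cs_mixCls hh, e0, kilF, ← expec_const_mul]
  refine sum_le_sum fun π _ => ?_
  refine mul_le_mul_of_nonneg_left ?_ (hP π)
  have h1 := one_sub_pathSum_le (W := polK p (c.pol π)) (W' := polK (c.mixK R p) (c.pol π))
    (d := fun j s a => 2 * c.kil past j s a)
    (fun j s a => mul_nonneg zero_le_two (c.kil_nonneg past j s a))
    (polK_nonneg (fun j s a x => by
      unfold mixK; split_ifs
      · exact hR0 _ _ _ _
      · exact (hp j).1 _ _ _) _)
    (fun j s a x => mul_le_mul_of_nonneg_left (by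
      unfold mixK; split_ifs with ho
      · exact hR _ ho _ _ _
      · exact le_rfl) (detW_nonneg _ _ _ _))
    (sum_polK_eq_one hp _)
    (fun j s a => by
      unfold polK
      rw [← mul_sum, ← mul_sum, mul_assoc]
      refine mul_le_mul_of_nonneg_left ?_ (detW_nonneg _ _ _ _)
      rw [(hp j).2, one_mul]
      unfold mixK; split_ifs with ho
      · exact hR1 _ ho _ _
      · rw [(hp j).2]; linarith [c.kil_nonneg past j s a]) h 0 c.s0
  refine h1.trans ?_
  obtain ⟨n, rfl⟩ : ∃ n, H = h + n := ⟨H - h, by omega⟩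
  rw [pathSum_append]
  refine pathSum_mono (polK_nonneg (fun j => (hp j).1) _) fun l x _ _ => ?_
  calc pathAdd (fun j s a => 2 * c.kil past j s a) 0 l =
      pathSum (polK p (c.pol π)) n (0 + h) x (fun _ _ => 2 * pathAdd (c.kil past) 0 l) := by
        rw [pathSum_const _ _ _ _ (sum_polK_eq_one hp _), pathAdd_const_mul]
    _ ≤ _ := by
        refine pathSum_mono (polK_nonneg (fun j => (hp j).1) _) fun l' y _ _ => ?_
        dsimp only
        rw [pathAdd_append]
        have := pathAdd_nonneg (c.kil_nonneg past) (0 + l.length) l'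
        linarith

theorem cs_mixCls_le_one (hp : ∀ j, IsKernel (p j)) {h : ℕ} (hh : h < H)
    {R : ℕ → Fin S → Fin A → Fin S → ℝ} (hR0 : ∀ j s a x, 0 ≤ R j s a x)
    (hR : ∀ j s a, ∑ x, R j s a x ≤ 1)
    {P : c.Det → ℝ} (hP : ∀ π, 0 ≤ P π) (hP1 : ∑ π, P π = 1) :
    c.cs p h (c.mixCls R P h) ≤ 1 := by
  rw [c.cs_mixCls hh]
  refine (sum_le_sum fun π _ => mul_le_of_le_one_right (hP π) ?_).trans_eq hP1
  refine pathSum_one_le _ _ _ (polK_nonneg (fun j s a x => by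
      unfold mixK; split_ifs
      · exact hR0 _ _ _ _
      · exact (hp j).1 _ _ _) _) fun j s => ?_
  rw [sum_polK]
  unfold mixK; split_ifs
  · exact hR _ _ _
  · exact ((hp j).2 _ _).le

end episode
end Cfg

namespace Cfg
variable {H : ℕ} (c : Cfg S A H)

/-! ### Moments of the estimators in one episode -/

section moments
variable (past : List (BanditObs S A H)) {p : ℕ → Fin S → Fin A → Fin S → ℝ}
  {P : c.Det → ℝ} {ℓ : ℕ → Fin S → Fin A → ℝ} {z : c.Idx → ℝ}

theorem sim_nonneg (h : ℕ) (ω : SubPol S A c.lam) (x : Cls S A) : 0 ≤ c.sim h ω x := by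
  unfold sim
  have := pathProd_detW_nonneg (c.blkPol ω.2.1) (c.bb h) x.1
  split_ifs <;> simp [this]

theorem pathProd_le_one {r : ℕ → Fin S → Fin A → ℝ} (h0 : ∀ j s a, 0 ≤ r j s a)
    (h1 : ∀ j s a, r j s a ≤ 1) (j : ℕ) (l : List (Fin S × Fin A)) :
    0 ≤ pathProd r j l ∧ pathProd r j l ≤ 1 := by
  induction l generalizing j with
  | nil => exact ⟨zero_le_one, le_rfl⟩
  | cons x l ih =>
    exact ⟨mul_nonneg (h0 _ _ _) (ih _).1, mul_le_one₀ (h1 _ _ _) (ih _).1 (ih _).2⟩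

theorem sim_le_one (h : ℕ) (ω : SubPol S A c.lam) (x : Cls S A) : c.sim h ω x ≤ 1 := by
  unfold sim
  have h1 := pathProd_le_one (detW_nonneg (c.blkPol ω.2.1))
    (fun j s a => by unfold detW; split_ifs <;> norm_num) (c.bb h) x.1
  split_ifs <;> simp [h1.2]

/-- Sums of product functions over the classes. -/
theorem cs_mul_pathProd (h : ℕ) (f : Fin S → ℝ) (q : ℕ → Fin S → Fin A)
    (g : Fin S → Fin S × Fin A → ℝ) :
    c.cs p h (fun y => f (headState y.1 y.2.1) * pathProd (detW q) (c.bb h) y.1 * g y.2.1 y.2.2) =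
      ∑ y, f y * pathSum (polK p q) (c.mm h) (c.bb h) y (fun _ x => ∑ s, ∑ a, g x (s, a)) := by
  unfold cs clsSum
  refine sum_congr rfl fun y _ => ?_
  have e : polK p q = fun j s a x => detW q j s a * p j s a x := rfl
  rw [e, pathSum_mul_weight, ← pathSum_const_mul]
  refine pathSum_congr _ fun l x _ hx => ?_
  simp only [hx, mul_sum, mul_assoc]

theorem cs_sim (hp : ∀ j, IsKernel (p j)) (h : ℕ) (ω : SubPol S A c.lam) :
    c.cs p h (c.sim h ω) = 1 := by
  have := c.cs_mul_pathProd (p := p) h (fun y => if y = ω.1 then 1 else 0) (c.blkPol ω.2.1)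
    (fun x u => if ω.2.2 x = u then 1 else 0)
  refine this.trans ?_
  have e : ∀ x, ∑ s, ∑ a, (if ω.2.2 x = (s, a) then (1 : ℝ) else 0) = 1 := by
    intro x
    rw [← Fintype.sum_prod_type' (f := fun s a => if ω.2.2 x = (s, a) then (1 : ℝ) else 0)]
    simp
  simp only [e, pathSum_const _ _ _ _ (sum_polK_eq_one hp _)]
  simp

/-- The expected loss at a layer of a sub-policy. -/
noncomputable def lossW (p : ℕ → Fin S → Fin A → Fin S → ℝ) (ℓ : ℕ → Fin S → Fin A → ℝ)
    (i : c.Idx) : ℝ := c.cs p i.1 (fun y => c.sim i.1 i.2 y * ℓ i.1 y.2.2.1 y.2.2.2)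

theorem lossW_nonneg (hp : ∀ j, IsKernel (p j)) (hℓ : IsLoss H ℓ) (i : c.Idx) :
    0 ≤ c.lossW p ℓ i := by
  unfold lossW cs
  refine clsSum_nonneg (fun j => (hp j).1) fun y => ?_
  exact mul_nonneg (c.sim_nonneg _ _ _) (hℓ i.1 y.2.2.1 y.2.2.2 i.1.isLt).1

theorem lossW_le_one (hp : ∀ j, IsKernel (p j)) (hℓ : IsLoss H ℓ) (i : c.Idx) :
    c.lossW p ℓ i ≤ 1 := by
  rw [← c.cs_sim hp i.1 i.2]
  unfold lossW cs
  refine clsSum_mono (fun j => (hp j).1) fun y _ => ?_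
  exact mul_le_of_le_one_right (c.sim_nonneg _ _ _) (hℓ i.1 y.2.2.1 y.2.2.2 i.1.isLt).2

/-- The estimator as a function of the trajectory. -/
noncomputable def estL (P : c.Det → ℝ) (ℓ : ℕ → Fin S → Fin A → ℝ) (L : List (Fin S × Fin A))
    (i : c.Idx) : ℝ :=
  pathProd (c.surv past) 0 (L.take i.1) * (c.sim i.1 i.2 (c.cls i.1 L) *
    ℓ i.1 (c.cls i.1 L).2.2.1 (c.cls i.1 L).2.2.2 /
      (c.mixCls (c.kerU past) P i.1 (c.cls i.1 L) + c.γ))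

theorem est_eq (t : Fin H → Fin S × Fin A) (i : c.Idx) :
    c.est past P (t, fun h => ℓ h (t h).1 (t h).2) i = c.estL past P ℓ (List.ofFn t) i := by
  have e : (c.cls i.1 (List.ofFn t)).2.2 = t i.1 := by
    unfold cls clsOf
    simp only [c.bb_add_mm_add_nn]
    simp [List.getD_eq_getElem?_getD]
  unfold est estL
  rw [e]; ring

theorem mixCls_nonneg {R : ℕ → Fin S → Fin A → Fin S → ℝ} (hR : ∀ j s a x, 0 ≤ R j s a x)
    (hP : ∀ π, 0 ≤ P π) (h : ℕ) (y : Cls S A) : 0 ≤ c.mixCls R P h y :=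
  sum_nonneg fun π _ => mul_nonneg (hP π) (clsProb_nonneg _ _ _ _ hR _ _)

theorem mixCls_mono {R R' : ℕ → Fin S → Fin A → Fin S → ℝ} (hR : ∀ j s a x, 0 ≤ R j s a x)
    (hR' : ∀ j s a x, 0 ≤ R' j s a x)
    (hRR : ∀ j, c.off j → ∀ s a x, R j s a x ≤ R' j s a x)
    (hP : ∀ π, 0 ≤ P π) {h : ℕ} (hh : h < H) (y : Cls S A) :
    c.mixCls R P h y ≤ c.mixCls R' P h y :=
  sum_le_sum fun π _ => mul_le_mul_of_nonneg_left
    (clsProb_mono _ _ _ _ hR hR' (fun j hj => hRR j (c.off_of_lt hh hj)) _ _) (hP π)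

/-- The survival-weighted kernel. -/
noncomputable def kerD (p : ℕ → Fin S → Fin A → Fin S → ℝ) (j : ℕ) (s : Fin S) (a : Fin A)
    (x : Fin S) : ℝ := c.surv past j s a * p j s a x

theorem kerD_nonneg (hp : ∀ j, IsKernel (p j)) (j : ℕ) (s : Fin S) (a : Fin A) (x : Fin S) :
    0 ≤ c.kerD past p j s a x := mul_nonneg (c.surv_nonneg _ _ _ _) ((hp j).1 _ _ _)

theorem expec_surv (hp : ∀ j, IsKernel (p j)) {h : ℕ} (hh : h < H) (P : c.Det → ℝ)
    (F : Cls S A → ℝ) :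
    c.expec p P (fun L => pathProd (c.surv past) 0 (L.take h) * F (c.cls h L)) =
      c.cs p h (fun y => c.mixCls (c.kerD past p) P h y * F y) := c.expec_surv_mul past hp hh P F

theorem mixCls_kerD_le (hp : ∀ j, IsKernel (p j)) (hc : c.conf past p)
    (hP : ∀ π, 0 ≤ P π) {h : ℕ} (hh : h < H) (y : Cls S A) :
    c.mixCls (c.kerD past p) P h y ≤ c.mixCls (c.kerU past) P h y :=
  c.mixCls_mono (c.kerD_nonneg past hp) (c.kerU_nonneg past)
    (fun j hj s a x => (hc j hj s a x).2) hP hh y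

theorem exp_mul_le {κ g : ℝ} (h0 : 0 ≤ κ) (h1 : κ ≤ 1) :
    Real.exp (κ * g) ≤ 1 + κ * (Real.exp g - 1) := by
  have := convexOn_exp.2 (Set.mem_univ 0) (Set.mem_univ g) (sub_nonneg.2 h1) h0 (by ring)
  simp only [smul_eq_mul, mul_zero, zero_add, Real.exp_zero, mul_one] at this
  linarith

theorem mul_exp_sub_one_le {u d γ x : ℝ} (hγ : 0 < γ) (hd : 0 ≤ d) (hdu : d ≤ u)
    (hx : 0 ≤ x) (hx1 : x ≤ 1) : d * (Real.exp (γ * (x / (u + γ))) - 1) ≤ γ * x := by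
  rcases (hd.trans hdu).eq_or_lt with hu | hu
  · rw [le_antisymm (hdu.trans hu.symm.le) hd, zero_mul]; positivity
  have h1 : γ * (x / (u + γ)) ≤ Real.log (1 + γ * x / u) := by
    have h2 := Real.one_sub_inv_le_log_of_pos (x := 1 + γ * x / u) (by positivity)
    refine le_trans ?_ h2
    have e : 1 - (1 + γ * x / u)⁻¹ = γ * x / (u + γ * x) := by
      field_simp; ring
    rw [e, mul_div_assoc']
    refine div_le_div_of_nonneg_left (by positivity) (by positivity) ?_
    nlinarith
  have h3 : Real.exp (γ * (x / (u + γ))) ≤ 1 + γ * x / u := by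
    rw [← Real.exp_log (show 0 < 1 + γ * x / u by positivity)]
    exact Real.exp_le_exp.2 h1
  calc _ ≤ d * (γ * x / u) := mul_le_mul_of_nonneg_left (by linarith) hd
    _ ≤ u * (γ * x / u) := mul_le_mul_of_nonneg_right hdu (by positivity)
    _ = γ * x := mul_div_cancel₀ _ hu.ne'

/-- The exponential moment of the estimator. -/
theorem expec_exp_est_le (hp : ∀ j, IsKernel (p j)) (hc : c.conf past p) (hℓ : IsLoss H ℓ)
    (hP : ∀ π, 0 ≤ P π) (hP1 : ∑ π, P π = 1) (i : c.Idx) :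
    c.expec p P (fun L => Real.exp (c.γ * c.estL past P ℓ L i)) ≤
      Real.exp (c.γ * c.lossW p ℓ i) := by
  have hh := i.1.isLt
  set G : Cls S A → ℝ := fun y => Real.exp (c.γ * (c.sim i.1 i.2 y * ℓ i.1 y.2.2.1 y.2.2.2 /
      (c.mixCls (c.kerU past) P i.1 y + c.γ))) - 1 with hG
  calc _ ≤ c.expec p P (fun L => 1 + pathProd (c.surv past) 0 (L.take i.1) *
        G (c.cls i.1 L)) := by
        refine c.expec_mono hp hP fun L _ => ?_
        have hs := pathProd_le_one (c.surv_nonneg past) (c.surv_le_one past) 0 (L.take i.1)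
        unfold estL
        rw [mul_left_comm]
        exact exp_mul_le hs.1 hs.2
    _ = 1 + c.cs p i.1 (fun y => c.mixCls (c.kerD past p) P i.1 y * G y) := by
        rw [expec_add, c.expec_const hp hP1, c.expec_surv past hp hh]
    _ ≤ 1 + c.γ * c.lossW p ℓ i := by
        unfold lossW cs
        rw [← clsSum_const_mul]
        gcongr
        refine clsSum_mono (fun j => (hp j).1) fun y _ => ?_
        refine mul_exp_sub_one_le c.γ_pos (c.mixCls_nonneg (c.kerD_nonneg past hp) hP _ _)
          (c.mixCls_kerD_le past hp hc hP hh y)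
          (mul_nonneg (c.sim_nonneg _ _ _) (hℓ _ _ _ hh).1)
          (mul_le_one₀ (c.sim_le_one _ _ _) (hℓ _ _ _ hh).1 (hℓ _ _ _ hh).2)
    _ ≤ _ := by linarith [Real.add_one_le_exp (c.γ * c.lossW p ℓ i)]

end moments
end Cfg

namespace Cfg
variable {H : ℕ} (c : Cfg S A H)

section layer
variable (past : List (BanditObs S A H)) {p : ℕ → Fin S → Fin A → Fin S → ℝ}
  {P : c.Det → ℝ} {ℓ : ℕ → Fin S → Fin A → ℝ} {z : c.Idx → ℝ}

theorem simZ_mem (hz0 : ∀ i, 0 ≤ z i) {h : Fin H} (hz1 : ∑ ω, z (h, ω) = 1) (y : Cls S A) :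
    0 ≤ c.simZ z h y ∧ c.simZ z h y ≤ 1 := by
  refine ⟨sum_nonneg fun ω _ => mul_nonneg (hz0 _) (c.sim_nonneg _ _ _), ?_⟩
  rw [← hz1]
  exact sum_le_sum fun ω _ => mul_le_of_le_one_right (hz0 _) (c.sim_le_one _ _ _)

theorem cs_simZ_mul (h : Fin H) (F : Cls S A → ℝ) :
    c.cs p h (fun y => c.simZ z h y * F y) =
      ∑ ω, z (h, ω) * c.cs p h (fun y => c.sim h ω y * F y) := by
  unfold cs simZ
  simp only [sum_mul, mul_assoc]
  rw [clsSum_sum]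
  exact sum_congr rfl fun ω _ => clsSum_const_mul _ _

theorem cs_simZ (hp : ∀ j, IsKernel (p j)) {h : Fin H} (hz1 : ∑ ω, z (h, ω) = 1) :
    c.cs p h (c.simZ z h) = 1 := by
  have := c.cs_simZ_mul (p := p) (z := z) h (fun _ => 1)
  simp only [mul_one] at this
  rw [this, ← hz1]
  refine sum_congr rfl fun ω _ => ?_
  have e := c.cs_sim hp h ω
  unfold cs at e ⊢
  rw [e, mul_one]

theorem one_sub_cs_kerL_le (hp : ∀ j, IsKernel (p j)) (hc : c.conf past p)
    (hP : ∀ π, 0 ≤ P π) (hP1 : ∑ π, P π = 1) {h : ℕ} (hh : h < H) :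
    1 - c.cs p h (c.mixCls (c.kerL past) P h) ≤ 2 * c.kilF past p P :=
  c.one_sub_cs_mixCls_le past hp hh (c.kerL_nonneg past) (fun j hj s a x => (hc j hj s a x).1)
    (fun j hj s a => by unfold kil; rw [if_pos hj]; exact c.le_sum_kerL past j s a) hP hP1

theorem one_sub_cs_kerD_le (hp : ∀ j, IsKernel (p j))
    (hP : ∀ π, 0 ≤ P π) (hP1 : ∑ π, P π = 1) {h : ℕ} (hh : h < H) :
    1 - c.cs p h (c.mixCls (c.kerD past p) P h) ≤ 2 * c.kilF past p P :=
  c.one_sub_cs_mixCls_le past hp hh (c.kerD_nonneg past hp)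
    (fun j _ s a x => mul_le_of_le_one_left ((hp j).1 _ _ _) (c.surv_le_one _ _ _ _))
    (fun j _ s a => by
      unfold kerD
      rw [← mul_sum, (hp j).2, mul_one]
      exact c.one_sub_kil_le_surv past j s a) hP hP1

theorem cs_kerU_le (hp : ∀ j, IsKernel (p j))
    (hP : ∀ π, 0 ≤ P π) (hP1 : ∑ π, P π = 1) {h : ℕ} (hh : h < H) :
    c.cs p h (c.mixCls (c.kerU past) P h) ≤ 1 :=
  c.cs_mixCls_le_one hp hh (c.kerU_nonneg past) (c.sum_kerU_le past) hP hP1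

theorem mixK_self (p : ℕ → Fin S → Fin A → Fin S → ℝ) : c.mixK p p = p := by
  funext j; unfold mixK; split_ifs <;> rfl

theorem cs_mixCls_self (hp : ∀ j, IsKernel (p j)) (hP1 : ∑ π, P π = 1) {h : ℕ} (hh : h < H) :
    c.cs p h (c.mixCls p P h) = 1 := by
  rw [c.cs_mixCls hh, mixK_self]
  simp only [pathSum_const _ _ _ _ (sum_polK_eq_one hp _), mul_one, hP1]

/-- The expected loss at a layer of a mixture of policies. -/
noncomputable def layerV (p : ℕ → Fin S → Fin A → Fin S → ℝ) (P : c.Det → ℝ)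
    (ℓ : ℕ → Fin S → Fin A → ℝ) (h : ℕ) : ℝ :=
  ∑ π, P π * layerVal p (detW (c.pol π)) ℓ c.s0 h

theorem layerV_eq {h : ℕ} (hh : h < H) : c.layerV p P ℓ h =
    c.cs p h (fun y => c.mixCls p P h y * ℓ h y.2.2.1 y.2.2.2) := by
  rw [cs_mixCls_mul, layerV]
  refine sum_congr rfl fun π _ => ?_
  rw [← c.pathSum_mixK hh, mixK_self]
  congr 1
  refine pathSum_congr _ fun l x hl _ => sum_congr rfl fun a _ => ?_
  have e : (c.cls h (l ++ [(x, a)])).2.2 = (x, a) := by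
    unfold cls clsOf
    simp only [c.bb_add_mm_add_nn]
    simp [List.getD_eq_getElem?_getD, hl]
  rw [e]

theorem cs_sub (h : ℕ) (F G : Cls S A → ℝ) :
    c.cs p h (fun y => F y - G y) = c.cs p h F - c.cs p h G := clsSum_sub _ _

theorem cs_add (h : ℕ) (F G : Cls S A → ℝ) :
    c.cs p h (fun y => F y + G y) = c.cs p h F + c.cs p h G := clsSum_add _ _

theorem cs_const_mul (h : ℕ) (r : ℝ) (F : Cls S A → ℝ) :
    c.cs p h (fun y => r * F y) = r * c.cs p h F := clsSum_const_mul _ _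

theorem cs_mono (hp : ∀ j, IsKernel (p j)) {h : ℕ} {F G : Cls S A → ℝ}
    (hFG : ∀ y : Cls S A, y.1.length = c.mm h → F y ≤ G y) : c.cs p h F ≤ c.cs p h G :=
  clsSum_mono (fun j => (hp j).1) hFG

/-- A bound on the number of classes of a layer. -/
noncomputable def numC : ℝ := (S : ℝ) ^ 2 * (A : ℝ) ^ (c.lam + 1)

theorem cs_one_le (hp : ∀ j, IsKernel (p j)) (h : ℕ) : c.cs p h (fun _ => 1) ≤ c.numC := by
  unfold cs numC
  rw [clsSum_one hp]
  have hA : (1 : ℝ) ≤ A := by exact_mod_cast c.a0.pos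
  have := pow_le_pow_right₀ hA (show c.mm h ≤ c.lam by unfold mm; omega)
  have hS := c.S_pos
  calc (S : ℝ) * A ^ c.mm h * (S * A) = S ^ 2 * (A ^ c.mm h * A) := by ring
    _ ≤ S ^ 2 * (A ^ c.lam * A) := by gcongr
    _ = _ := by ring

theorem exp_le_quadratic {w : ℝ} (hw : w ≤ 1) : Real.exp w ≤ 1 + w + w ^ 2 := by
  rcases le_total 0 w with h | h
  · have := (abs_le.1 (Real.abs_exp_sub_one_sub_id_le (abs_le.2 ⟨by linarith, hw⟩))).2
    linarith
  · have := exp_neg_le_quadratic (neg_nonneg.2 h)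
    rw [neg_neg] at this
    nlinarith

theorem exp_sub_le {a b a' : ℝ} (h1 : a ≤ a') (ha' : 0 ≤ a') (ha1 : a' ≤ 1) (hb : 0 ≤ b)
    (hba : b ^ 2 ≤ a') : Real.exp (a - b) ≤ 1 + (3 * a' - b) := by
  have h2 : Real.exp (a - b) ≤ Real.exp (a' - b) := Real.exp_le_exp.2 (by linarith)
  have h3 := exp_le_quadratic (show a' - b ≤ 1 by linarith)
  nlinarith [mul_nonneg ha' hb, mul_nonneg ha' (sub_nonneg.2 ha1)]

section feasible
variable (hp : ∀ j, IsKernel (p j)) (hc : c.conf past p) (hℓ : IsLoss H ℓ)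
  (hz : (z, P) ∈ c.feas past) (h : Fin H)
include hp hc hz

theorem cs_gap_le : c.cs p h (fun y => c.simZ z h y - (1 - c.β) * c.mixCls (c.kerL past) P h y) ≤
    c.β + 2 * c.kilF past p P := by
  have h1 := c.one_sub_cs_kerL_le past hp hc hz.2.2.1 hz.2.2.2.1 h.isLt
  have h2 := c.cs_simZ (z := z) hp (hz.2.1 h)
  have h3 := c.kilF_nonneg past hp hz.2.2.1
  rw [cs_sub, cs_const_mul, h2]
  have h4 := c.β_pos
  have h5 := c.β_le
  have h6 := mul_le_mul_of_nonneg_left h1 (sub_nonneg.2 h5)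
  nlinarith [mul_nonneg h4.le h3]

theorem cs_div_le : c.cs p h (fun y => c.simZ z h y / (c.mixCls (c.kerU past) P h y + c.γ)) ≤
    (c.β + 2 * c.kilF past p P) / c.γ + c.numC := by
  have hg := c.γ_pos
  calc _ ≤ c.cs p h (fun y => 1 / c.γ *
          (c.simZ z h y - (1 - c.β) * c.mixCls (c.kerL past) P h y) + 1) := by
        refine c.cs_mono hp fun y hy => ?_
        have hU := c.mixCls_nonneg (c.kerU_nonneg past) hz.2.2.1 h y
        have hL := c.mixCls_nonneg (c.kerL_nonneg past) hz.2.2.1 h y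
        have hLU := c.mixCls_mono (c.kerL_nonneg past) (c.kerU_nonneg past)
          (fun j _ => c.kerL_le_kerU past j) hz.2.2.1 h.isLt y
        have hf := hz.2.2.2.2 h y hy
        have h4 := c.β_pos
        have h5 := c.β_le
        generalize c.mixCls (c.kerU past) P h y = u at *
        generalize c.mixCls (c.kerL past) P h y = l at *
        dsimp only at hf
        generalize c.simZ z h y = x at *
        rw [div_le_iff₀ (by linarith)]
        have e1 : 1 / c.γ * (x - (1 - c.β) * l) * c.γ = x - (1 - c.β) * l := by
          field_simp
        have e2 : 0 ≤ 1 / c.γ * (x - (1 - c.β) * l) * u :=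
          mul_nonneg (mul_nonneg (by positivity) (by linarith)) hU
        nlinarith
    _ ≤ _ := by
        rw [cs_add, cs_const_mul]
        have h1 := c.cs_gap_le past hp hc hz h
        have h2 := c.cs_one_le hp h
        refine add_le_add ?_ h2
        rw [one_div_mul_eq_div]
        exact div_le_div_of_nonneg_right h1 hg.le

include hℓ

theorem layerV_sub_le : c.layerV p P ℓ h -
    c.cs p h (fun y => c.simZ z h y * ℓ h y.2.2.1 y.2.2.2) ≤ c.β + 2 * c.kilF past p P := by
  rw [c.layerV_eq h.isLt, ← cs_sub]
  have h1 := c.one_sub_cs_kerL_le past hp hc hz.2.2.1 hz.2.2.2.1 h.isLt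
  have h2 := c.cs_mixCls_self hp hz.2.2.2.1 h.isLt
  have h3 := c.kilF_nonneg past hp hz.2.2.1
  have h4 := c.β_pos
  have h5 := c.β_le
  calc _ ≤ c.cs p h (fun y => c.mixCls p P h y - (1 - c.β) * c.mixCls (c.kerL past) P h y) := by
        refine c.cs_mono hp fun y hy => ?_
        have hl := hℓ h y.2.2.1 y.2.2.2 h.isLt
        have hL := c.mixCls_nonneg (c.kerL_nonneg past) hz.2.2.1 h y
        have hLp := c.mixCls_mono (c.kerL_nonneg past) (fun j => (hp j).1)
          (fun j hj s a x => (hc j hj s a x).1) hz.2.2.1 h.isLt y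
        have hf := hz.2.2.2.2 h y hy
        dsimp only at hf
        have := mul_le_mul_of_nonneg_right hf hl.1
        have h8 : 0 ≤ (c.mixCls p P h y - (1 - c.β) * c.mixCls (c.kerL past) P h y) := by
          nlinarith
        have := mul_le_of_le_one_right h8 hl.2
        linarith
    _ ≤ _ := by
        rw [cs_sub, cs_const_mul, h2]
        have h6 := mul_le_mul_of_nonneg_left h1 (sub_nonneg.2 h5)
        nlinarith [mul_nonneg h4.le h3]

theorem cs_sub_mean_le : c.cs p h (fun y => c.simZ z h y * ℓ h y.2.2.1 y.2.2.2) -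
    c.cs p h (fun y => c.mixCls (c.kerD past p) P h y * (c.simZ z h y * ℓ h y.2.2.1 y.2.2.2 /
      (c.mixCls (c.kerU past) P h y + c.γ))) ≤
    c.β + 4 * c.kilF past p P + c.γ * c.numC := by
  have hg := c.γ_pos
  rw [← cs_sub]
  calc _ ≤ c.cs p h (fun y => (c.simZ z h y - (1 - c.β) * c.mixCls (c.kerL past) P h y) +
        ((c.mixCls (c.kerU past) P h y - c.mixCls (c.kerD past p) P h y) + c.γ * 1)) := by
        refine c.cs_mono hp fun y hy => ?_
        have hl := hℓ h y.2.2.1 y.2.2.2 h.isLt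
        have hL := c.mixCls_nonneg (c.kerL_nonneg past) hz.2.2.1 h y
        have hD := c.mixCls_nonneg (c.kerD_nonneg past hp) hz.2.2.1 h y
        have hDU := c.mixCls_kerD_le past hp hc hz.2.2.1 h.isLt y
        have hLU := c.mixCls_mono (c.kerL_nonneg past) (c.kerU_nonneg past)
          (fun j _ => c.kerL_le_kerU past j) hz.2.2.1 h.isLt y
        have hf := hz.2.2.2.2 h y hy
        dsimp only at hf
        have h4 := c.β_pos
        have h5 := c.β_le
        have hz0 := mul_nonneg (sub_nonneg.2 h5) hL
        generalize c.mixCls (c.kerU past) P h y = u at *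
        generalize c.mixCls (c.kerL past) P h y = l at *
        generalize c.mixCls (c.kerD past p) P h y = d at *
        generalize c.simZ z h y = x at *
        generalize ℓ h y.2.2.1 y.2.2.2 = v at *
        have hr0 : 0 ≤ 1 - d / (u + c.γ) := by
          rw [sub_nonneg, div_le_one (by linarith)]; linarith
        have hr1 : 1 - d / (u + c.γ) ≤ 1 := by
          have : 0 ≤ d / (u + c.γ) := div_nonneg hD (by linarith)
          linarith
        have hru : (u + c.γ) * (1 - d / (u + c.γ)) = u + c.γ - d := by
          have : u + c.γ ≠ 0 := by linarith
          field_simp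
        have e : x * v - d * (x * v / (u + c.γ)) = x * v * (1 - d / (u + c.γ)) := by ring
        rw [e]
        generalize 1 - d / (u + c.γ) = r at *
        calc x * v * r ≤ x * r := by nlinarith [mul_nonneg (hz0.trans hf) hr0]
          _ = (x - (1 - c.β) * l) * r + (1 - c.β) * l * r := by ring
          _ ≤ (x - (1 - c.β) * l) * 1 + (u + c.γ) * r := by
              refine add_le_add (mul_le_mul_of_nonneg_left hr1 (by linarith))
                (mul_le_mul_of_nonneg_right ?_ hr0)
              nlinarith
          _ = _ := by rw [hru]; ring
    _ ≤ _ := by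
        rw [cs_add, cs_add, cs_sub _ _ (c.mixCls (c.kerU past) P h), cs_const_mul]
        have h1 := c.cs_gap_le past hp hc hz h
        have h2 := c.cs_one_le hp h
        have h3 := c.cs_kerU_le past hp hz.2.2.1 hz.2.2.2.1 h.isLt
        have h4 := c.one_sub_cs_kerD_le past hp hz.2.2.1 hz.2.2.2.1 h.isLt
        have := mul_le_mul_of_nonneg_left h2 hg.le
        linarith

/-- The exponential moment of the regret of one layer against the estimated losses. -/
theorem expec_exp_layer_le :
    c.expec p P (fun L => Real.exp (c.γ * (c.γ * ∑ ω, z (h, ω) * c.estL past P ℓ L (h, ω) ^ 2 -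
      ∑ ω, z (h, ω) * c.estL past P ℓ L (h, ω) + c.layerV p P ℓ h) -
      c.γ * (4 * c.γ * c.numC + 6 * c.β + 14 * c.kilF past p P))) ≤ 1 := by
  have hg := c.γ_pos
  have hz0 : ∀ i, 0 ≤ z i := fun i => (div_pos c.β_pos c.card_pos).le.trans (hz.1 i)
  have h1 := c.cs_div_le past hp hc hz h
  have h2 := c.layerV_sub_le past hp hc hℓ hz h
  have h3 := c.cs_sub_mean_le past hp hc hℓ hz h
  set V := c.layerV p P ℓ h
  set F := c.kilF past p P
  set μ := c.cs p h (fun y => c.mixCls (c.kerD past p) P h y *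
    (c.simZ z h y * ℓ h y.2.2.1 y.2.2.2 / (c.mixCls (c.kerU past) P h y + c.γ))) with hμ
  set G := c.cs p h (fun y => c.simZ z h y / (c.mixCls (c.kerU past) P h y + c.γ)) with hG
  set M : Cls S A → ℝ := fun y =>
    3 * (c.γ ^ 2 * (c.simZ z h y / (c.mixCls (c.kerU past) P h y + c.γ) ^ 2)) -
      c.γ * (c.simZ z h y * ℓ h y.2.2.1 y.2.2.2 / (c.mixCls (c.kerU past) P h y + c.γ)) with hM
  have hpt : ∀ L : List (Fin S × Fin A),
      Real.exp (c.γ * (c.γ * ∑ ω, z (h, ω) * c.estL past P ℓ L (h, ω) ^ 2 -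
        ∑ ω, z (h, ω) * c.estL past P ℓ L (h, ω))) ≤
      1 + pathProd (c.surv past) 0 (L.take h) * M (c.cls h L) := by
    intro L
    have hs := pathProd_le_one (c.surv_nonneg past) (c.surv_le_one past) 0 (L.take h)
    have hU := c.mixCls_nonneg (c.kerU_nonneg past) hz.2.2.1 h (c.cls h L)
    have hZ := c.simZ_mem hz0 (hz.2.1 h) (c.cls h L)
    have hl := hℓ h (c.cls h L).2.2.1 (c.cls h L).2.2.2 h.isLt
    have e1 : ∑ ω, z (h, ω) * c.estL past P ℓ L (h, ω) =
        pathProd (c.surv past) 0 (L.take h) * (c.simZ z h (c.cls h L) *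
          ℓ h (c.cls h L).2.2.1 (c.cls h L).2.2.2 /
            (c.mixCls (c.kerU past) P h (c.cls h L) + c.γ)) := by
      unfold estL simZ
      rw [sum_mul, sum_div, mul_sum]
      exact sum_congr rfl fun ω _ => by ring
    have e2 : ∑ ω, z (h, ω) * c.estL past P ℓ L (h, ω) ^ 2 ≤
        pathProd (c.surv past) 0 (L.take h) * (c.simZ z h (c.cls h L) /
            (c.mixCls (c.kerU past) P h (c.cls h L) + c.γ) ^ 2) := by
      unfold estL
      conv_rhs => rw [simZ, sum_div, mul_sum]
      refine sum_le_sum fun ω _ => ?_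
      have hsim0 := c.sim_nonneg h ω (c.cls h L)
      have hsim1 := c.sim_le_one h ω (c.cls h L)
      dsimp only
      generalize c.sim h ω (c.cls h L) = x at *
      generalize pathProd (c.surv past) 0 (L.take h) = κ at *
      generalize ℓ h (c.cls h L).2.2.1 (c.cls h L).2.2.2 = v at *
      generalize c.mixCls (c.kerU past) P h (c.cls h L) = u at *
      have hq : 0 ≤ z (h, ω) / (u + c.γ) ^ 2 := div_nonneg (hz0 _) (sq_nonneg _)
      have hk : κ ^ 2 * (x ^ 2 * v ^ 2) ≤ κ * (x * 1) := by
        have a1 : κ ^ 2 ≤ κ := by nlinarith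
        have a2 : x ^ 2 ≤ x := by nlinarith
        have a3 : v ^ 2 ≤ 1 := by nlinarith
        gcongr
        exact hs.1
      calc _ = z (h, ω) / (u + c.γ) ^ 2 * (κ ^ 2 * (x ^ 2 * v ^ 2)) := by
            rw [mul_pow, div_pow]; ring
        _ ≤ z (h, ω) / (u + c.γ) ^ 2 * (κ * (x * 1)) := mul_le_mul_of_nonneg_left hk hq
        _ = _ := by ring
    rw [e1, hM, mul_sub]
    dsimp only
    generalize c.simZ z h (c.cls h L) = x at *
    generalize pathProd (c.surv past) 0 (L.take h) = κ at *
    generalize ℓ h (c.cls h L).2.2.1 (c.cls h L).2.2.2 = v at *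
    generalize c.mixCls (c.kerU past) P h (c.cls h L) = u at *
    generalize ∑ ω, z (h, ω) * c.estL past P ℓ L (h, ω) ^ 2 = X at *
    have hug : 0 < u + c.γ := by linarith
    have hq : c.γ / (u + c.γ) ≤ 1 := by rw [div_le_one hug]; linarith
    have hq0 : 0 ≤ c.γ / (u + c.γ) := by positivity
    have hx0 := hZ.1
    have hx1 := hZ.2
    have hv0 := hl.1
    have hk0 := hs.1
    have ea : c.γ * (c.γ * (κ * (x / (u + c.γ) ^ 2))) = κ * x * (c.γ / (u + c.γ)) ^ 2 := by
      field_simp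
    have eb : c.γ * (κ * (x * v / (u + c.γ))) = κ * (x * v) * (c.γ / (u + c.γ)) := by
      field_simp
    have hfin := exp_sub_le (a := c.γ * (c.γ * X)) (a' := c.γ * (c.γ * (κ * (x / (u + c.γ) ^ 2))))
      (b := c.γ * (κ * (x * v / (u + c.γ)))) (by gcongr) (by positivity)
      (by
        rw [ea]
        have : (c.γ / (u + c.γ)) ^ 2 ≤ 1 := by nlinarith
        exact mul_le_one₀ (mul_le_one₀ hs.2 hx0 hx1) (sq_nonneg _) this)
      (by positivity)
      (by
        rw [ea, eb, mul_pow]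
        refine mul_le_mul_of_nonneg_right ?_ (sq_nonneg _)
        have a1 : κ ^ 2 ≤ κ := by nlinarith [hs.2]
        have a2 : x ^ 2 ≤ x := by nlinarith
        have a3 : v ^ 2 ≤ 1 := by nlinarith [hl.2]
        calc (κ * (x * v)) ^ 2 = κ ^ 2 * (x ^ 2 * v ^ 2) := by ring
          _ ≤ κ * (x * 1) := by gcongr
          _ = κ * x := by ring)
    refine hfin.trans_eq ?_
    ring
  have hE : c.expec p P (fun L =>
      Real.exp (c.γ * (c.γ * ∑ ω, z (h, ω) * c.estL past P ℓ L (h, ω) ^ 2 -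
        ∑ ω, z (h, ω) * c.estL past P ℓ L (h, ω)))) ≤ 1 + (3 * c.γ ^ 2 * G - c.γ * μ) := by
    refine (c.expec_mono hp hz.2.2.1 fun L _ => hpt L).trans ?_
    rw [expec_add, c.expec_const hp hz.2.2.2.1, c.expec_surv past hp h.isLt, hG, hμ,
      ← cs_const_mul, ← cs_const_mul, ← cs_sub]
    refine add_le_add le_rfl (c.cs_mono hp fun y _ => ?_)
    have hU := c.mixCls_nonneg (c.kerU_nonneg past) hz.2.2.1 h y
    have hZ := c.simZ_mem hz0 (hz.2.1 h) y
    have hDU := c.mixCls_kerD_le past hp hc hz.2.2.1 h.isLt y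
    rw [hM]
    dsimp only
    generalize c.mixCls (c.kerU past) P h y = u at *
    generalize c.mixCls (c.kerD past p) P h y = d at *
    generalize c.simZ z h y = x at *
    have hug : 0 < u + c.γ := by linarith
    have hd1 : d / (u + c.γ) ≤ 1 := by rw [div_le_one hug]; linarith
    have hx0 : 0 ≤ 3 * c.γ ^ 2 * (x / (u + c.γ)) :=
      mul_nonneg (by positivity) (div_nonneg hZ.1 hug.le)
    have := mul_le_mul_of_nonneg_left hd1 hx0
    have e : d * (3 * (c.γ ^ 2 * (x / (u + c.γ) ^ 2))) =
        3 * c.γ ^ 2 * (x / (u + c.γ)) * (d / (u + c.γ)) := by field_simp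
    rw [mul_sub, e]
    linarith [mul_left_comm c.γ d (x * ℓ h y.2.2.1 y.2.2.2 / (u + c.γ))]
  have hsplit : ∀ L : List (Fin S × Fin A),
      Real.exp (c.γ * (c.γ * ∑ ω, z (h, ω) * c.estL past P ℓ L (h, ω) ^ 2 -
        ∑ ω, z (h, ω) * c.estL past P ℓ L (h, ω) + V) -
        c.γ * (4 * c.γ * c.numC + 6 * c.β + 14 * F)) =
      Real.exp (c.γ * V - c.γ * (4 * c.γ * c.numC + 6 * c.β + 14 * F)) *
      Real.exp (c.γ * (c.γ * ∑ ω, z (h, ω) * c.estL past P ℓ L (h, ω) ^ 2 -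
        ∑ ω, z (h, ω) * c.estL past P ℓ L (h, ω))) := by
    intro L
    rw [← Real.exp_add]
    congr 1; ring
  simp only [hsplit]
  rw [expec_const_mul]
  have hG2 : 3 * c.γ ^ 2 * G ≤ 3 * c.γ * (c.β + 2 * F) + 3 * c.γ ^ 2 * c.numC := by
    have := mul_le_mul_of_nonneg_left h1 (show 0 ≤ 3 * c.γ ^ 2 by positivity)
    refine this.trans_eq ?_
    field_simp
  have hfin : c.γ * V - c.γ * (4 * c.γ * c.numC + 6 * c.β + 14 * F) +
      (3 * c.γ ^ 2 * G - c.γ * μ) ≤ 0 := by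
    have h4 : V - μ ≤ 2 * c.β + 6 * F + c.γ * c.numC := by linarith
    have h5 := mul_le_mul_of_nonneg_left h4 hg.le
    have hF : 0 ≤ F := c.kilF_nonneg past hp hz.2.2.1
    nlinarith [mul_nonneg hg.le hF, mul_nonneg hg.le c.β_pos.le]
  calc _ ≤ Real.exp (c.γ * V - c.γ * (4 * c.γ * c.numC + 6 * c.β + 14 * F)) *
        Real.exp (3 * c.γ ^ 2 * G - c.γ * μ) := by
        refine mul_le_mul_of_nonneg_left (hE.trans ?_) (Real.exp_pos _).le
        linarith [Real.add_one_le_exp (3 * c.γ ^ 2 * G - c.γ * μ)]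
    _ = Real.exp (c.γ * V - c.γ * (4 * c.γ * c.numC + 6 * c.β + 14 * F) +
        (3 * c.γ ^ 2 * G - c.γ * μ)) := (Real.exp_add _ _).symm
    _ ≤ 1 := Real.exp_le_one_iff.2 hfin

end feasible
end layer
end Cfg

namespace Cfg
variable {H : ℕ} (c : Cfg S A H)

theorem pathProd_congr {r r' : ℕ → Fin S → Fin A → ℝ} {j : ℕ} {l : List (Fin S × Fin A)}
    (h : ∀ i, j ≤ i → i < j + l.length → r i = r' i) : pathProd r j l = pathProd r' j l := by
  induction l generalizing j with
  | nil => rfl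
  | cons x l ih =>
    simp only [pathProd]
    rw [h j le_rfl (by simp), ih fun i h1 h2 => h i (by omega) (by simp; omega)]

theorem pathTo_congr {W W' : ℕ → Fin S → Fin A → Fin S → ℝ} {n j : ℕ}
    (h : ∀ i, j ≤ i → i < j + n → W i = W' i) (s x : Fin S) :
    pathTo W n j s x = pathTo W' n j s x := pathSum_congr_kernel h

theorem sum_pathTo {p : ℕ → Fin S → Fin A → Fin S → ℝ} (hp : ∀ j, IsKernel (p j))
    (f : ℕ → Fin S → Fin A) (n j : ℕ) (s : Fin S) : ∑ x, pathTo (polK p f) n j s x = 1 := by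
  have := pathSum_eq_sum_pathTo (polK p f) n j s fun _ => 1
  simp only [mul_one] at this
  rw [← this, pathSum_const n j s 1 (sum_polK_eq_one hp f)]

/-- The point mass at a policy. -/
noncomputable def dirac (π : c.Det) : c.Det → ℝ := fun π' => if π' = π then 1 else 0

theorem dirac_nonneg (π π' : c.Det) : 0 ≤ c.dirac π π' := by
  unfold dirac; split_ifs <;> norm_num

theorem sum_dirac (π : c.Det) : ∑ π', c.dirac π π' = 1 := by simp [dirac]

theorem mixCls_dirac (R : ℕ → Fin S → Fin A → Fin S → ℝ) (π : c.Det) (h : ℕ) (x : Cls S A) :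
    c.mixCls R (c.dirac π) h x = clsProb c.s0 (c.bb h) (c.mm h) (c.nn h) R (c.pol π) x := by
  simp [mixCls, dirac]

theorem clsProb_congr {R R' : ℕ → Fin S → Fin A → Fin S → ℝ} (hR : ∀ j, c.off j → R j = R' j)
    {h : ℕ} (hh : h < H) (f : ℕ → Fin S → Fin A) (x : Cls S A) :
    clsProb c.s0 (c.bb h) (c.mm h) (c.nn h) R f x =
      clsProb c.s0 (c.bb h) (c.mm h) (c.nn h) R' f x := by
  have hK : ∀ j, c.off j → polK R f j = polK R' f j := by
    intro j hj
    unfold polK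
    rw [hR j hj]
  unfold clsProb
  rw [pathTo_congr (W' := polK R' f) fun i _ h2 => hK i (c.off_of_lt hh (by omega)),
    pathTo_congr (W' := polK R' f) fun i _ h2 => hK i (c.off_of_lt hh (by omega))]

/-- The part of a policy on the block. -/
def blkOf (f : ℕ → Fin S → Fin A) : Fin (c.lam + 1) → Fin S → Fin A := fun i => f (c.h1 + i)

/-- The law of the state-action pair at layer `h` given the state after the block. -/
noncomputable def post (pb : ℕ → Fin S → Fin A → Fin S → ℝ) (f : ℕ → Fin S → Fin A) (h : ℕ)
    (x : Fin S) (y : Fin S × Fin A) : ℝ :=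
  pathTo (polK pb f) (c.nn h) (c.bb h + c.mm h) x y.1 *
    detW f (c.bb h + c.mm h + c.nn h) y.1 y.2

/-- The law on sub-policies induced by a policy. -/
noncomputable def zpol (pb : ℕ → Fin S → Fin A → Fin S → ℝ) (f : ℕ → Fin S → Fin A)
    (i : c.Idx) : ℝ :=
  pathTo (polK pb f) (c.bb i.1) 0 c.s0 i.2.1 * ((if i.2.2.1 = c.blkOf f then 1 else 0) *
    ∏ x, c.post pb f i.1 x (i.2.2.2 x))

section
variable {pb : ℕ → Fin S → Fin A → Fin S → ℝ} (f : ℕ → Fin S → Fin A)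

theorem sum_post (hpb : ∀ j, IsKernel (pb j)) (h : ℕ) (x : Fin S) :
    ∑ y, c.post pb f h x y = 1 := by
  rw [Fintype.sum_prod_type]
  simp only [post, ← mul_sum, sum_detW, mul_one]
  exact sum_pathTo hpb f _ _ _

theorem zpol_nonneg (hpb : ∀ j, IsKernel (pb j)) (i : c.Idx) : 0 ≤ c.zpol pb f i := by
  have h0 := polK_nonneg (fun j => (hpb j).1) f
  unfold zpol
  refine mul_nonneg (pathTo_nonneg h0 _ _ _ _) (mul_nonneg (by split_ifs <;> norm_num) ?_)
  exact prod_nonneg fun x _ => mul_nonneg (pathTo_nonneg h0 _ _ _ _) (detW_nonneg _ _ _ _)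

theorem sum_zpol_mul (h : Fin H) (u : Fin S → ℝ) (v : (Fin (c.lam + 1) → Fin S → Fin A) → ℝ)
    (w : (Fin S → Fin S × Fin A) → ℝ) :
    ∑ ω, c.zpol pb f (h, ω) * (u ω.1 * v ω.2.1 * w ω.2.2) =
      (∑ y, pathTo (polK pb f) (c.bb h) 0 c.s0 y * u y) * v (c.blkOf f) *
        ∑ g : Fin S → Fin S × Fin A, (∏ x, c.post pb f h x (g x)) * w g := by
  rw [Fintype.sum_prod_type, sum_mul, sum_mul]
  refine sum_congr rfl fun y _ => ?_
  rw [Fintype.sum_prod_type, sum_eq_single (c.blkOf f) _ (by simp)]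
  · rw [mul_sum]
    refine sum_congr rfl fun g _ => ?_
    simp only [zpol, if_true]
    ring
  · intro φ _ hφ
    refine sum_eq_zero fun g _ => ?_
    simp [zpol, hφ]

theorem sum_prod_post (hpb : ∀ j, IsKernel (pb j)) (h : ℕ) :
    ∑ g : Fin S → Fin S × Fin A, ∏ x, c.post pb f h x (g x) = 1 := by
  have := sum_prod_pi (c.post pb f h) (c.sum_post f hpb h) c.s0
  have h2 : ∑ v, ∑ g : Fin S → Fin S × Fin A, (∏ x, c.post pb f h x (g x)) *
      (if g c.s0 = v then 1 else 0) = ∑ v, c.post pb f h c.s0 v := sum_congr rfl fun v _ => this v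
  rw [c.sum_post f hpb, sum_comm] at h2
  rw [← h2]
  exact sum_congr rfl fun g _ => by simp

theorem sum_zpol (hpb : ∀ j, IsKernel (pb j)) (h : Fin H) : ∑ ω, c.zpol pb f (h, ω) = 1 := by
  have := c.sum_zpol_mul (pb := pb) f h (fun _ => 1) (fun _ => 1) (fun _ => 1)
  simp only [mul_one] at this
  rw [this, sum_pathTo hpb, c.sum_prod_post f hpb, one_mul]

theorem simZ_zpol (hpb : ∀ j, IsKernel (pb j)) (h : Fin H) {x : Cls S A}
    (hx : x.1.length = c.mm h) : c.simZ (c.zpol pb f) h x =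
      clsProb c.s0 (c.bb h) (c.mm h) (c.nn h) pb f x := by
  have := c.sum_zpol_mul (pb := pb) f h (fun y => if headState x.1 x.2.1 = y then 1 else 0)
    (fun φ => pathProd (detW (c.blkPol φ)) (c.bb h) x.1)
    (fun g => if g x.2.1 = x.2.2 then 1 else 0)
  unfold simZ sim
  rw [this, sum_prod_pi _ (c.sum_post f hpb h)]
  unfold clsProb post
  congr 1
  simp only [mul_ite, mul_one, mul_zero, sum_ite_eq, mem_univ, if_true]
  congr 1
  refine pathProd_congr fun i h1 h2 => ?_
  have : c.blkPol (c.blkOf f) i = f i := by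
    funext s
    unfold blkPol blkOf
    unfold bb at h1 h2
    unfold mm at hx
    rw [hx] at h2
    have e : ((Fin.ofNat (c.lam + 1) (i - c.h1) : Fin (c.lam + 1)) : ℕ) = i - c.h1 :=
      Nat.mod_eq_of_lt (by omega)
    rw [e, show c.h1 + (i - c.h1) = i by omega]
  unfold detW
  rw [this]

/-- The comparator of mirror descent. -/
noncomputable def comp (pb : ℕ → Fin S → Fin A → Fin S → ℝ) (f : ℕ → Fin S → Fin A)
    (i : c.Idx) : ℝ := (1 - c.β) * c.zpol pb f i + c.β / c.card

theorem le_comp (hpb : ∀ j, IsKernel (pb j)) (i : c.Idx) : c.β / c.card ≤ c.comp pb f i :=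
  le_add_of_nonneg_left (mul_nonneg (sub_nonneg.2 c.β_le) (c.zpol_nonneg f hpb i))

theorem sum_comp (hpb : ∀ j, IsKernel (pb j)) (h : Fin H) : ∑ ω, c.comp pb f (h, ω) = 1 := by
  unfold comp
  rw [sum_add_distrib, ← mul_sum, c.sum_zpol f hpb, sum_const, card_univ, nsmul_eq_mul]
  have := c.card_pos
  have e : (Fintype.card (SubPol S A c.lam) : ℝ) = c.card := rfl
  rw [e]
  field_simp
  ring

theorem comp_mem_feas {past : List (BanditObs S A H)} (hpb : ∀ j, IsKernel (pb j))
    (hc : c.conf past pb) (π : c.Det) : (c.comp pb (c.pol π), c.dirac π) ∈ c.feas past := by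
  refine ⟨c.le_comp _ hpb, c.sum_comp _ hpb, c.dirac_nonneg π, c.sum_dirac π, fun h y hy => ?_⟩
  dsimp only
  have e : c.simZ (c.comp pb (c.pol π)) h y = (1 - c.β) * c.simZ (c.zpol pb (c.pol π)) h y +
      ∑ ω, c.β / c.card * c.sim h ω y := by
    unfold simZ comp
    rw [mul_sum, ← sum_add_distrib]
    exact sum_congr rfl fun ω _ => by ring
  rw [mixCls_dirac, e, c.simZ_zpol _ hpb h hy]
  have h1 : clsProb c.s0 (c.bb h) (c.mm h) (c.nn h) (c.kerL past) (c.pol π) y ≤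
      clsProb c.s0 (c.bb h) (c.mm h) (c.nn h) pb (c.pol π) y :=
    clsProb_mono _ _ _ _ (c.kerL_nonneg past) (fun j => (hpb j).1)
      (fun j hj s a x => (hc j (c.off_of_lt h.isLt hj) s a x).1) _ _
  have h2 := mul_le_mul_of_nonneg_left h1 (sub_nonneg.2 c.β_le)
  have h3 : 0 ≤ ∑ ω, c.β / c.card * c.sim h ω y :=
    sum_nonneg fun ω _ => mul_nonneg (div_nonneg c.β_pos.le c.card_pos.le) (c.sim_nonneg _ _ _)
  linarith

theorem sum_comp_lossW_le {p : ℕ → Fin S → Fin A → Fin S → ℝ} (hpb : ∀ j, IsKernel (pb j))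
    (hp : ∀ j, IsKernel (p j)) (hpp : ∀ j, c.off j → p j = pb j)
    {ℓ : ℕ → Fin S → Fin A → ℝ} (hℓ : IsLoss H ℓ) (π : c.Det) (h : Fin H) :
    ∑ ω, c.comp pb (c.pol π) (h, ω) * c.lossW p ℓ (h, ω) ≤
      layerVal p (detW (c.pol π)) ℓ c.s0 h + c.β := by
  have e1 : ∑ ω, c.zpol pb (c.pol π) (h, ω) * c.lossW p ℓ (h, ω) =
      layerVal p (detW (c.pol π)) ℓ c.s0 h := by
    have h1 : layerVal p (detW (c.pol π)) ℓ c.s0 h = c.layerV p (c.dirac π) ℓ h := by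
      simp [layerV, dirac]
    rw [h1, c.layerV_eq h.isLt]
    have h2 := c.cs_simZ_mul (z := c.zpol pb (c.pol π)) (p := p) h
      fun y => ℓ h y.2.2.1 y.2.2.2
    unfold lossW
    rw [← h2]
    unfold cs
    refine clsSum_congr fun y hy => ?_
    rw [c.simZ_zpol _ hpb h hy, mixCls_dirac, c.clsProb_congr hpp h.isLt]
  have e2 : ∑ ω, c.comp pb (c.pol π) (h, ω) * c.lossW p ℓ (h, ω) =
      (1 - c.β) * ∑ ω, c.zpol pb (c.pol π) (h, ω) * c.lossW p ℓ (h, ω) +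
        c.β / c.card * ∑ ω, c.lossW p ℓ (h, ω) := by
    unfold comp
    rw [mul_sum, mul_sum, ← sum_add_distrib]
    exact sum_congr rfl fun ω _ => by ring
  have h3 : ∑ ω, c.lossW p ℓ (h, ω) ≤ c.card := by
    refine (sum_le_sum fun ω _ => c.lossW_le_one hp hℓ (h, ω)).trans_eq ?_
    simp [card]
  have h4 : 0 ≤ ∑ ω, c.zpol pb (c.pol π) (h, ω) * c.lossW p ℓ (h, ω) :=
    sum_nonneg fun ω _ => mul_nonneg (c.zpol_nonneg _ hpb _) (c.lossW_nonneg hp hℓ _)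
  have h5 : c.β / c.card * ∑ ω, c.lossW p ℓ (h, ω) ≤ c.β / c.card * c.card :=
    mul_le_mul_of_nonneg_left h3 (div_nonneg c.β_pos.le c.card_pos.le)
  rw [div_mul_cancel₀ _ c.card_pos.ne'] at h5
  rw [e2, ← e1]
  nlinarith [c.β_pos]

end

/-- The confidence sets contain the kernel before every observation of the history. -/
def confAll (pb : ℕ → Fin S → Fin A → Fin S → ℝ) : List (BanditObs S A H) → Prop
  | [] => True
  | _ :: past => c.conf past pb ∧ confAll pb past

/-- The regret of mirror descent in one episode, for the estimated losses. -/
noncomputable def gap (y : c.Idx → ℝ) (past : List (BanditObs S A H)) (o : BanditObs S A H) : ℝ :=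
  ∑ i, c.zst past i * c.est past (c.Pst past) o i -
    c.γ * ∑ i, c.zst past i * c.est past (c.Pst past) o i ^ 2 -
      ∑ i, y i * c.est past (c.Pst past) o i

theorem sum_eq_card {y : c.Idx → ℝ} (hy : ∀ h, ∑ ω, y (h, ω) = 1) : ∑ i, y i = H := by
  rw [Fintype.sum_prod_type]
  simp [hy]

theorem est_nonneg (past : List (BanditObs S A H)) {P : c.Det → ℝ} (hP : ∀ π, 0 ≤ P π)
    {o : BanditObs S A H} (ho : ∀ h, 0 ≤ o.2 h) (i : c.Idx) : 0 ≤ c.est past P o i := by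
  unfold est
  refine div_nonneg (mul_nonneg (mul_nonneg ?_ (c.sim_nonneg _ _ _)) (ho _))
    (add_nonneg (c.mixCls_nonneg (c.kerU_nonneg past) hP _ _) c.γ_pos.le)
  exact (pathProd_le_one (c.surv_nonneg past) (c.surv_le_one past) _ _).1

theorem relEnt_wst_le {pb : ℕ → Fin S → Fin A → Fin S → ℝ} (hpb : ∀ j, IsKernel (pb j))
    (π : c.Det) (past : List (BanditObs S A H)) (hc : c.confAll pb past)
    (ho : ∀ o ∈ past, ∀ h, 0 ≤ o.2 h) :
    relEnt (c.comp pb (c.pol π)) (c.wst past) + ∑ i, c.wst past i +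
      c.γ * histSum (c.gap (c.comp pb (c.pol π))) past ≤ H * Real.log c.card + H := by
  have hy : ∀ i, 0 < c.comp pb (c.pol π) i :=
    fun i => (div_pos c.β_pos c.card_pos).trans_le (c.le_comp _ hpb i)
  have hysum := c.sum_eq_card (c.sum_comp (c.pol π) hpb)
  have hcard := c.card_pos
  induction past with
  | nil =>
    have h1 : ∑ i, c.wst [] i = H := c.sum_eq_card fun h => by
      rw [wst, sum_const, card_univ, nsmul_eq_mul]
      exact mul_one_div_cancel hcard.ne'
    have h2 : relEnt (c.comp pb (c.pol π)) (c.wst []) ≤ H * Real.log c.card := by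
      unfold relEnt
      rw [← hysum, sum_mul]
      refine sum_le_sum fun i _ => mul_le_mul_of_nonneg_left ?_ (hy i).le
      rw [wst, div_div_eq_mul_div, div_one]
      have h3 : c.comp pb (c.pol π) i ≤ 1 := by
        rw [← c.sum_comp (c.pol π) hpb i.1]
        exact single_le_sum (f := fun ω => c.comp pb (c.pol π) (i.1, ω))
          (fun ω _ => (hy _).le) (mem_univ i.2)
      exact Real.log_le_log (mul_pos (hy i) hcard) (mul_le_of_le_one_left hcard.le h3)
    rw [h1, histSum]
    linarith
  | cons o past ih =>
    have ih := ih hc.2 fun o' h' => ho o' (List.mem_cons_of_mem _ h')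
    have hfeas := c.comp_mem_feas hpb hc.1 π
    obtain ⟨hz, hmin⟩ := c.sel_spec past (c.wst_pos past) ⟨_, hfeas⟩
    have hopt := relEnt_optimality hy (c.zst_pos past) (c.wst_pos past)
      (hysum.trans (c.sum_eq_card hz.2.1).symm) fun t h0 h1 =>
        hmin _ (c.feas_convex past hz hfeas h0.le h1)
    have hest : ∀ i, 0 ≤ c.est past (c.Pst past) o i :=
      fun i => c.est_nonneg past (c.Pst_simplex past).1 (ho o List.mem_cons_self) i
    have hstep := relEnt_step (ℓ := fun i => c.γ * c.est past (c.Pst past) o i) hy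
      (c.zst_pos past) (c.wst_pos past) (fun i => mul_nonneg c.γ_pos.le (hest i)) hopt
    have e : c.wst (o :: past) = fun i => c.zst past i *
        Real.exp (-(c.γ * c.est past (c.Pst past) o i)) := rfl
    rw [e, histSum, gap]
    have e1 : ∑ i, c.comp pb (c.pol π) i * (c.γ * c.est past (c.Pst past) o i) =
        c.γ * ∑ i, c.comp pb (c.pol π) i * c.est past (c.Pst past) o i := by
      rw [mul_sum]; exact sum_congr rfl fun i _ => by ring
    have e2 : ∑ i, c.zst past i * (c.γ * c.est past (c.Pst past) o i) =
        c.γ * ∑ i, c.zst past i * c.est past (c.Pst past) o i := by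
      rw [mul_sum]; exact sum_congr rfl fun i _ => by ring
    have e3 : ∑ i, c.zst past i * (c.γ * c.est past (c.Pst past) o i) ^ 2 =
        c.γ * (c.γ * ∑ i, c.zst past i * c.est past (c.Pst past) o i ^ 2) := by
      rw [mul_sum, mul_sum]; exact sum_congr rfl fun i _ => by ring
    rw [e1, e2, e3] at hstep
    linarith

theorem histSum_gap_le {pb : ℕ → Fin S → Fin A → Fin S → ℝ} (hpb : ∀ j, IsKernel (pb j))
    (π : c.Det) (past : List (BanditObs S A H)) (hc : c.confAll pb past)
    (ho : ∀ o ∈ past, ∀ h, 0 ≤ o.2 h) :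
    c.γ * histSum (c.gap (c.comp pb (c.pol π))) past ≤ H * Real.log c.card := by
  have h1 := c.relEnt_wst_le hpb π past hc ho
  have h2 := sum_sub_sum_le_relEnt
    (fun i => (div_pos c.β_pos c.card_pos).trans_le (c.le_comp (c.pol π) hpb i)) (c.wst_pos past)
  rw [c.sum_eq_card (c.sum_comp (c.pol π) hpb)] at h2
  linarith
end Cfg

namespace Cfg
variable {H : ℕ} (c : Cfg S A H)

theorem pathAdd_ofFn (d : ℕ → Fin S → Fin A → ℝ) (n j : ℕ) (t : Fin n → Fin S × Fin A) :
    pathAdd d j (List.ofFn t) = ∑ i : Fin n, d (j + i) (t i).1 (t i).2 := by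
  induction n generalizing j with
  | zero => simp [pathAdd]
  | succ n ih =>
    rw [List.ofFn_succ, pathAdd, ih, Fin.sum_univ_succ]
    simp only [Fin.val_zero, add_zero, Fin.val_succ, add_assoc, add_comm 1]

theorem rad_le {n : ℝ} (hn : 0 ≤ n) : c.rad n ≤ 4 * √(S * c.L0) * (√(n + 1) - √n) := by
  have hS := c.SL0_ge
  generalize hw : (S : ℝ) * c.L0 = w at *
  have e : √(n + 1) - √n = 1 / (√(n + 1) + √n) := by
    have h0 : 0 < √(n + 1) + √n := by positivity
    rw [eq_div_iff h0.ne']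
    have h1 := Real.sq_sqrt hn
    have h2 := Real.sq_sqrt (show 0 ≤ n + 1 by linarith)
    nlinarith
  have h3 : 1 / (2 * √(n + 1)) ≤ √(n + 1) - √n := by
    rw [e]
    apply one_div_le_one_div_of_le (by positivity)
    have := Real.sqrt_le_sqrt (show n ≤ n + 1 by linarith)
    linarith
  refine le_trans ?_ (mul_le_mul_of_nonneg_left h3 (by positivity))
  rw [mul_one_div, le_div_iff₀ (by positivity)]
  unfold rad
  rw [hw]
  split_ifs with h
  · have hn0 : 0 < n := lt_of_lt_of_le one_pos (hS.trans (le_of_lt h))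
    rw [Real.sqrt_div (by linarith), div_mul_eq_mul_div, div_le_iff₀ (by positivity)]
    have : √(n + 1) ≤ 2 * √n := by
      rw [show 2 * √n = √(2 ^ 2 * n) by rw [Real.sqrt_mul (by norm_num)]; simp]
      apply Real.sqrt_le_sqrt
      linarith [hS.trans (le_of_lt h)]
    nlinarith [Real.sqrt_nonneg w]
  · have : √(n + 1) ≤ 2 * √w := by
      have e2 : √(2 ^ 2 * w) = 2 * √w := by
        rw [Real.sqrt_mul (by norm_num), Real.sqrt_sq (by norm_num)]
      rw [← e2]
      apply Real.sqrt_le_sqrt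
      linarith
    linarith

/-- The realized killing rate along the trajectory of an episode. -/
noncomputable def kilR (past : List (BanditObs S A H)) (o : BanditObs S A H) : ℝ :=
  pathAdd (c.kil past) 0 (List.ofFn o.1)

theorem cntN_cons (o : BanditObs S A H) (past : List (BanditObs S A H)) (j : Fin H) (s : Fin S)
    (a : Fin A) : c.cntN (o :: past) j s a = c.cntN past j s a +
      (if o.1 j = (s, a) then 1 else 0) := by
  rw [cntN]
  congr 2
  simp

theorem kilR_le (past : List (BanditObs S A H)) (o : BanditObs S A H) : c.kilR past o ≤ H := by
  unfold kilR
  rw [pathAdd_ofFn]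
  refine (sum_le_sum fun j _ => c.kil_le_one past _ _ _).trans ?_
  simp

theorem kilR_nonneg (past : List (BanditObs S A H)) (o : BanditObs S A H) : 0 ≤ c.kilR past o :=
  pathAdd_nonneg (c.kil_nonneg past) _ _

theorem histSum_kilR_le_sqrt (past : List (BanditObs S A H)) :
    histSum c.kilR past ≤ 4 * √(S * c.L0) * ∑ j : Fin H, ∑ y : Fin S × Fin A,
      √(c.cntN past j y.1 y.2) := by
  induction past with
  | nil => simp [histSum, cntN]
  | cons o past ih =>
    have h1 : c.kilR past o ≤ 4 * √(S * c.L0) * ∑ j : Fin H, ∑ y : Fin S × Fin A,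
        (√(c.cntN (o :: past) j y.1 y.2) - √(c.cntN past j y.1 y.2)) := by
      unfold kilR
      rw [pathAdd_ofFn, mul_sum]
      refine sum_le_sum fun j _ => ?_
      have h2 : ∀ y : Fin S × Fin A,
          0 ≤ √(c.cntN (o :: past) j y.1 y.2) - √(c.cntN past j y.1 y.2) := by
        intro y
        rw [cntN_cons]
        refine sub_nonneg.2 (Real.sqrt_le_sqrt (le_add_of_nonneg_right ?_))
        split_ifs <;> norm_num
      have h3 := single_le_sum (fun y _ => h2 y) (mem_univ (o.1 j))
      refine le_trans ?_ (mul_le_mul_of_nonneg_left h3 (by positivity))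
      rw [cntN_cons, if_pos rfl, zero_add]
      refine le_trans ?_ (c.rad_le (c.cntN_nonneg past _ _ _))
      unfold kil thet
      split_ifs
      · exact le_rfl
      · exact c.rad_nonneg _
    rw [histSum]
    simp only [sum_sub_distrib, mul_sub] at h1
    linarith

theorem sum_cntN (past : List (BanditObs S A H)) (j : Fin H) :
    ∑ y : Fin S × Fin A, c.cntN past j y.1 y.2 = past.length := by
  induction past with
  | nil => simp [cntN]
  | cons o past ih =>
    simp only [cntN_cons, sum_add_distrib, ih, List.length_cons]
    simp

theorem histSum_kilR_le (past : List (BanditObs S A H)) :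
    histSum c.kilR past ≤ 4 * √(S * c.L0) * (H * √(S * A * past.length)) := by
  refine (c.histSum_kilR_le_sqrt past).trans (mul_le_mul_of_nonneg_left ?_ (by positivity))
  refine (sum_le_sum (g := fun _ => √(S * A * past.length)) fun j _ => ?_).trans_eq (by simp)
  refine Real.le_sqrt_of_sq_le ?_
  refine (sq_sum_le_card_mul_sum_sq).trans_eq ?_
  simp only [Real.sq_sqrt (c.cntN_nonneg past _ _ _), c.sum_cntN, card_univ, Fintype.card_prod,
    Fintype.card_fin]
  push_cast
  ring

end Cfg

section hist
variable {T : Type*}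

theorem prod_eq_histProd (Q : List T → T → ℝ) {K : ℕ} (ts : Fin K → T) :
    ∏ k : Fin K, Q ((List.ofFn fun j : Fin (k : ℕ) =>
      ts ⟨(j : ℕ), j.2.trans k.2⟩).reverse) (ts k) = histProd Q (List.ofFn ts).reverse := by
  induction K with
  | zero => simp [histProd]
  | succ K ih =>
    rw [Fin.prod_univ_castSucc, List.ofFn_succ_last, List.reverse_append, List.reverse_singleton,
      List.singleton_append, histProd, ← ih]
    rfl

theorem sum_eq_histSum (D : List T → T → ℝ) {K : ℕ} (ts : Fin K → T) :
    ∑ k : Fin K, D ((List.ofFn fun j : Fin (k : ℕ) =>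
      ts ⟨(j : ℕ), j.2.trans k.2⟩).reverse) (ts k) = histSum D (List.ofFn ts).reverse := by
  induction K with
  | zero => simp [histSum]
  | succ K ih =>
    rw [Fin.sum_univ_castSucc, List.ofFn_succ_last, List.reverse_append, List.reverse_singleton,
      List.singleton_append, histSum, ← ih]
    rfl

theorem sum_reverse_ofFn [Fintype T] (n : ℕ) (G : List T → ℝ) :
    ∑ t : Fin n → T, G (List.ofFn t).reverse = ∑ t : Fin n → T, G (List.ofFn t) := by
  rw [← (Equiv.arrowCongr (Fin.revPerm (n := n)) (Equiv.refl T)).sum_comp]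
  refine sum_congr rfl fun t _ => ?_
  congr 1
  refine List.ext_getElem (by simp) fun i h1 h2 => ?_
  simp only [List.length_reverse, List.length_ofFn] at h1
  simp only [List.getElem_reverse, List.getElem_ofFn, List.length_ofFn, Equiv.arrowCongr_apply,
    Function.comp, Equiv.refl_apply, Fin.revPerm_symm, Fin.revPerm_apply]
  congr 1
  ext
  simp only [Fin.val_rev]
  omega

end hist

section observations
variable {H : ℕ} (ℓ : ℕ → ℕ → Fin S → Fin A → ℝ)

/-- The observations along a history of trajectories, most recent first. -/
noncomputable def obsHist : List (Fin H → Fin S × Fin A) → List (BanditObs S A H)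
  | [] => []
  | t :: past => banditObs H ℓ past.length t :: obsHist past

theorem length_obsHist (l : List (Fin H → Fin S × Fin A)) : (obsHist ℓ l).length = l.length := by
  induction l with
  | nil => rfl
  | cons t l ih => simp [obsHist, ih]

theorem obsHist_reverse_ofFn {n : ℕ} (u : Fin n → Fin H → Fin S × Fin A) :
    obsHist ℓ (List.ofFn u).reverse =
      (List.ofFn fun j : Fin n => banditObs H ℓ j (u j)).reverse := by
  induction n with
  | zero => rfl
  | succ n ih =>
    rw [List.ofFn_succ_last, List.ofFn_succ_last, List.reverse_append, List.reverse_append,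
      List.reverse_singleton, List.reverse_singleton, List.singleton_append, List.singleton_append,
      obsHist, ih]
    simp

theorem histSum_obsHist (D : List (BanditObs S A H) → BanditObs S A H → ℝ)
    (l : List (Fin H → Fin S × Fin A)) : histSum D (obsHist ℓ l) =
      histSum (fun past t => D (obsHist ℓ past) (banditObs H ℓ past.length t)) l := by
  induction l with
  | nil => rfl
  | cons t l ih => rw [obsHist, histSum, histSum, ih]

theorem obsHist_nonneg (hℓ : ∀ k, IsLoss H (ℓ k)) (l : List (Fin H → Fin S × Fin A)) :
    ∀ o ∈ obsHist ℓ l, ∀ h, 0 ≤ o.2 h := by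
  induction l with
  | nil => simp [obsHist]
  | cons t l ih =>
    intro o ho h
    rcases List.mem_cons.1 ho with rfl | h'
    · exact (hℓ _ _ _ _ h.isLt).1
    · exact ih o h' h

end observations

namespace Cfg
variable {H : ℕ} (c : Cfg S A H) (p : ℕ → ℕ → Fin S → Fin A → Fin S → ℝ)
  (ℓ : ℕ → ℕ → Fin S → Fin A → ℝ)

/-- The mixture of policies played after a history of trajectories. -/
noncomputable def PH (past : List (Fin H → Fin S × Fin A)) : c.Det → ℝ := c.Pst (obsHist ℓ past)

/-- The conditional law of the next trajectory. -/
noncomputable def QH (past : List (Fin H → Fin S × Fin A)) (t : Fin H → Fin S × Fin A) : ℝ :=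
  trajDist H (p past.length) (mixStrat c.pol c.a0 (c.PH ℓ past)) c.s0 t

theorem played_alg {K : ℕ} (i : ℕ) (ts : Fin K → Fin H → Fin S × Fin A) (k : Fin K) :
    played c.alg i (banditObs H ℓ) ts k = mixStrat c.pol c.a0
      (c.PH ℓ (List.ofFn fun j : Fin (k : ℕ) => ts ⟨(j : ℕ), j.2.trans k.2⟩).reverse) := by
  unfold played PH
  rw [obsHist_reverse_ofFn]
  rfl

theorem seqProb_alg {K : ℕ} (i : ℕ) (ts : Fin K → Fin H → Fin S × Fin A) :
    seqProb c.alg i p (banditObs H ℓ) c.s0 ts = histProd (c.QH p ℓ) (List.ofFn ts).reverse := by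
  rw [← prod_eq_histProd]
  unfold seqProb QH
  refine prod_congr rfl fun k _ => ?_
  rw [played_alg, List.length_reverse, List.length_ofFn]

/-- The value of the strategy played after a history. -/
noncomputable def valH (past : List (Fin H → Fin S × Fin A)) : ℝ :=
  stratValue H (p past.length) (mixStrat c.pol c.a0 (c.PH ℓ past)) (ℓ past.length) c.s0

theorem playedValue_alg {K : ℕ} (i : ℕ) (ts : Fin K → Fin H → Fin S × Fin A) :
    playedValue H K c.alg i p ℓ (banditObs H ℓ) c.s0 ts =
      histSum (fun past _ => c.valH p ℓ past) (List.ofFn ts).reverse := by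
  rw [← sum_eq_histSum]
  unfold playedValue valH
  refine sum_congr rfl fun k _ => ?_
  rw [played_alg, List.length_reverse, List.length_ofFn]

variable {p ℓ}

theorem sum_QH (hp : ∀ k j, IsKernel (p k j)) (past : List (Fin H → Fin S × Fin A))
    (F : List (Fin S × Fin A) → ℝ) :
    ∑ t, c.QH p ℓ past t * F (List.ofFn t) = c.expec (p past.length) (c.PH ℓ past) F :=
  sum_trajDist_mixStrat c.pol (hp _) c.a0 (c.Pst_simplex _).1 (c.Pst_simplex _).2 H c.s0 F

theorem sum_QH_one (hp : ∀ k j, IsKernel (p k j)) (past : List (Fin H → Fin S × Fin A)) :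
    ∑ t, c.QH p ℓ past t = 1 := by
  have := c.sum_QH (ℓ := ℓ) hp past fun _ => 1
  simp only [mul_one] at this
  rw [this]
  exact c.expec_const (hp _) (c.Pst_simplex _).2 1

theorem transW_nonneg {p : ℕ → Fin S → Fin A → Fin S → ℝ} (hp : ∀ j s a x, 0 ≤ p j s a x)
    (j : ℕ) (s : Fin S) (l : List (Fin S × Fin A)) : 0 ≤ transW p j s l := by
  induction l generalizing j s with
  | nil => exact zero_le_one
  | cons x l ih =>
    refine mul_nonneg (by split_ifs <;> norm_num) (sum_nonneg fun y _ => mul_nonneg (hp _ _ _ _) ?_)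
    exact ih _ _

theorem QH_nonneg (hp : ∀ k j, IsKernel (p k j)) (past : List (Fin H → Fin S × Fin A))
    (t : Fin H → Fin S × Fin A) : 0 ≤ c.QH p ℓ past t := by
  unfold QH PH
  rw [trajDist_mixStrat c.pol (hp _) c.a0 (c.Pst_simplex _).1 (c.Pst_simplex _).2]
  exact sum_nonneg fun i _ => mul_nonneg ((c.Pst_simplex _).1 i)
    (mul_nonneg (pathProd_detW_nonneg _ _ _) (transW_nonneg (fun j => (hp _ j).1) _ _ _))

open scoped Classical in
theorem le_eventProb (hp : ∀ k j, IsKernel (p k j)) (K : ℕ)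
    {E : ℕ → (Fin K → Fin H → Fin S × Fin A) → Prop}
    {B : List (Fin H → Fin S × Fin A) → Prop}
    (hE : ∀ ts, ¬ B (List.ofFn ts).reverse → E 0 ts) :
    1 - ∑ t : Fin K → Fin H → Fin S × Fin A,
        histProd (c.QH p ℓ) (List.ofFn t) * (if B (List.ofFn t) then 1 else 0) ≤
      eventProb H K c.alg p (banditObs H ℓ) c.s0 E := by
  unfold eventProb
  rw [tsum_eq_single 0 (fun i hi => by simp [alg, hi])]
  have h1 := sum_histProd (Q := c.QH p ℓ) (c.sum_QH_one hp) K
  have h2 : 1 - ∑ t : Fin K → Fin H → Fin S × Fin A,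
      histProd (c.QH p ℓ) (List.ofFn t) * (if B (List.ofFn t) then 1 else 0) =
      ∑ t : Fin K → Fin H → Fin S × Fin A, (histProd (c.QH p ℓ) (List.ofFn t) -
        histProd (c.QH p ℓ) (List.ofFn t) * (if B (List.ofFn t) then 1 else 0)) := by
    rw [sum_sub_distrib, h1]
  rw [h2, ← sum_reverse_ofFn K fun l => histProd (c.QH p ℓ) l -
    histProd (c.QH p ℓ) l * (if B l then 1 else 0)]
  have e : c.alg.w 0 = 1 := by simp [alg]
  rw [e, one_mul]
  refine sum_le_sum fun ts _ => ?_
  rw [seqProb_alg]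
  have h0 := histProd_nonneg (c.QH_nonneg (ℓ := ℓ) hp) (List.ofFn ts).reverse
  by_cases hB : B (List.ofFn ts).reverse
  · rw [if_pos hB]
    split_ifs <;> simp [h0]
  · rw [if_neg hB, if_pos (hE ts hB)]
    simp

end Cfg

section union
variable {T : Type*} [Fintype T]

open scoped Classical in
/-- The probability of an event on histories of length `n`. -/
noncomputable def histPr (Q : List T → T → ℝ) (n : ℕ) (B : List T → Prop) : ℝ :=
  ∑ t : Fin n → T, histProd Q (List.ofFn t) * (if B (List.ofFn t) then 1 else 0)

theorem histPr_or_le {Q : List T → T → ℝ} (hQ : ∀ past t, 0 ≤ Q past t) (n : ℕ)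
    (B B' : List T → Prop) :
    histPr Q n (fun l => B l ∨ B' l) ≤ histPr Q n B + histPr Q n B' := by
  unfold histPr
  rw [← sum_add_distrib]
  refine sum_le_sum fun t _ => ?_
  have h0 := histProd_nonneg hQ (List.ofFn t)
  rw [← mul_add]
  refine mul_le_mul_of_nonneg_left ?_ h0
  by_cases h1 : B (List.ofFn t) <;> by_cases h2 : B' (List.ofFn t) <;> simp [h1, h2]

theorem histPr_exists_le {ι : Type*} [Fintype ι] {Q : List T → T → ℝ}
    (hQ : ∀ past t, 0 ≤ Q past t) {D : ι → List T → T → ℝ}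
    (hD : ∀ i past, ∑ t, Q past t * Real.exp (D i past t) ≤ 1) (n : ℕ) (L : ℝ) :
    histPr Q n (fun l => ∃ i, L < histSum (D i) l) ≤ Fintype.card ι * Real.exp (-L) := by
  have h : ∀ i, _ := fun i => sum_histProd_tail_le hQ (hD i) n L
  have h2 := sum_le_sum fun i (_ : i ∈ univ) => h i
  rw [sum_const, card_univ, nsmul_eq_mul, sum_comm] at h2
  refine le_trans (sum_le_sum fun t _ => ?_) h2
  rw [← mul_sum]
  refine mul_le_mul_of_nonneg_left ?_ (histProd_nonneg hQ _)
  split_ifs with h3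
  · obtain ⟨i, hi⟩ := h3
    have := single_le_sum (f := fun i => if L < histSum (D i) (List.ofFn t) then (1 : ℝ) else 0)
      (fun i _ => by split_ifs <;> norm_num) (mem_univ i)
    rwa [if_pos hi] at this
  · exact sum_nonneg fun i _ => by split_ifs <;> norm_num

end union

namespace Cfg
variable {H : ℕ} (c : Cfg S A H)

/-! ### Concentration of the empirical transitions -/

theorem expec_visit_le {p : ℕ → Fin S → Fin A → Fin S → ℝ} (hp : ∀ j, IsKernel (p j))
    {P : c.Det → ℝ} (hP : ∀ π, 0 ≤ P π) (hP1 : ∑ π, P π = 1) {j : ℕ} (hj : j + 1 < H)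
    (s : Fin S) (a : Fin A) {g : Fin S → ℝ} (hg : ∑ x, p j s a x * Real.exp (g x) ≤ 1)
    (d : Fin S × Fin A) :
    c.expec p P (fun L => Real.exp (if L.getD j d = (s, a) then g (L.getD (j + 1) d).1 else 0)) ≤
      1 := by
  refine le_of_le_of_eq ?_ hP1
  refine sum_le_sum fun π _ => mul_le_of_le_one_right (hP π) ?_
  obtain ⟨n, rfl⟩ : ∃ n, H = j + (n + 1 + 1) := ⟨H - j - 2, by omega⟩
  rw [pathSum_append]
  have h1 := sum_polK_eq_one hp (c.pol π)
  have h0 := polK_nonneg (fun j => (hp j).1) (c.pol π)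
  refine le_of_le_of_eq (pathSum_mono h0 (G := fun _ _ => 1) fun l x hl _ => ?_)
    (pathSum_const _ _ _ _ h1)
  rw [pathSum]
  have h2 : ∀ a' x', pathSum (polK p (c.pol π)) (n + 1) (0 + j + 1) x' (fun l' _ => Real.exp
      (if (l ++ (x, a') :: l').getD j d = (s, a) then
        g ((l ++ (x, a') :: l').getD (j + 1) d).1 else 0)) =
      Real.exp (if (x, a') = (s, a) then g x' else 0) := by
    intro a' x'
    rw [← pathSum_const (W := polK p (c.pol π)) (n + 1) (0 + j + 1) x' (Real.exp _) h1]
    refine pathSum_congr _ fun l' y hl' hy => ?_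
    rw [List.getD_append_right _ _ _ _ (by omega), List.getD_append_right _ _ _ _ (by omega)]
    obtain ⟨z, l', rfl⟩ := List.exists_cons_of_length_eq_add_one hl'
    have hz : z.1 = x' := hy
    subst hl
    simp [hz]
  simp only [h2]
  refine le_of_le_of_eq (sum_le_sum fun a' _ => ?_) (sum_detW (c.pol π) j x)
  simp only [polK, zero_add, mul_assoc, ← mul_sum]
  refine mul_le_of_le_one_right (detW_nonneg _ _ _ _) ?_
  by_cases h : (x, a') = (s, a)
  · simp only [if_pos h]
    simp only [Prod.mk.injEq] at h
    rw [h.1, h.2]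
    exact hg
  · simp only [if_neg h, Real.exp_zero, mul_one, (hp j).2, le_refl]

/-- The increments of the exponential supermartingale that controls the number of transitions to
`x` over the first `m` visits to `(j, s, a)`. -/
noncomputable def visitD (q θ σ : ℝ) (m : ℝ) (j : ℕ) (s : Fin S) (a : Fin A) (x : Fin S)
    (past : List (BanditObs S A H)) (o : BanditObs S A H) : ℝ :=
  if c.cntN past j s a < m then
    if (List.ofFn o.1).getD j (c.s0, c.a0) = (s, a) then
      σ * θ * (if ((List.ofFn o.1).getD (j + 1) (c.s0, c.a0)).1 = x then 1 else 0) -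
        (σ * θ + θ ^ 2) * q
    else 0
  else 0

theorem histSum_visitD (q θ σ : ℝ) {m : ℝ} (j : ℕ) (s : Fin S) (a : Fin A) (x : Fin S)
    (past : List (BanditObs S A H)) (h : c.cntN past j s a ≤ m) :
    histSum (c.visitD q θ σ m j s a x) past =
      σ * θ * c.cntC past j s a x - (σ * θ + θ ^ 2) * q * c.cntN past j s a := by
  induction past with
  | nil => simp [histSum, cntC, cntN]
  | cons o past ih =>
    rw [cntN] at h ⊢
    rw [histSum, cntC, visitD]
    split_ifs at h ⊢ <;> try (first | linarith | tauto)
    all_goals (rw [ih (by linarith)]; ring)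

theorem cntN_le_append (l past : List (BanditObs S A H)) (j : ℕ) (s : Fin S) (a : Fin A) :
    c.cntN past j s a ≤ c.cntN (l ++ past) j s a := by
  induction l with
  | nil => exact le_rfl
  | cons o l ih =>
    rw [List.cons_append, cntN]
    split_ifs <;> linarith

theorem histSum_visitD_append (q θ σ : ℝ) (j : ℕ) (s : Fin S) (a : Fin A) (x : Fin S)
    (l past : List (BanditObs S A H)) :
    histSum (c.visitD q θ σ (c.cntN past j s a) j s a x) (l ++ past) =
      histSum (c.visitD q θ σ (c.cntN past j s a) j s a x) past := by
  induction l with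
  | nil => rfl
  | cons o l ih =>
    rw [List.cons_append, histSum, ih, visitD, if_neg, add_zero]
    exact not_lt.2 (c.cntN_le_append l past j s a)

theorem exists_cntN_eq (past : List (BanditObs S A H)) (j : ℕ) (s : Fin S) (a : Fin A) :
    ∃ m : ℕ, m ≤ past.length ∧ c.cntN past j s a = m := by
  induction past with
  | nil => exact ⟨0, le_rfl, by simp [cntN]⟩
  | cons o past ih =>
    obtain ⟨m, hm, e⟩ := ih
    rw [cntN, e]
    split_ifs
    · exact ⟨m + 1, by simpa using hm, by push_cast; rfl⟩
    · exact ⟨m, by simp; omega, by simp⟩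

/-- The confidence sets are valid if all the visit supermartingales stay small. -/
theorem conf_of_visitD {pb : ℕ → Fin S → Fin A → Fin S → ℝ} (hp : ∀ j s a x, 0 ≤ pb j s a x)
    (l past : List (BanditObs S A H))
    (h : ∀ (m : Fin (past.length + 1)) (j : Fin H) (s : Fin S) (a : Fin A) (x : Fin S) (σ : ℝ),
      (σ = 1 ∨ σ = -1) → c.off j →
      histSum (c.visitD (pb j s a x) (c.rad m) σ m j s a x) (l ++ past) ≤ c.L0) :
    c.conf past pb := by
  refine c.conf_of_bounds past hp fun j hj s a x hθ => ?_
  obtain ⟨m, hm, e⟩ := c.exists_cntN_eq past j s a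
  have key : ∀ σ : ℝ, (σ = 1 ∨ σ = -1) →
      σ * c.thet past j s a * c.cntC past j s a x -
        (σ * c.thet past j s a + c.thet past j s a ^ 2) * pb j s a x * c.cntN past j s a ≤ c.L0 := by
    intro σ hσ
    have := h ⟨m, by omega⟩ ⟨j, by have := hj.1; omega⟩ s a x σ hσ hj
    simp only [← e] at this
    rwa [histSum_visitD_append, histSum_visitD _ _ _ _ _ _ _ _ _ le_rfl] at this
  have k1 := key 1 (Or.inl rfl)
  have k2 := key (-1) (Or.inr rfl)
  have hn : S * c.L0 < c.cntN past j s a := by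
    by_contra hn
    rw [thet, rad, if_neg hn] at hθ
    exact absurd hθ (lt_irrefl _)
  have hS := c.S_pos
  have hSL := c.SL0_ge
  have hn0 : 0 < c.cntN past j s a := by linarith
  have hθ2 : c.thet past j s a ^ 2 * c.cntN past j s a = S * c.L0 := by
    rw [thet, rad, if_pos hn, Real.sq_sqrt (by positivity)]
    field_simp
  have hθ0 : 0 < c.thet past j s a := by
    rw [thet, rad, if_pos hn]; positivity
  unfold phat
  generalize c.cntN past j s a = N at *
  generalize c.thet past j s a = θ at *
  have e2 : θ / S = c.L0 / (θ * N) := by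
    rw [div_eq_div_iff hS.ne' (by positivity)]
    linear_combination hθ2
  rw [e2]
  constructor
  · rw [← sub_nonneg]
    have : c.cntC past j s a x / N + c.L0 / (θ * N) - (1 - θ) * pb j s a x =
      (c.L0 - (-1 * θ * c.cntC past j s a x - (-1 * θ + θ ^ 2) * pb j s a x * N)) / (θ * N) := by
      field_simp; ring
    rw [this]
    exact div_nonneg (by linarith) (by positivity)
  · rw [← sub_nonneg]
    have : (1 + θ) * pb j s a x - (c.cntC past j s a x / N - c.L0 / (θ * N)) =
      (c.L0 - (1 * θ * c.cntC past j s a x - (1 * θ + θ ^ 2) * pb j s a x * N)) / (θ * N) := by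
      field_simp; ring
    rw [this]
    exact div_nonneg (by linarith) (by positivity)

theorem sum_mul_exp_visit_le {q : Fin S → ℝ} (hq : ∀ x, 0 ≤ q x) (hq1 : ∑ x, q x = 1) {θ σ : ℝ}
    (h0 : 0 ≤ θ) (h1 : θ ≤ 1) (hσ : σ = 1 ∨ σ = -1) (x : Fin S) :
    ∑ y, q y * Real.exp (σ * θ * (if y = x then 1 else 0) - (σ * θ + θ ^ 2) * q x) ≤ 1 := by
  have e : ∀ y, q y * Real.exp (σ * θ * (if y = x then 1 else 0) - (σ * θ + θ ^ 2) * q x) =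
      (q y + (if y = x then q y * (Real.exp (σ * θ) - 1) else 0)) *
        Real.exp (-((σ * θ + θ ^ 2) * q x)) := by
    intro y
    split_ifs
    · rw [mul_one, sub_eq_add_neg, Real.exp_add]; ring
    · rw [mul_zero, zero_sub]; ring
  simp only [e, ← sum_mul, sum_add_distrib, hq1, sum_ite_eq', mem_univ, if_true]
  have h2 : Real.exp (σ * θ) - 1 ≤ σ * θ + θ ^ 2 := by
    have h3 := Real.abs_exp_sub_one_sub_id_le (x := σ * θ) (by
      rcases hσ with rfl | rfl <;> simp [abs_of_nonneg h0, h1])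
    have h4 := (abs_le.1 h3).2
    have : (σ * θ) ^ 2 = θ ^ 2 := by rcases hσ with rfl | rfl <;> ring
    linarith
  have h3 : 1 + q x * (Real.exp (σ * θ) - 1) ≤ Real.exp ((σ * θ + θ ^ 2) * q x) := by
    refine le_trans ?_ (Real.add_one_le_exp _)
    nlinarith [mul_le_mul_of_nonneg_left h2 (hq x)]
  calc _ ≤ Real.exp ((σ * θ + θ ^ 2) * q x) * Real.exp (-((σ * θ + θ ^ 2) * q x)) :=
        mul_le_mul_of_nonneg_right h3 (Real.exp_pos _).le
    _ = 1 := by rw [← Real.exp_add]; simp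

theorem sum_QH_exp_visitD_le {p : ℕ → ℕ → Fin S → Fin A → Fin S → ℝ}
    {ℓ : ℕ → ℕ → Fin S → Fin A → ℝ} (hp : ∀ k j, IsKernel (p k j))
    {pb : ℕ → Fin S → Fin A → Fin S → ℝ} {j : ℕ} (hj : c.off j) (hpb : ∀ k, p k j = pb j)
    {θ σ : ℝ} (h0 : 0 ≤ θ) (h1 : θ ≤ 1) (hσ : σ = 1 ∨ σ = -1) (m : ℝ) (s : Fin S) (a : Fin A)
    (x : Fin S) (past : List (Fin H → Fin S × Fin A)) :
    ∑ t, c.QH p ℓ past t * Real.exp (c.visitD (pb j s a x) θ σ m j s a x (obsHist ℓ past)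
      (banditObs H ℓ past.length t)) ≤ 1 := by
  by_cases hm : c.cntN (obsHist ℓ past) j s a < m
  · simp only [visitD, if_pos hm]
    refine (c.sum_QH hp past fun L => Real.exp (if L.getD j (c.s0, c.a0) = (s, a) then
      (fun y => σ * θ * (if y = x then 1 else 0) - (σ * θ + θ ^ 2) * pb j s a x)
        (L.getD (j + 1) (c.s0, c.a0)).1 else 0)).trans_le ?_
    refine c.expec_visit_le (hp _) (c.Pst_simplex _).1 (c.Pst_simplex _).2 hj.1 s a
      (g := fun y => σ * θ * (if y = x then 1 else 0) - (σ * θ + θ ^ 2) * pb j s a x) ?_ _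
    rw [hpb]
    have := hp 0 j
    rw [hpb] at this
    exact sum_mul_exp_visit_le (this.1 s a) (this.2 s a) h0 h1 hσ x
  · simp only [visitD, if_neg hm, Real.exp_zero, mul_one]
    exact (c.sum_QH_one hp past).le

end Cfg

namespace Cfg
variable {H : ℕ} (c : Cfg S A H)

/-! ### The regret against a deterministic policy -/

section increments
variable (p : ℕ → ℕ → Fin S → Fin A → Fin S → ℝ) (ℓ : ℕ → ℕ → Fin S → Fin A → ℝ)
  (pb : ℕ → Fin S → Fin A → Fin S → ℝ)

open scoped Classical in
/-- The increments that compare the loss estimate of a sub-policy with its loss. -/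
noncomputable def estD (i : c.Idx) (past : List (BanditObs S A H)) (o : BanditObs S A H) : ℝ :=
  if c.conf past pb then c.γ * c.est past (c.Pst past) o i -
    c.γ * c.lossW (p past.length) (ℓ past.length) i else 0

/-- The expected killing rate in the next episode. -/
noncomputable def kilH (past : List (BanditObs S A H)) : ℝ :=
  c.kilF past (p past.length) (c.Pst past)

open scoped Classical in
/-- The increments that compare the loss at a layer with its estimate. -/
noncomputable def layD (h : Fin H) (past : List (BanditObs S A H)) (o : BanditObs S A H) : ℝ :=
  if c.conf past pb then
    c.γ * (c.γ * ∑ ω, c.zst past (h, ω) * c.est past (c.Pst past) o (h, ω) ^ 2 -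
      ∑ ω, c.zst past (h, ω) * c.est past (c.Pst past) o (h, ω) +
      c.layerV (p past.length) (c.Pst past) (ℓ past.length) h) -
    c.γ * (4 * c.γ * c.numC + 6 * c.β + 14 * c.kilH p past) else 0

/-- The increments that compare the expected and the realized killing rates. -/
noncomputable def kilD (past : List (BanditObs S A H)) (o : BanditObs S A H) : ℝ :=
  c.kilH p past / (4 * H) - c.kilR past o / (2 * H)

/-- The value of the mixture played in the next episode. -/
noncomputable def valP (past : List (BanditObs S A H)) : ℝ :=
  ∑ h ∈ range H, c.layerV (p past.length) (c.Pst past) (ℓ past.length) h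

/-- The value of a deterministic policy in the next episode. -/
noncomputable def valD (π : c.Det) (past : List (BanditObs S A H)) : ℝ :=
  ∑ h ∈ range H, layerVal (p past.length) (detW (c.pol π)) (ℓ past.length) c.s0 h

end increments

variable {p : ℕ → ℕ → Fin S → Fin A → Fin S → ℝ} {ℓ : ℕ → ℕ → Fin S → Fin A → ℝ}
  {pb : ℕ → Fin S → Fin A → Fin S → ℝ}

theorem conf_congr {past : List (BanditObs S A H)} {q : ℕ → Fin S → Fin A → Fin S → ℝ}
    (h : ∀ j, c.off j → q j = pb j) (hc : c.conf past pb) : c.conf past q := by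
  intro j hj
  rw [h j hj]
  exact hc j hj

theorem zst_mem_feas {past : List (BanditObs S A H)} (hpb : ∀ j, IsKernel (pb j))
    (hc : c.conf past pb) : (c.zst past, c.Pst past) ∈ c.feas past :=
  (c.sel_spec past (c.wst_pos past) ⟨_, c.comp_mem_feas hpb hc fun _ _ => c.a0⟩).1

section bounds
variable (hp : ∀ k j, IsKernel (p k j)) (hpb : ∀ j, IsKernel (pb j))
  (hpp : ∀ k j, c.off j → p k j = pb j) (hℓ : ∀ k, IsLoss H (ℓ k))
include hp hpp hℓ

theorem sum_QH_exp_estD_le (i : c.Idx) (past : List (Fin H → Fin S × Fin A)) :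
    ∑ t, c.QH p ℓ past t * Real.exp (c.estD p ℓ pb i (obsHist ℓ past)
      (banditObs H ℓ past.length t)) ≤ 1 := by
  by_cases hc : c.conf (obsHist ℓ past) pb
  · simp only [estD, if_pos hc, length_obsHist, banditObs, est_eq]
    have h1 := c.expec_exp_est_le (obsHist ℓ past) (hp past.length)
      (c.conf_congr (hpp _) hc) (hℓ past.length) (c.Pst_simplex _).1
      (c.Pst_simplex (obsHist ℓ past)).2 i
    rw [← PH, ← c.sum_QH (ℓ := ℓ) hp] at h1
    simp only [Real.exp_sub, ← mul_div_assoc, ← sum_div]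
    exact div_le_one_of_le₀ h1 (Real.exp_pos _).le
  · simp only [estD, if_neg hc, Real.exp_zero, mul_one]
    exact (c.sum_QH_one hp past).le

include hpb

theorem sum_QH_exp_layD_le (h : Fin H) (past : List (Fin H → Fin S × Fin A)) :
    ∑ t, c.QH p ℓ past t * Real.exp (c.layD p ℓ pb h (obsHist ℓ past)
      (banditObs H ℓ past.length t)) ≤ 1 := by
  by_cases hc : c.conf (obsHist ℓ past) pb
  · simp only [layD, if_pos hc, length_obsHist, banditObs, est_eq, kilH]
    have h1 := c.expec_exp_layer_le (obsHist ℓ past) (hp past.length)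
      (c.conf_congr (hpp _) hc) (hℓ past.length) (c.zst_mem_feas hpb hc) h
    rwa [← PH, ← c.sum_QH (ℓ := ℓ) hp] at h1
  · simp only [layD, if_neg hc, Real.exp_zero, mul_one]
    exact (c.sum_QH_one hp past).le

theorem valP_sub_valD_le (π : c.Det) {past : List (BanditObs S A H)} (hc : c.conf past pb)
    (o : BanditObs S A H) :
    c.γ * (c.valP p ℓ past - c.valD p ℓ π past) ≤ ∑ h, c.layD p ℓ pb h past o +
      c.γ * c.gap (c.comp pb (c.pol π)) past o +
      ∑ i, c.comp pb (c.pol π) i * c.estD p ℓ pb i past o +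
      c.γ * (H * (4 * c.γ * c.numC + 7 * c.β + 14 * c.kilH p past)) := by
  have h1 : ∀ h : Fin H, _ := fun h => c.sum_comp_lossW_le hpb (hp past.length) (hpp _)
    (hℓ past.length) π h
  have h2 := sum_le_sum fun h (_ : h ∈ univ) => h1 h
  rw [← Fintype.sum_prod_type', sum_add_distrib, sum_const, card_univ, Fintype.card_fin,
    nsmul_eq_mul] at h2
  simp only [layD, estD, if_pos hc, gap, valP, valD, Finset.sum_range]
  simp only [mul_add, mul_sub, sum_add_distrib, sum_sub_distrib, Fintype.sum_prod_type,
    sum_const, card_univ, Fintype.card_fin, nsmul_eq_mul, ← mul_sum, mul_left_comm _ c.γ]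
  simp only [Fintype.sum_prod_type] at h2
  nlinarith [mul_le_mul_of_nonneg_left h2 c.γ_pos.le]

theorem histSum_valP_sub_valD_le (π : c.Det) (past : List (BanditObs S A H))
    (hc : c.confAll pb past) :
    c.γ * histSum (fun past _ => c.valP p ℓ past - c.valD p ℓ π past) past ≤
      ∑ h, histSum (c.layD p ℓ pb h) past + c.γ * histSum (c.gap (c.comp pb (c.pol π))) past +
      ∑ i, c.comp pb (c.pol π) i * histSum (c.estD p ℓ pb i) past +
      c.γ * (H * ((4 * c.γ * c.numC + 7 * c.β) * past.length +
        14 * histSum (fun past _ => c.kilH p past) past)) := by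
  induction past with
  | nil => simp [histSum]
  | cons o past ih =>
    have h1 := ih hc.2
    have h2 := c.valP_sub_valD_le hp hpb hpp hℓ π hc.1 o
    simp only [histSum, mul_add, sum_add_distrib, List.length_cons, Nat.cast_add, Nat.cast_one]
      at h1 h2 ⊢
    linarith

end bounds

theorem sum_QH_exp_kilD_le (hp : ∀ k j, IsKernel (p k j)) (past : List (Fin H → Fin S × Fin A)) :
    ∑ t, c.QH p ℓ past t * Real.exp (c.kilD p (obsHist ℓ past)
      (banditObs H ℓ past.length t)) ≤ 1 := by
  have hH : (0 : ℝ) < H := by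
    have := c.hH
    exact_mod_cast (by omega : 0 < H)
  set x : (Fin H → Fin S × Fin A) → ℝ := fun t =>
    c.kilR (obsHist ℓ past) (banditObs H ℓ past.length t) / (2 * H) with hx
  have hF : ∑ t, c.QH p ℓ past t * x t = c.kilH p (obsHist ℓ past) / (2 * H) := by
    simp only [hx, ← mul_div_assoc, ← sum_div, kilH, length_obsHist]
    rw [← PH]
    exact congrArg (· / (2 * (H : ℝ))) (c.sum_QH hp past _)
  have h1 : ∀ t, Real.exp (-x t) ≤ 1 - x t / 2 := by
    intro t
    have h2 : 0 ≤ x t := div_nonneg (c.kilR_nonneg _ _) (by positivity)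
    have h3 : x t ≤ 1 / 2 := by
      rw [hx, div_le_div_iff₀ (by positivity) two_pos]
      have := c.kilR_le (obsHist ℓ past) (banditObs H ℓ past.length t)
      linarith
    nlinarith [exp_neg_le_quadratic h2]
  have h4 : ∑ t, c.QH p ℓ past t * Real.exp (-x t) ≤
      1 - c.kilH p (obsHist ℓ past) / (4 * H) := by
    refine (sum_le_sum fun t _ => mul_le_mul_of_nonneg_left (h1 t)
      (c.QH_nonneg hp past t)).trans_eq ?_
    simp only [mul_sub, mul_one, sum_sub_distrib, c.sum_QH_one hp, ← mul_div_assoc, ← sum_div, hF]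
    ring
  have h5 := h4.trans (Real.one_sub_le_exp_neg _)
  have e : ∀ t, c.kilD p (obsHist ℓ past) (banditObs H ℓ past.length t) =
      -x t - -(c.kilH p (obsHist ℓ past) / (4 * H)) := fun t => by
    rw [kilD, hx]; ring
  simp only [e, Real.exp_sub, ← mul_div_assoc, ← sum_div]
  exact div_le_one_of_le₀ h5 (Real.exp_pos _).le

end Cfg

namespace Cfg
variable {H : ℕ} (c : Cfg S A H)

/-! ### The good event -/

section event
variable (p : ℕ → ℕ → Fin S → Fin A → Fin S → ℝ) (ℓ : ℕ → ℕ → Fin S → Fin A → ℝ)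
  (pb : ℕ → Fin S → Fin A → Fin S → ℝ)

/-- The indices of the visit supermartingales. -/
abbrev VisitIdx (S A H K : ℕ) : Type := Fin K × Bool × Fin H × Fin S × Fin A × Fin S

/-- The increments of the visit supermartingales outside the block. -/
noncomputable def confD {K : ℕ} :
    VisitIdx S A H K → List (BanditObs S A H) → BanditObs S A H → ℝ
  | (m, b, j, s, a, x), past, o =>
    if c.off j then
      c.visitD (pb j s a x) (c.rad m) (if b then 1 else -1) m j s a x past o
    else 0

/-- Increments along observations, as increments along trajectories. -/
noncomputable def onTraj (D : List (BanditObs S A H) → BanditObs S A H → ℝ)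
    (past : List (Fin H → Fin S × Fin A)) (t : Fin H → Fin S × Fin A) : ℝ :=
  D (obsHist ℓ past) (banditObs H ℓ past.length t)

/-- One of the supermartingales exceeds its level. -/
def bad (K : ℕ) (L : ℝ) (l : List (Fin H → Fin S × Fin A)) : Prop :=
  (∃ i : VisitIdx S A H K, c.L0 < histSum (onTraj ℓ (c.confD pb i)) l) ∨
    (∃ i, L < histSum (onTraj ℓ (c.estD p ℓ pb i)) l) ∨
      (∃ h, L < histSum (onTraj ℓ (c.layD p ℓ pb h)) l) ∨
        ∃ _ : Unit, L < histSum (onTraj ℓ (c.kilD p)) l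

end event

variable {p : ℕ → ℕ → Fin S → Fin A → Fin S → ℝ} {ℓ : ℕ → ℕ → Fin S → Fin A → ℝ}
  {pb : ℕ → Fin S → Fin A → Fin S → ℝ} (hp : ∀ k j, IsKernel (p k j))
  (hpb : ∀ j, IsKernel (pb j)) (hpp : ∀ k j, c.off j → p k j = pb j) (hℓ : ∀ k, IsLoss H (ℓ k))
include hp hpb hpp

theorem histPr_bad_le (hℓ : ∀ k, IsLoss H (ℓ k)) (K : ℕ) (L : ℝ) :
    histPr (c.QH p ℓ) K (c.bad p ℓ pb K L) ≤
      2 * K * H * S ^ 2 * A * Real.exp (-c.L0) + H * c.card * Real.exp (-L) +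
        H * Real.exp (-L) + Real.exp (-L) := by
  have hQ := c.QH_nonneg (ℓ := ℓ) hp
  have h1 := histPr_exists_le hQ (D := fun i : VisitIdx S A H K => onTraj ℓ (c.confD pb i))
    (fun i past => by
      obtain ⟨m, b, j, s, a, x⟩ := i
      by_cases hj : c.off j
      · simp only [onTraj, confD, if_pos hj]
        exact c.sum_QH_exp_visitD_le hp hj (fun k => hpp k j hj) (c.rad_nonneg _) (c.rad_le_one _)
          (by cases b <;> simp) _ s a x past
      · simp only [onTraj, confD, if_neg hj, Real.exp_zero, mul_one]
        exact (c.sum_QH_one hp past).le) K c.L0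
  have h2 := histPr_exists_le hQ (D := fun i => onTraj ℓ (c.estD p ℓ pb i))
    (c.sum_QH_exp_estD_le hp hpp hℓ) K L
  have h3 := histPr_exists_le hQ (D := fun h => onTraj ℓ (c.layD p ℓ pb h))
    (c.sum_QH_exp_layD_le hp hpb hpp hℓ) K L
  have h4 := histPr_exists_le hQ (D := fun _ : Unit => onTraj ℓ (c.kilD p))
    (fun _ => c.sum_QH_exp_kilD_le hp) K L
  refine (histPr_or_le hQ K _ _).trans ?_
  refine (add_le_add h1 ((histPr_or_le hQ K _ _).trans (add_le_add h2
    ((histPr_or_le hQ K _ _).trans (add_le_add h3 h4))))).trans_eq ?_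
  simp only [Fintype.card_prod, Fintype.card_fin, Fintype.card_bool, Fintype.card_unit, card,
    Nat.cast_mul, Nat.cast_one, Nat.cast_ofNat]
  ring

omit hp hpp in
theorem confAll_of_not_bad {K : ℕ} {L : ℝ} {l : List (Fin H → Fin S × Fin A)} (hl : l.length ≤ K)
    (h : ¬ c.bad p ℓ pb K L l) : c.confAll pb (obsHist ℓ l) := by
  have h1 : ∀ i : VisitIdx S A H K, histSum (c.confD pb i) (obsHist ℓ l) ≤ c.L0 := by
    intro i
    by_contra h2
    refine h (Or.inl ⟨i, ?_⟩)
    rw [histSum_obsHist] at h2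
    exact not_le.1 h2
  rw [← length_obsHist ℓ l] at hl
  have key : ∀ l1 l2, l1 ++ l2 = obsHist ℓ l → c.confAll pb l2 := by
    intro l1 l2
    induction l2 generalizing l1 with
    | nil => intro _; trivial
    | cons o l2 ih =>
      intro e
      have e' : (l1 ++ [o]) ++ l2 = obsHist ℓ l := by rw [← e]; simp
      refine ⟨c.conf_of_visitD (fun j => (hpb j).1) (l1 ++ [o]) l2 fun m j s a x σ hσ hj => ?_,
        ih _ e'⟩
      have hm : (m : ℕ) < K := by
        have := congrArg List.length e
        simp only [List.length_append, List.length_cons] at this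
        have := m.isLt
        omega
      have := h1 (⟨m, hm⟩, decide (σ = 1), j, s, a, x)
      have e2 : c.confD pb (K := K) (⟨m, hm⟩, decide (σ = 1), j, s, a, x) =
          c.visitD (pb j s a x) (c.rad m) σ m j s a x := by
        funext past o
        rw [confD, if_pos hj]
        rcases hσ with rfl | rfl
        · simp
        · norm_num
      rwa [e2, ← e'] at this
  exact key [] _ rfl

include hℓ

theorem histSum_le_of_not_bad {K : ℕ} {L : ℝ} {l : List (Fin H → Fin S × Fin A)}
    (hl : l.length = K) (h : ¬ c.bad p ℓ pb K L l) (hL : Real.log c.card ≤ L) (π : c.Det) :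
    histSum (fun past _ => c.valP p ℓ past - c.valD p ℓ π past) (obsHist ℓ l) ≤
      3 * H * L / c.γ + H * (4 * c.γ * c.numC + 7 * c.β) * K +
        14 * H * (8 * √(S * c.L0) * (H * √(S * A * K)) + 4 * H * L) := by
  have hc := c.confAll_of_not_bad hpb hl.le h
  have h1 := c.histSum_valP_sub_valD_le hp hpb hpp hℓ π _ hc
  have h2 := c.histSum_gap_le hpb π _ hc (obsHist_nonneg ℓ hℓ l)
  have h3 : ∀ i, histSum (c.estD p ℓ pb i) (obsHist ℓ l) ≤ L := fun i => by
    by_contra h'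
    rw [histSum_obsHist] at h'
    exact h (Or.inr (Or.inl ⟨i, not_le.1 h'⟩))
  have h4 : ∀ i, histSum (c.layD p ℓ pb i) (obsHist ℓ l) ≤ L := fun i => by
    by_contra h'
    rw [histSum_obsHist] at h'
    exact h (Or.inr (Or.inr (Or.inl ⟨i, not_le.1 h'⟩)))
  have h5 : histSum (c.kilD p) (obsHist ℓ l) ≤ L := by
    by_contra h'
    rw [histSum_obsHist] at h'
    exact h (Or.inr (Or.inr (Or.inr ⟨(), not_le.1 h'⟩)))
  have h6 := c.histSum_kilR_le (obsHist ℓ l)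
  have hH : (0 : ℝ) < H := by
    have := c.hH
    exact_mod_cast (by omega : 0 < H)
  have h7 : ∀ past, histSum (c.kilD p) past =
      histSum (fun past _ => c.kilH p past) past / (4 * H) - histSum c.kilR past / (2 * H) := by
    intro past
    induction past with
    | nil => simp [histSum]
    | cons o past ih => simp only [histSum, ih, kilD]; ring
  rw [h7, sub_le_iff_le_add, div_le_iff₀ (by positivity)] at h5
  have h8 : (L + histSum c.kilR (obsHist ℓ l) / (2 * H)) * (4 * H) =
      4 * H * L + 2 * histSum c.kilR (obsHist ℓ l) := by field_simp; ring
  have h9 := sum_le_sum fun i (_ : i ∈ univ) => mul_le_mul_of_nonneg_left (h3 i)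
    ((div_pos c.β_pos c.card_pos).le.trans (c.le_comp (c.pol π) hpb i))
  rw [← sum_mul, c.sum_eq_card (c.sum_comp (c.pol π) hpb)] at h9
  have h10 := sum_le_sum fun i (_ : i ∈ univ) => h4 i
  rw [sum_const, card_univ, Fintype.card_fin, nsmul_eq_mul] at h10
  rw [length_obsHist, hl] at h6 h1
  have h11 := mul_le_mul_of_nonneg_left hL hH.le
  have h12 : H * ((4 * c.γ * c.numC + 7 * c.β) * K +
      14 * histSum (fun past _ => c.kilH p past) (obsHist ℓ l)) ≤
      H * (4 * c.γ * c.numC + 7 * c.β) * K +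
        14 * H * (8 * √(S * c.L0) * (H * √(S * A * K)) + 4 * H * L) := by
    have := mul_le_mul_of_nonneg_left (h5.trans_eq h8) hH.le
    have := mul_le_mul_of_nonneg_left h6 hH.le
    nlinarith
  have h13 := mul_le_mul_of_nonneg_left h12 c.γ_pos.le
  rw [add_assoc, ← sub_le_iff_le_add, le_div_iff₀ c.γ_pos]
  nlinarith

end Cfg


/-! ### From deterministic policies to the benchmark -/

theorem layerVal_nonneg {H : ℕ} {p : ℕ → Fin S → Fin A → Fin S → ℝ} (hp : ∀ j, IsKernel (p j))
    {q : ℕ → Fin S → Fin A → ℝ} (hq : ∀ j s a, 0 ≤ q j s a) {ℓ : ℕ → Fin S → Fin A → ℝ}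
    (hℓ : IsLoss H ℓ) (s0 : Fin S) {h : ℕ} (hh : h < H) : 0 ≤ layerVal p q ℓ s0 h :=
  pathSum_nonneg (fun j _ _ _ => mul_nonneg (hq _ _ _) ((hp j).1 _ _ _)) fun _ _ _ _ =>
    sum_nonneg fun _ _ => mul_nonneg (hq _ _ _) (hℓ _ _ _ hh).1

theorem layerVal_le_one {H : ℕ} {p : ℕ → Fin S → Fin A → Fin S → ℝ} (hp : ∀ j, IsKernel (p j))
    {q : ℕ → Fin S → Fin A → ℝ} (hq : IsPolicy q) {ℓ : ℕ → Fin S → Fin A → ℝ}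
    (hℓ : IsLoss H ℓ) (s0 : Fin S) {h : ℕ} (hh : h < H) : layerVal p q ℓ s0 h ≤ 1 := by
  refine (pathSum_mono (G := fun _ _ => 1)
    (fun j s a x => mul_nonneg (hq.1 _ _ _) ((hp j).1 _ _ _)) fun _ x _ _ => ?_).trans_eq
    (pathSum_const _ _ _ _ fun j s => ?_)
  · exact (sum_le_sum fun a _ => mul_le_of_le_one_right (hq.1 _ _ _) (hℓ _ _ _ hh).2).trans_eq
      (hq.2 _ _)
  · simp only [← mul_sum, (hp j).2, mul_one, hq.2]

theorem isPolicy_detW (f : ℕ → Fin S → Fin A) : IsPolicy (detW f) :=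
  ⟨fun j s a => by unfold detW; split_ifs <;> norm_num, fun j s => by simp [detW]⟩

theorem sub_bestValue_le {H K : ℕ} {p : ℕ → ℕ → Fin S → Fin A → Fin S → ℝ}
    (hp : ∀ k j, IsKernel (p k j)) {ℓ : ℕ → ℕ → Fin S → Fin A → ℝ} {s0 : Fin S} (a0 : Fin A)
    {V X : ℝ} (h : ∀ g : Fin H → Fin S → Fin A,
      V - ∑ k ∈ range K, ∑ h ∈ range H, layerVal (p k) (detW (extPol a0 g)) (ℓ k) s0 h ≤ X) :
    V - bestValue H K p ℓ s0 ≤ X := by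
  rw [sub_le_comm]
  refine le_csInf ⟨_, _, isPolicy_detW fun _ _ => a0, rfl⟩ ?_
  rintro _ ⟨q, hq, rfl⟩
  have h1 : ∑ k ∈ range K, value H (p k) q (ℓ k) s0 = ∑ g : Fin H → Fin S → Fin A,
      (∏ h : Fin H, ∏ s, q h s (g h s)) *
        ∑ k ∈ range K, ∑ h ∈ range H, layerVal (p k) (detW (extPol a0 g)) (ℓ k) s0 h := by
    simp only [mul_sum (s := range K)]
    rw [sum_comm]
    refine sum_congr rfl fun k _ => ?_
    rw [value_eq, layerVal_mixture (hp k) hq.2 (s0, a0)]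
  rw [h1, ← mul_one (V - X), ← sum_mixture_weights hq.2 H, mul_sum]
  refine sum_le_sum fun g _ => ?_
  rw [mul_comm]
  exact mul_le_mul_of_nonneg_left (by linarith [h g])
    (prod_nonneg fun _ _ => prod_nonneg fun _ _ => hq.1 _ _ _)

/-! ### Irrelevance of the transitions out of the last step -/

section extension
variable {H : ℕ} {p p' : ℕ → Fin S → Fin A → Fin S → ℝ}

theorem trajProb_congr (h : ∀ j, j + 1 < H → p j = p' j)
    (σ : List (Fin S × Fin A) → Fin S → Fin A → ℝ) (j : ℕ) (s : Fin S)
    (hist l : List (Fin S × Fin A)) (hl : j + l.length ≤ H) :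
    trajProb p σ j s hist l = trajProb p' σ j s hist l := by
  induction l generalizing j s hist with
  | nil => rfl
  | cons x l ih =>
    obtain ⟨s', a⟩ := x
    cases l with
    | nil => rfl
    | cons y l =>
      obtain ⟨s'', a''⟩ := y
      simp only [List.length_cons] at hl
      simp only [trajProb]
      rw [ih _ _ _ (by simp only [List.length_cons]; omega), h j (by omega)]

theorem trajDist_congr (h : ∀ j, j + 1 < H → p j = p' j)
    (σ : List (Fin S × Fin A) → Fin S → Fin A → ℝ) (s0 : Fin S) :
    trajDist H p σ s0 = trajDist H p' σ s0 :=
  funext fun t => trajProb_congr h _ _ _ _ _ (by simp)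

theorem stateDist_congr (h : ∀ j, j + 1 < H → p j = p' j) (π : ℕ → Fin S → Fin A → ℝ)
    (s0 : Fin S) {j : ℕ} (hj : j < H) : stateDist p π s0 j = stateDist p' π s0 j := by
  induction j with
  | zero => rfl
  | succ j ih => simp only [stateDist, ih (by omega), h j hj]

theorem value_congr (h : ∀ j, j + 1 < H → p j = p' j) (π ℓ : ℕ → Fin S → Fin A → ℝ)
    (s0 : Fin S) : value H p π ℓ s0 = value H p' π ℓ s0 :=
  sum_congr rfl fun j hj => by rw [stateDist_congr h π s0 (mem_range.1 hj)]

end extension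

section extension
variable {H K : ℕ} {p p' : ℕ → ℕ → Fin S → Fin A → Fin S → ℝ} {Obs : Type}

theorem bestValue_congr (h : ∀ k j, j + 1 < H → p k j = p' k j)
    (ℓ : ℕ → ℕ → Fin S → Fin A → ℝ) (s0 : Fin S) :
    bestValue H K p ℓ s0 = bestValue H K p' ℓ s0 := by
  simp only [bestValue, fun k π => value_congr (h k) π (ℓ k) s0]

theorem playedValue_congr (h : ∀ k j, j + 1 < H → p k j = p' k j)
    (alg : Alg S A Obs) (i : ℕ) (ℓ : ℕ → ℕ → Fin S → Fin A → ℝ)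
    (obs : ℕ → (Fin H → Fin S × Fin A) → Obs) (s0 : Fin S)
    (ts : Fin K → Fin H → Fin S × Fin A) :
    playedValue H K alg i p ℓ obs s0 ts = playedValue H K alg i p' ℓ obs s0 ts := by
  simp only [playedValue, stratValue, fun k σ => trajDist_congr (h k) σ s0]

theorem eventProb_congr (h : ∀ k j, j + 1 < H → p k j = p' k j)
    (alg : Alg S A Obs) (obs : ℕ → (Fin H → Fin S × Fin A) → Obs) (s0 : Fin S)
    (E : ℕ → (Fin K → Fin H → Fin S × Fin A) → Prop) :
    eventProb H K alg p obs s0 E = eventProb H K alg p' obs s0 E := by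
  simp only [eventProb, seqProb, fun k σ => trajDist_congr (h k) σ s0]

/-- The transitions, completed by a trivial kernel from the last step on. -/
def extKer (H : ℕ) (s0 : Fin S) (p : ℕ → Fin S → Fin A → Fin S → ℝ) (j : ℕ) :
    Fin S → Fin A → Fin S → ℝ :=
  if j + 1 < H then p j else fun _ _ x => if x = s0 then 1 else 0

theorem isKernel_extKer (s0 : Fin S) {p : ℕ → Fin S → Fin A → Fin S → ℝ} (hp : IsTrans H p)
    (j : ℕ) : IsKernel (extKer H s0 p j) := by
  unfold extKer
  split_ifs with h
  · exact hp j h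
  · exact ⟨fun s a x => by dsimp only; split_ifs <;> norm_num, fun s a => by simp⟩

end extension

namespace Cfg
variable {H : ℕ} (c : Cfg S A H)

/-! ### High-probability regret bound -/

section regret
variable {p : ℕ → ℕ → Fin S → Fin A → Fin S → ℝ} {ℓ : ℕ → ℕ → Fin S → Fin A → ℝ}
  {pb : ℕ → Fin S → Fin A → Fin S → ℝ} (hp : ∀ k j, IsKernel (p k j))
include hp

theorem valH_eq (past : List (Fin H → Fin S × Fin A)) :
    c.valH p ℓ past = c.valP p ℓ (obsHist ℓ past) := by
  unfold valH valP PH layerV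
  rw [stratValue_mixStrat c.pol (hp _) c.a0 (c.Pst_simplex _).1 (c.Pst_simplex _).2,
    length_obsHist, sum_comm]
  simp only [mul_sum]

theorem playedValue_sub_eq {K : ℕ} (i : ℕ) (ts : Fin K → Fin H → Fin S × Fin A) (π : c.Det) :
    playedValue H K c.alg i p ℓ (banditObs H ℓ) c.s0 ts -
        ∑ k ∈ range K, ∑ h ∈ range H, layerVal (p k) (detW (c.pol π)) (ℓ k) c.s0 h =
      histSum (fun past _ => c.valP p ℓ past - c.valD p ℓ π past)
        (obsHist ℓ (List.ofFn ts).reverse) := by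
  have h1 := sum_eq_histSum (fun (past : List (Fin H → Fin S × Fin A)) _ => ∑ h ∈ range H,
    layerVal (p past.length) (detW (c.pol π)) (ℓ past.length) c.s0 h) ts
  simp only [List.length_reverse, List.length_ofFn] at h1
  rw [playedValue_alg, histSum_obsHist, ← Fin.sum_univ_eq_sum_range
    (fun k => ∑ h ∈ range H, layerVal (p k) (detW (c.pol π)) (ℓ k) c.s0 h), h1]
  induction (List.ofFn ts).reverse with
  | nil => simp [histSum]
  | cons t l ih =>
    simp only [histSum]
    rw [← ih, ← c.valH_eq hp, valD, length_obsHist]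
    ring

theorem valP_le (hℓ : ∀ k, IsLoss H (ℓ k)) (past : List (BanditObs S A H)) :
    c.valP p ℓ past ≤ H := by
  refine (sum_le_sum (g := fun _ => (1 : ℝ)) fun h hh => ?_).trans_eq (by simp)
  refine (sum_le_sum fun π _ => mul_le_of_le_one_right ((c.Pst_simplex _).1 π) ?_).trans_eq
    (c.Pst_simplex past).2
  exact layerVal_le_one (hp _) (isPolicy_detW _) (hℓ _) _ (mem_range.1 hh)

theorem valD_nonneg (hℓ : ∀ k, IsLoss H (ℓ k)) (π : c.Det) (past : List (BanditObs S A H)) :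
    0 ≤ c.valD p ℓ π past :=
  sum_nonneg fun _ hh => layerVal_nonneg (hp _) (isPolicy_detW _).1 (hℓ _) _ (mem_range.1 hh)

theorem histSum_le_mul (hℓ : ∀ k, IsLoss H (ℓ k)) (π : c.Det) (l : List (BanditObs S A H)) :
    histSum (fun past _ => c.valP p ℓ past - c.valD p ℓ π past) l ≤ l.length * H := by
  induction l with
  | nil => simp [histSum]
  | cons o l ih =>
    have h1 := c.valP_le hp hℓ l
    have h2 := c.valD_nonneg hp hℓ π l
    simp only [histSum, List.length_cons, Nat.cast_add, Nat.cast_one, add_mul]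
    linarith

theorem regret_le_mul (hℓ : ∀ k, IsLoss H (ℓ k)) {K : ℕ} (i : ℕ)
    (ts : Fin K → Fin H → Fin S × Fin A) :
    playedValue H K c.alg i p ℓ (banditObs H ℓ) c.s0 ts - bestValue H K p ℓ c.s0 ≤ K * H := by
  refine sub_bestValue_le hp c.a0 fun g => ?_
  have h1 := c.histSum_le_mul hp hℓ g (obsHist ℓ (List.ofFn ts).reverse)
  rw [length_obsHist, List.length_reverse, List.length_ofFn] at h1
  exact (c.playedValue_sub_eq hp i ts g).trans_le h1

theorem regret_le (hpb : ∀ j, IsKernel (pb j)) (hpp : ∀ k j, c.off j → p k j = pb j)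
    (hℓ : ∀ k, IsLoss H (ℓ k)) {K : ℕ} {L : ℝ} (hL : Real.log c.card ≤ L) (i : ℕ)
    (ts : Fin K → Fin H → Fin S × Fin A)
    (h : ¬ c.bad p ℓ pb K L (List.ofFn ts).reverse) :
    playedValue H K c.alg i p ℓ (banditObs H ℓ) c.s0 ts - bestValue H K p ℓ c.s0 ≤
      3 * H * L / c.γ + H * (4 * c.γ * c.numC + 7 * c.β) * K +
        14 * H * (8 * √(S * c.L0) * (H * √(S * A * K)) + 4 * H * L) := by
  refine sub_bestValue_le hp c.a0 fun g => ?_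
  exact (c.playedValue_sub_eq hp i ts g).trans_le
    (c.histSum_le_of_not_bad hp hpb hpp hℓ (by simp) h hL g)

theorem le_eventProb_regret (hpb : ∀ j, IsKernel (pb j)) (hpp : ∀ k j, c.off j → p k j = pb j)
    (hℓ : ∀ k, IsLoss H (ℓ k)) {K : ℕ} {L X : ℝ} (hL : Real.log c.card ≤ L)
    (hX : K * H ≤ X ∨ 3 * H * L / c.γ + H * (4 * c.γ * c.numC + 7 * c.β) * K +
        14 * H * (8 * √(S * c.L0) * (H * √(S * A * K)) + 4 * H * L) ≤ X) :
    1 - (2 * K * H * S ^ 2 * A * Real.exp (-c.L0) + H * c.card * Real.exp (-L) +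
        H * Real.exp (-L) + Real.exp (-L)) ≤
      eventProb H K c.alg p (banditObs H ℓ) c.s0 fun i ts =>
        playedValue H K c.alg i p ℓ (banditObs H ℓ) c.s0 ts - bestValue H K p ℓ c.s0 ≤ X := by
  refine le_trans (sub_le_sub_left (c.histPr_bad_le hp hpb hpp hℓ K L) 1)
    (c.le_eventProb hp K fun ts h => ?_)
  rcases hX with hX | hX
  · exact (c.regret_le_mul hp hℓ 0 ts).trans hX
  · exact (c.regret_le hp hpb hpp hℓ hL 0 ts h).trans hX

end regret

end Cfg



/-! ### Tuning of the parameters -/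

section tuning
variable {s a h k n : ℝ} (hs : 1 ≤ s) (ha : 1 ≤ a) (hh : 1 ≤ h) (hk : 1 ≤ k)
include hs ha hh hk

theorem failure_le {δ d : ℝ} (h0 : 0 < δ) (h1 : δ ≤ 1) (hd : 1 ≤ d) :
    2 * k * h * s ^ 2 * a * Real.exp (-(3 * (1 + Real.log (k * s * a * h / δ)))) +
        h * d * Real.exp (-Real.log (h * d / δ)) + h * Real.exp (-Real.log (h * d / δ)) +
        Real.exp (-Real.log (h * d / δ)) ≤ 9 * δ := by
  have hx : 1 ≤ k * s * a * h :=
    one_le_mul_of_one_le_of_one_le (one_le_mul_of_one_le_of_one_le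
      (one_le_mul_of_one_le_of_one_le hk hs) ha) hh
  have hx0 : 0 < k * s * a * h := by linarith
  have e1 : Real.exp (-Real.log (h * d / δ)) = δ / (h * d) := by
    rw [Real.exp_neg, Real.exp_log (by positivity), inv_div]
  have e2 : Real.exp (-(3 * (1 + Real.log (k * s * a * h / δ)))) ≤ (δ / (k * s * a * h)) ^ 3 := by
    have : (δ / (k * s * a * h)) ^ 3 = Real.exp (-(3 * Real.log (k * s * a * h / δ))) := by
      rw [Real.exp_neg, mul_comm (3 : ℝ), Real.exp_mul, Real.exp_log (by positivity), ← inv_div]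
      norm_cast
      exact inv_pow _ _
    rw [this]
    exact Real.exp_le_exp.2 (by linarith)
  have e3 : 2 * k * h * s ^ 2 * a * (δ / (k * s * a * h)) ^ 3 ≤ 2 * δ := by
    have e4 : 2 * k * h * s ^ 2 * a * (δ / (k * s * a * h)) ^ 3 =
        2 * δ * (δ ^ 2 / (k * a * h * (k * s * a * h))) := by field_simp
    rw [e4]
    refine mul_le_of_le_one_right (by positivity) (div_le_one_of_le₀ ?_ (by positivity))
    refine (pow_le_one₀ h0.le h1).trans (one_le_mul_of_one_le_of_one_le ?_ hx)
    exact one_le_mul_of_one_le_of_one_le (one_le_mul_of_one_le_of_one_le hk ha) hh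
  have e5 : h * d * (δ / (h * d)) = δ := by field_simp
  have e6 : h * (δ / (h * d)) ≤ δ := by
    rw [show h * (δ / (h * d)) = δ / d by field_simp]
    exact div_le_self h0.le hd
  have e7 : δ / (h * d) ≤ δ := div_le_self h0.le (one_le_mul_of_one_le_of_one_le hh hd)
  have e8 := mul_le_mul_of_nonneg_left e2
    (show 0 ≤ 2 * k * h * s ^ 2 * a by positivity)
  rw [e1]
  linarith

theorem tuned_bound_le (hn : 1 ≤ n) {ι L : ℝ} (hι : 1 ≤ ι) (hL : L ≤ 2 * s * ι) :
    3 * h * L / (1 / √(s * k * n)) +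
          h * (4 * (1 / √(s * k * n)) * (s ^ 2 * n) + 7 * (1 / k)) * k +
        14 * h * (8 * √(s * (3 * ι)) * (h * √(s * a * k)) + 4 * h * L) ≤
      400 * ι * (h * √(k * s ^ 3 * n) + h ^ 3 * s ^ 2 * a + √(h ^ 4 * s ^ 2 * a * k)) := by
  have p1 : √(k * s ^ 3 * n) = s * √(s * k * n) := by
    rw [show k * s ^ 3 * n = s ^ 2 * (s * k * n) by ring, Real.sqrt_mul (by positivity),
      Real.sqrt_sq (by linarith)]
  have p2 : √(s * (3 * ι)) * √(s * a * k) * h ^ 2 ≤ 3 * ι * √(h ^ 4 * s ^ 2 * a * k) := by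
    rw [← Real.sqrt_mul (by positivity), ← Real.sqrt_sq (show 0 ≤ h ^ 2 by positivity),
      ← Real.sqrt_mul (by positivity), ← Real.sqrt_sq (show 0 ≤ 3 * ι by positivity),
      ← Real.sqrt_mul (by positivity), Real.sqrt_sq (show 0 ≤ 3 * ι by positivity)]
    refine Real.sqrt_le_sqrt ?_
    have : 0 ≤ (h ^ 4 * s ^ 2 * a * k) * (3 * ι * (3 * ι - 1)) :=
      mul_nonneg (by positivity) (mul_nonneg (by positivity) (by linarith))
    nlinarith
  have p3 : 1 ≤ √(s * k * n) := Real.one_le_sqrt.2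
    (one_le_mul_of_one_le_of_one_le (one_le_mul_of_one_le_of_one_le hs hk) hn)
  have p4 : 1 / √(s * k * n) * (s ^ 2 * n) * k = s * √(s * k * n) := by
    have := Real.mul_self_sqrt (show 0 ≤ s * k * n by positivity)
    field_simp
    nlinarith
  have p5 : 7 * (1 / k) * k = 7 := by field_simp
  set r := √(s * k * n)
  have q1 : 3 * h * L / (1 / r) ≤ 6 * ι * (h * (s * r)) := by
    rw [div_div_eq_mul_div, div_one]
    have := mul_le_mul_of_nonneg_left hL (show 0 ≤ 3 * h * r by positivity)
    linarith
  have q2 : h * (4 * (1 / r) * (s ^ 2 * n) + 7 * (1 / k)) * k = 4 * (h * (s * r)) + 7 * h := by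
    linear_combination 4 * h * p4 + h * p5
  have q3 : h ≤ h * (s * r) :=
    le_mul_of_one_le_right (by positivity) (one_le_mul_of_one_le_of_one_le hs p3)
  have q4 : h * (s * r) ≤ ι * (h * (s * r)) := le_mul_of_one_le_left (by positivity) hι
  have q5 : h ^ 2 * L ≤ 2 * ι * (h ^ 3 * s ^ 2 * a) := by
    have h1 := mul_le_mul_of_nonneg_left hL (show 0 ≤ h ^ 2 by positivity)
    have h2 : 1 ≤ h * s * a :=
      one_le_mul_of_one_le_of_one_le (one_le_mul_of_one_le_of_one_le hh hs) ha
    have h3 := mul_le_mul_of_nonneg_left h2 (show 0 ≤ 2 * ι * h ^ 2 * s by positivity)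
    linarith
  have t1 : 0 ≤ ι * (h * (s * r)) := by positivity
  have t2 : 0 ≤ ι * (h ^ 3 * s ^ 2 * a) := by positivity
  have t3 : 0 ≤ ι * √(h ^ 4 * s ^ 2 * a * k) := by positivity
  rw [p1, q2]
  linarith

theorem mul_le_tuned_bound (hn : k ≤ n) {ι : ℝ} (hι : 1 ≤ ι) :
    k * h ≤
      400 * ι * (h * √(k * s ^ 3 * n) + h ^ 3 * s ^ 2 * a + √(h ^ 4 * s ^ 2 * a * k)) := by
  have h1 : k ≤ √(k * s ^ 3 * n) := by
    refine Real.le_sqrt_of_sq_le ?_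
    have h2 := mul_le_mul (one_le_pow₀ hs (n := 3)) hn (by linarith) (by positivity)
    have h3 := mul_le_mul_of_nonneg_left h2 (show 0 ≤ k by linarith)
    linarith
  have h4 : k * h ≤ h * √(k * s ^ 3 * n) := by
    rw [mul_comm]; exact mul_le_mul_of_nonneg_left h1 (by linarith)
  have h5 : 0 ≤ h ^ 3 * s ^ 2 * a + √(h ^ 4 * s ^ 2 * a * k) := by positivity
  refine le_trans ?_ (le_mul_of_one_le_left (by positivity) (by linarith))
  linarith

end tuning

namespace Cfg
variable {H : ℕ} (c : Cfg S A H)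

theorem one_le_card : 1 ≤ c.card := by
  have h := c.card_pos
  unfold card at h ⊢
  exact_mod_cast h

theorem card_eq : c.card = S * (((A : ℝ) ^ (c.lam + 1)) ^ S * (S * A) ^ S) := by
  simp only [card, Fintype.card_prod, Fintype.card_pi, prod_const, card_univ, Fintype.card_fin]
  push_cast
  rw [← pow_mul, ← pow_mul, mul_comm S]

theorem log_card_le {K : ℕ} (hS : 1 ≤ S) (hA : 1 ≤ A) (hH : 1 ≤ H) (hK : A ^ (c.lam + 1) ≤ K)
    {δ : ℝ} (h0 : 0 < δ) (h1 : δ ≤ 1) :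
    Real.log (H * c.card / δ) ≤ 2 * S * (1 + Real.log ((K : ℝ) * S * A * H / δ)) := by
  have hS' : (1 : ℝ) ≤ S := by exact_mod_cast hS
  have hA' : (1 : ℝ) ≤ A := by exact_mod_cast hA
  have hH' : (1 : ℝ) ≤ H := by exact_mod_cast hH
  have hN : (A : ℝ) ^ (c.lam + 1) ≤ K := by exact_mod_cast hK
  have hK' : (1 : ℝ) ≤ K := (one_le_pow₀ hA').trans hN
  set u := (K : ℝ) * S * A * H / δ
  have hu1 : (K : ℝ) * S * A ≤ u := by
    rw [le_div_iff₀ h0]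
    exact mul_le_mul_of_nonneg_left (h1.trans hH') (by positivity)
  have hu2 : (H : ℝ) * S / δ ≤ u := by
    refine div_le_div_of_nonneg_right ?_ h0.le
    have h2 : 1 ≤ (K : ℝ) * A := one_le_mul_of_one_le_of_one_le hK' hA'
    have h3 := mul_le_mul_of_nonneg_left h2 (show 0 ≤ (H : ℝ) * S by positivity)
    linarith
  have hu : 1 ≤ u := (one_le_mul_of_one_le_of_one_le (one_le_mul_of_one_le_of_one_le hK' hS')
    hA').trans hu1
  have h2 : H * c.card / δ ≤ u ^ (S + 1) := by
    rw [c.card_eq, ← mul_pow, ← mul_assoc, mul_div_right_comm, pow_succ, mul_comm]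
    refine mul_le_mul (pow_le_pow_left₀ (by positivity) ?_ _) hu2 (by positivity)
      (pow_nonneg (by linarith) _)
    rw [← mul_assoc]
    exact (mul_le_mul_of_nonneg_right (mul_le_mul_of_nonneg_right hN (by positivity))
      (by positivity)).trans hu1
  have h3 := Real.log_le_log (by have := c.card_pos; positivity) h2
  rw [Real.log_pow] at h3
  have h4 := Real.log_nonneg hu
  have h5 := mul_le_mul_of_nonneg_right hS' h4
  push_cast at h3
  linarith

/-- The configuration with the tuned parameters. -/
noncomputable def tuned (s0 : Fin S) (a0 : Fin A) (h1 lam K : ℕ) (hH : h1 + lam < H) (hK : 1 ≤ K)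
    (δ : ℝ) : Cfg S A H where
  s0 := s0
  a0 := a0
  h1 := h1
  lam := lam
  hH := hH
  γ := 1 / √((S : ℝ) * K * (A : ℝ) ^ (lam + 1))
  β := 1 / K
  L0 := max 1 (3 * (1 + Real.log ((K : ℝ) * S * A * H / δ)))
  γ_pos := by
    have := s0.pos
    have := a0.pos
    positivity
  β_pos := by positivity
  β_le := by
    rw [one_div]
    exact inv_le_one_of_one_le₀ (by exact_mod_cast hK)
  L0_ge := le_max_left _ _

theorem tuned_regret (s0 : Fin S) (a0 : Fin A) {h1 lam K : ℕ} (hH : h1 + lam < H) (hK : 1 ≤ K)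
    {p : ℕ → ℕ → Fin S → Fin A → Fin S → ℝ} {ℓ : ℕ → ℕ → Fin S → Fin A → ℝ}
    (hp : ∀ k, IsTrans H (p k)) (hℓ : ∀ k, IsLoss H (ℓ k))
    (hpp : ∀ k k' j, j + 1 < H → ¬ (h1 ≤ j ∧ j < h1 + lam) → p k j = p k' j)
    {δ : ℝ} (hδ0 : 0 < δ) (hδ1 : δ < 1) :
    1 - 9 * δ ≤ eventProb H K (tuned s0 a0 h1 lam K hH hK δ).alg p (banditObs H ℓ) s0 fun i ts =>
      playedValue H K (tuned s0 a0 h1 lam K hH hK δ).alg i p ℓ (banditObs H ℓ) s0 ts -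
          bestValue H K p ℓ s0 ≤
        400 * (1 + Real.log ((K : ℝ) * S * A * H / δ)) *
          ((H : ℝ) * √((K : ℝ) * (S : ℝ) ^ 3 * (A : ℝ) ^ (lam + 1)) +
            (H : ℝ) ^ 3 * (S : ℝ) ^ 2 * A + √((H : ℝ) ^ 4 * (S : ℝ) ^ 2 * A * K)) := by
  have hS : 1 ≤ S := s0.pos
  have hA : 1 ≤ A := a0.pos
  have hH1 : 1 ≤ H := by omega
  have hS' : (1 : ℝ) ≤ S := by exact_mod_cast hS
  have hA' : (1 : ℝ) ≤ A := by exact_mod_cast hA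
  have hH' : (1 : ℝ) ≤ H := by exact_mod_cast hH1
  have hK' : (1 : ℝ) ≤ K := by exact_mod_cast hK
  set c := tuned s0 a0 h1 lam K hH hK δ with hc
  have hι : 1 ≤ 1 + Real.log ((K : ℝ) * S * A * H / δ) := by
    have h2 : 1 ≤ (K : ℝ) * S * A * H :=
      one_le_mul_of_one_le_of_one_le (one_le_mul_of_one_le_of_one_le
        (one_le_mul_of_one_le_of_one_le hK' hS') hA') hH'
    have := Real.log_nonneg ((one_le_div hδ0).2 (hδ1.le.trans h2))
    linarith
  have hL0 : c.L0 = 3 * (1 + Real.log ((K : ℝ) * S * A * H / δ)) := max_eq_right (by linarith)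
  have hq : ∀ k j, j + 1 < H → p k j = extKer H s0 (p k) j := fun k j hj => (if_pos hj).symm
  have hpq : ∀ k j, c.off j → extKer H s0 (p k) j = extKer H s0 (p 0) j := by
    intro k j hj
    simp only [extKer, if_pos hj.1]
    exact hpp _ _ _ hj.1 hj.2
  have hlog : Real.log c.card ≤ Real.log (H * c.card / δ) := by
    refine Real.log_le_log c.card_pos ?_
    rw [le_div_iff₀ hδ0, mul_comm]
    exact mul_le_mul_of_nonneg_right (hδ1.le.trans hH') c.card_pos.le
  rw [eventProb_congr hq]
  simp only [playedValue_congr hq, bestValue_congr hq]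
  refine le_trans (sub_le_sub_left ?_ 1) (c.le_eventProb_regret
    (fun k j => isKernel_extKer s0 (hp k) j) (fun j => isKernel_extKer s0 (hp 0) j) hpq hℓ hlog ?_)
  · rw [hL0]
    exact failure_le hS' hA' hH' hK' hδ0 hδ1.le c.one_le_card
  · rcases le_total (A ^ (lam + 1)) K with h2 | h2
    · right
      rw [hL0]
      exact tuned_bound_le hS' hA' hH' hK' (one_le_pow₀ hA') hι
        (c.log_card_le hS hA hH1 h2 hδ0 hδ1.le)
    · left
      exact mul_le_tuned_bound hS' hA' hH' hK' (by exact_mod_cast h2) hι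

end Cfg

/-- **Regret of the sub-policy based `COMSP-OMD`**.  There are a universal
constant `C > 0` and a polylogarithmic factor `(1 + log(K·S·A·H/δ))^n` such
that, in the partially adversarial setting in which the `λ` adversarial steps
form a known consecutive block `{h̃₁, …, h̃₂ − 1}` (with `h̃₂ = h̃₁ + λ`), and
with bandit feedback, the algorithm `COMSP-OMD` (with
`η = γ = 1/√(S·K·A^{λ+1})`, depending on the confidence parameter `δ`)
guarantees: for every `δ ∈ (0,1)`, with probability at least `1 − 9δ`,
`R_K ≤ C·L·(H·√(K·S³·A^{λ+1}) + H³·S²·A + √(H⁴·S²·A·K))`. -/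
theorem comsp_omd_regret :
    ∃ C : ℝ, 0 < C ∧ ∃ n : ℕ,
      ∀ (S A H K lam : ℕ), 1 ≤ S → 2 ≤ A → 1 ≤ H → 1 ≤ K →
      ∀ (sinit : Fin S) (h₁ : ℕ) (Λ : Finset ℕ),
        -- the adversarial steps form the consecutive block {h₁, …, h₁ + λ − 1}
        Λ = Finset.Ico h₁ (h₁ + lam) → Λ ⊆ Finset.range (H - 1) → Λ.card = lam →
      ∃ algOf : ℝ → Alg S A (BanditObs S A H),
        ∀ (p : ℕ → ℕ → Fin S → Fin A → Fin S → ℝ)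
          (ℓ : ℕ → ℕ → Fin S → Fin A → ℝ),
          (∀ k, IsTrans H (p k)) → (∀ k, IsLoss H (ℓ k)) →
          -- partially adversarial transitions: stationary off `Λ`
          (∃ pstat : ℕ → Fin S → Fin A → Fin S → ℝ,
            ∀ k h, h ∉ Λ → p k h = pstat h) →
          ∀ δ : ℝ, 0 < δ → δ < 1 →
            1 - 9 * δ ≤
              eventProb H K (algOf δ) p (banditObs H ℓ) sinit
                (fun i ts =>
                  playedValue H K (algOf δ) i p ℓ (banditObs H ℓ) sinit ts -
                      bestValue H K p ℓ sinit ≤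
                    C * (1 + Real.log ((K : ℝ) * S * A * H / δ)) ^ n *
                      ((H : ℝ) *
                          Real.sqrt ((K : ℝ) * (S : ℝ) ^ 3 * (A : ℝ) ^ (lam + 1)) +
                        (H : ℝ) ^ 3 * (S : ℝ) ^ 2 * A +
                        Real.sqrt ((H : ℝ) ^ 4 * (S : ℝ) ^ 2 * A * K))) := by
  refine ⟨400, by norm_num, 1, ?_⟩
  rintro S A H K lam - hA hH hK sinit h₁ _ rfl hΛ -
  have hb : (if lam = 0 then 0 else h₁) + lam < H := by
    split_ifs with h
    · omega
    · have := mem_range.1 (hΛ (mem_Ico.2 ⟨Nat.le_add_right h₁ (lam - 1), by omega⟩))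
      omega
  refine ⟨fun δ => (Cfg.tuned sinit ⟨0, by omega⟩ _ lam K hb hK δ).alg, ?_⟩
  rintro p ℓ hp hℓ ⟨pstat, hstat⟩ δ hδ0 hδ1
  simp only [pow_one]
  refine Cfg.tuned_regret sinit _ hb hK hp hℓ (fun k k' j _ hj => ?_) hδ0 hδ1
  have hj' : j ∉ Ico h₁ (h₁ + lam) := by
    rw [mem_Ico]
    split_ifs at hj with h <;> omega
  rw [hstat k j hj', hstat k' j hj']

end AdvMDP
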